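/- arXiv:2312.12335 — 2 statements merged into one kernel-verified Lean document; each statement's English description precedes it below -/
import Mathlib

section
/- (Identifiability of Grassmannian secants.) Let 1 ≤ d ≤ n, set N := d*(n−d)+1, and let m ≥ 1. If N * (m + 1 + N) ≤ choose n d, then Gr(d,n) is m-identifiable: there is a dense open subset O of σ_m Gr(d,n) such that every p ∈ O can be written as p = x₁ + ⋯ + x_m with all xᵢ ∈ Gr(d,n), and any two such representations agree up to a permutation of the m summands. -/
noncomputable section

/-- The Zariski topology on `ι → ℂ`: a set is closed iff it is the common zero locus
of a family of polynomials in `MvPolynomial ι ℂ`. -/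
def zt (ι : Type*) : TopologicalSpace (ι → ℂ) :=
  TopologicalSpace.generateFrom
    { U | ∃ f : MvPolynomial ι ℂ, U = { x | MvPolynomial.eval x f ≠ 0 } }

def zIsOpen {ι : Type*} (S : Set (ι → ℂ)) : Prop := @IsOpen _ (zt ι) S

def zClosure {ι : Type*} (S : Set (ι → ℂ)) : Set (ι → ℂ) := @closure _ (zt ι) S

/-- The topological Krull dimension of `S` (with the subspace Zariski topology). -/
def zDim {ι : Type*} (S : Set (ι → ℂ)) : WithBot ℕ∞ :=
  @topologicalKrullDim ↥S (TopologicalSpace.induced Subtype.val (zt ι))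

/-- The `m`-th secant variety: the Zariski closure of the set of sums of `m` points of `V`. -/
def secant {ι : Type*} (m : ℕ) (V : Set (ι → ℂ)) : Set (ι → ℂ) :=
  zClosure { p | ∃ x : Fin m → (ι → ℂ), (∀ i, x i ∈ V) ∧ p = ∑ i, x i }

/-- The index type `Λ` of `d`-element subsets of `{0, …, n-1}`; `ℂ^Λ` carries the
Plücker coordinates. -/
def Lam (n d : ℕ) : Type := { S : Finset (Fin n) // S.card = d }

/-- The point of `ℂ^Λ` whose `S`-coordinate is the maximal minor of `M` with row set `S`
(rows taken in increasing order). -/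
def plucker {n d : ℕ} (M : Matrix (Fin n) (Fin d) ℂ) : Lam n d → ℂ :=
  fun S => (M.submatrix (fun i : Fin d => ((S.1.orderIsoOfFin S.2) i : Fin n)) id).det

/-- The affine cone over the Grassmannian in its Plücker embedding: the Zariski closure
of the set of all maximal-minor vectors of `n × d` matrices. -/
def GrassCone (n d : ℕ) : Set (Lam n d → ℂ) :=
  zClosure { p | ∃ M : Matrix (Fin n) (Fin d) ℂ, p = plucker M }

/-- `V` is `m`-identifiable: there is a dense open subset `O` of `σ_m V` such that every
`p ∈ O` is a sum of `m` points of `V`, uniquely up to a permutation of the summands. -/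
def IsIdentifiable {ι : Type*} (m : ℕ) (V : Set (ι → ℂ)) : Prop :=
  ∃ O : Set (ι → ℂ), O ⊆ secant m V ∧
    (∃ U, zIsOpen U ∧ O = U ∩ secant m V) ∧
    secant m V ⊆ zClosure O ∧
    ∀ p ∈ O,
      (∃ x : Fin m → (ι → ℂ), (∀ i, x i ∈ V) ∧ p = ∑ i, x i) ∧
      ∀ x y : Fin m → (ι → ℂ), (∀ i, x i ∈ V) → (∀ i, y i ∈ V) →
        p = ∑ i, x i → p = ∑ i, y i →
          ∃ e : Equiv.Perm (Fin m), ∀ i, y i = x (e i)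

section

/-- The decomposable tensor `v₁ ∧ ⋯ ∧ v_d`, as an alternating function of its indices. -/
def wedge (R : Type*) [CommRing R] (n d : ℕ) :
    (Fin n → R) [⋀^Fin d]→ₗ[R] ((Fin d → Fin n) → R) :=
  AlternatingMap.pi fun f =>
    (Matrix.detRowAlternating (n := Fin d) (R := R)).compLinearMap (LinearMap.funLeft R R f)

lemma wedge_apply {R : Type*} [CommRing R] {n d : ℕ} (v : Fin d → Fin n → R) (f : Fin d → Fin n) :
    wedge R n d v f = (Matrix.of fun l k => v l (f k)).det := rfl

lemma map_wedge {R S : Type*} [CommRing R] [CommRing S] {n d : ℕ} (φ : R →+* S)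
    (v : Fin d → Fin n → R) :
    (fun f => φ (wedge R n d v f)) = wedge S n d (fun l a => φ (v l a)) := by
  funext f
  rw [wedge_apply, wedge_apply, RingHom.map_det]
  rfl

/-- The derivation action of a matrix on `d`-tensors. -/
def act {F : Type*} [Field F] {n d : ℕ} (X : Matrix (Fin n) (Fin n) F) :
    ((Fin d → Fin n) → F) →ₗ[F] ((Fin d → Fin n) → F) where
  toFun u f := ∑ k, ∑ b, X (f k) b * u (Function.update f k b)
  map_add' u w := by
    funext f
    simp [mul_add, Finset.sum_add_distrib]
  map_smul' c u := by
    funext f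
    simp [Finset.mul_sum, mul_left_comm]

variable {F : Type*} [Field F] {n d : ℕ}

lemma act_apply (X : Matrix (Fin n) (Fin n) F) (u : (Fin d → Fin n) → F) (f : Fin d → Fin n) :
    act X u f = ∑ k, ∑ b, X (f k) b * u (Function.update f k b) := rfl

lemma act_add (X Y : Matrix (Fin n) (Fin n) F) (u : (Fin d → Fin n) → F) :
    act (X + Y) u = act X u + act Y u := by
  funext f
  simp [act_apply, add_mul, Finset.sum_add_distrib]

lemma act_smul (c : F) (X : Matrix (Fin n) (Fin n) F) (u : (Fin d → Fin n) → F) :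
    act (c • X) u = c • act X u := by
  funext f
  simp [act_apply, Finset.mul_sum, mul_assoc]

/-- The linear map `X ↦ act X u`. -/
def actRight (u : (Fin d → Fin n) → F) :
    Matrix (Fin n) (Fin n) F →ₗ[F] ((Fin d → Fin n) → F) where
  toFun X := act X u
  map_add' X Y := act_add X Y u
  map_smul' c X := act_smul c X u

lemma act_sub (X Y : Matrix (Fin n) (Fin n) F) (u : (Fin d → Fin n) → F) :
    act (X - Y) u = act X u - act Y u :=
  (actRight u).map_sub X Y

lemma act_zero (u : (Fin d → Fin n) → F) : act (0 : Matrix (Fin n) (Fin n) F) u = 0 :=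
  (actRight u).map_zero

lemma act_act (X Y : Matrix (Fin n) (Fin n) F) (u : (Fin d → Fin n) → F) :
    act X (act Y u) = act Y (act X u) + act (X * Y - Y * X) u := by
  have key : ∀ (X Y : Matrix (Fin n) (Fin n) F) (f : Fin d → Fin n), act X (act Y u) f =
      act (X * Y) u f + ∑ k, ∑ l ∈ Finset.univ.erase k, ∑ b, ∑ c,
        X (f k) b * Y (f l) c * u (Function.update (Function.update f k b) l c) := by
    intro X Y f
    simp only [act_apply, ← Finset.sum_add_distrib]
    refine Finset.sum_congr rfl fun k _ => ?_
    have : ∀ b, X (f k) b * ∑ l, ∑ c, Y (Function.update f k b l) c *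
        u (Function.update (Function.update f k b) l c) =
        (∑ c, X (f k) b * Y b c * u (Function.update f k c)) +
        ∑ l ∈ Finset.univ.erase k, ∑ c,
          X (f k) b * Y (f l) c * u (Function.update (Function.update f k b) l c) := by
      intro b
      rw [← Finset.add_sum_erase _ _ (Finset.mem_univ k), mul_add, Finset.mul_sum, Finset.mul_sum]
      congr 1
      · refine Finset.sum_congr rfl fun c _ => ?_
        simp [mul_assoc]
      · refine Finset.sum_congr rfl fun l hl => ?_
        rw [Finset.mul_sum]
        refine Finset.sum_congr rfl fun c _ => ?_
        rw [Function.update_of_ne (Finset.ne_of_mem_erase hl), mul_assoc]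
    simp only [this, Finset.sum_add_distrib]
    congr 1
    · rw [Finset.sum_comm]
      simp [Matrix.mul_apply, Finset.sum_mul]
    · rw [Finset.sum_comm]
  funext f
  rw [Pi.add_apply, key X Y, key Y X, act_sub, Pi.sub_apply]
  have : (∑ k, ∑ l ∈ Finset.univ.erase k, ∑ b, ∑ c,
        X (f k) b * Y (f l) c * u (Function.update (Function.update f k b) l c)) =
      ∑ k, ∑ l ∈ Finset.univ.erase k, ∑ b, ∑ c,
        Y (f k) b * X (f l) c * u (Function.update (Function.update f k b) l c) := by
    rw [Finset.sum_comm' (t' := Finset.univ) (s' := fun k => Finset.univ.erase k)]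
    · refine Finset.sum_congr rfl fun k _ => Finset.sum_congr rfl fun l hl => ?_
      rw [Finset.sum_comm]
      refine Finset.sum_congr rfl fun b _ => Finset.sum_congr rfl fun c _ => ?_
      rw [Function.update_comm (Finset.ne_of_mem_erase hl)]
      ring
    · intro x y
      simp [eq_comm]
  rw [this]
  ring

lemma sum_det_updateRow_eq {ι : Type*} [Fintype ι] [DecidableEq ι] {R : Type*} [CommRing R]
    (A B : Matrix ι ι R) :
    ∑ l, (A.updateRow l (fun k => B l k)).det = ∑ l, (A.updateCol l (fun k => B k l)).det := by
  have h1 : ∀ l, (A.updateRow l (fun k => B l k)).det = (B * A.adjugate) l l := by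
    intro l
    rw [← Matrix.det_transpose, ← Matrix.updateCol_transpose]
    rw [← Matrix.cramer_apply, Matrix.cramer_eq_adjugate_mulVec, ← Matrix.adjugate_transpose]
    simp [Matrix.mulVec, dotProduct, Matrix.mul_apply, mul_comm]
  have h2 : ∀ l, (A.updateCol l (fun k => B k l)).det = (A.adjugate * B) l l := by
    intro l
    rw [← Matrix.cramer_apply, Matrix.cramer_eq_adjugate_mulVec]
    simp [Matrix.mulVec, dotProduct, Matrix.mul_apply]
  simp only [h1, h2]
  exact Matrix.trace_mul_comm B A.adjugate

lemma act_wedge (X : Matrix (Fin n) (Fin n) F) (v : Fin d → Fin n → F) :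
    act X (wedge F n d v) = ∑ l, wedge F n d (Function.update v l (X.mulVec (v l))) := by
  funext f
  have h := sum_det_updateRow_eq (Matrix.of fun l k => v l (f k))
    (Matrix.of fun l k => X.mulVec (v l) (f k))
  rw [Finset.sum_apply]
  have h1 : ∀ l, wedge F n d (Function.update v l (X.mulVec (v l))) f =
      ((Matrix.of fun l k => v l (f k)).updateRow l
        (fun k => (Matrix.of fun l k => X.mulVec (v l) (f k)) l k)).det := by
    intro l
    rw [wedge_apply]
    congr 1
    ext i j
    by_cases h : i = l
    · subst h; simp
    · simp [h]
  simp only [h1, h, act_apply]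
  refine Finset.sum_congr rfl fun k _ => ?_
  have h2 : (fun l => (Matrix.of fun l k => X.mulVec (v l) (f k)) l k) =
      ∑ b, X (f k) b • fun l => v l b := by
    funext l
    simp [Matrix.mulVec, dotProduct]
  rw [h2, ← Matrix.cramer_apply, map_sum, Finset.sum_apply]
  refine Finset.sum_congr rfl fun b _ => ?_
  rw [map_smul, Pi.smul_apply, smul_eq_mul, Matrix.cramer_apply, wedge_apply]
  congr 2
  ext i j
  by_cases h : j = k
  · subst h; simp
  · simp [h]

lemma derivation_prod {R A : Type*} [CommRing R] [CommRing A] [Algebra R A]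
    (D : Derivation R A A) {ι : Type*} [DecidableEq ι] (s : Finset ι) (g : ι → A) :
    D (∏ i ∈ s, g i) = ∑ i ∈ s, ∏ j ∈ s, Function.update g i (D (g i)) j := by
  induction s using Finset.induction_on with
  | empty => simp
  | insert a s ha ih =>
    rw [Finset.prod_insert ha, Derivation.leibniz, ih, Finset.sum_insert ha, Finset.prod_insert ha,
      add_comm, Function.update_self]
    congr 1
    · rw [smul_eq_mul, mul_comm]
      congr 1
      exact Finset.prod_congr rfl fun j hj =>
        (Function.update_of_ne (by rintro rfl; exact ha hj) _ _).symm
    · rw [smul_eq_mul, Finset.mul_sum]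
      refine Finset.sum_congr rfl fun i hi => ?_
      rw [Finset.prod_insert ha, Function.update_of_ne (by rintro rfl; exact ha hi)]

lemma derivation_wedge {R : Type*} [CommRing R] [Algebra R F] (D : Derivation R F F)
    (v : Fin d → Fin n → F) :
    (fun f => D (wedge F n d v f)) =
      ∑ l, wedge F n d (Function.update v l (fun a => D (v l a))) := by
  funext f
  rw [Finset.sum_apply]
  simp only [wedge_apply, Matrix.det_apply']
  rw [map_sum, Finset.sum_comm]
  refine Finset.sum_congr rfl fun σ _ => ?_
  rw [Derivation.leibniz, derivation_prod, ← Finset.mul_sum]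
  have : D ((Equiv.Perm.sign σ : ℤ) : F) = 0 := by
    rw [Derivation.map_intCast]
  rw [this, smul_zero, add_zero, smul_eq_mul]
  congr 1
  conv_rhs => rw [← Equiv.sum_comp σ]
  refine Finset.sum_congr rfl fun l _ => Finset.prod_congr rfl fun k _ => ?_
  by_cases h : k = l
  · subst h; simp
  · simp [h]

lemma derivation_act {R : Type*} [CommRing R] [Algebra R F] (D : Derivation R F F)
    (X : Matrix (Fin n) (Fin n) F) (u : (Fin d → Fin n) → F) :
    (fun f => D (act X u f)) = act (X.map D) u + act X (fun f => D (u f)) := by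
  funext f
  simp [act_apply, Finset.sum_add_distrib, mul_comm, add_comm]

lemma map_act {F' : Type*} [Field F'] (φ : F →+* F')
    (X : Matrix (Fin n) (Fin n) F) (u : (Fin d → Fin n) → F) :
    (fun f => φ (act X u f)) = act (X.map φ) (fun f => φ (u f)) := by
  funext f
  simp [act_apply]

end

section

variable {F : Type*} [Field F] {n d : ℕ}

lemma act_vecMulVec_wedge (w γ : Fin n → F) (v : Fin d → Fin n → F) :
    act (Matrix.vecMulVec w γ) (wedge F n d v) =
      ∑ l, (γ ⬝ᵥ v l) • wedge F n d (Function.update v l w) := by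
  rw [act_wedge]
  refine Finset.sum_congr rfl fun l _ => ?_
  rw [← AlternatingMap.map_update_smul]
  congr 2
  funext a
  simp [Matrix.mulVec, Matrix.vecMulVec_apply, dotProduct, mul_comm, mul_left_comm, Finset.mul_sum]

/-- The affine tangent space to the cone of decomposable tensors at `wedge v`. -/
def tangent (v : Fin d → Fin n → F) : Submodule F ((Fin d → Fin n) → F) :=
  LinearMap.range (actRight (wedge F n d v))

lemma act_wedge_mem_tangent (X : Matrix (Fin n) (Fin n) F) (v : Fin d → Fin n → F) :
    act X (wedge F n d v) ∈ tangent v := ⟨X, rfl⟩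

lemma mem_tangent {v : Fin d → Fin n → F} {u : (Fin d → Fin n) → F} :
    u ∈ tangent v ↔ ∃ X, act X (wedge F n d v) = u := Iff.rfl

lemma tangent_eq_bot {v : Fin d → Fin n → F} (h : wedge F n d v = 0) : tangent v = ⊥ := by
  rw [eq_bot_iff]
  rintro _ ⟨X, rfl⟩
  change act X (wedge F n d v) ∈ _
  rw [h, map_zero]
  exact zero_mem _

/-- A system of covectors dual to the rows of `v` and to the coordinate vectors outside the
range of `f`. -/
structure Frame (v : Fin d → Fin n → F) (f : Fin d → Fin n) where
  /-- covectors dual to the rows of `v` -/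
  β : Fin d → Fin n → F
  /-- covectors vanishing on the rows of `v` -/
  α : Fin n → Fin n → F
  inj : Function.Injective f
  β_dot : ∀ l j, β l ⬝ᵥ v j = if l = j then 1 else 0
  β_apply : ∀ l a, a ∉ Set.range f → β l a = 0
  α_dot : ∀ a j, α a ⬝ᵥ v j = 0
  α_apply : ∀ a a', a' ∉ Set.range f → α a a' = if a = a' then 1 else 0
  expand : ∀ w a, w a = (∑ l, (β l ⬝ᵥ w) * v l a) + α a ⬝ᵥ w
  α_range : ∀ k, α (f k) = 0

lemma exists_frame {v : Fin d → Fin n → F} (h : wedge F n d v ≠ 0) :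
    ∃ f, Nonempty (Frame v f) := by
  obtain ⟨f, hf⟩ := Function.ne_iff.1 h
  rw [wedge_apply, Pi.zero_apply] at hf
  set A : Matrix (Fin d) (Fin d) F := Matrix.of fun l k => v l (f k) with hA
  have hu : IsUnit A.det := isUnit_iff_ne_zero.2 hf
  let β : Fin d → Fin n → F := fun l a => ∑ k, if f k = a then A⁻¹ k l else 0
  have hβw : ∀ l w, β l ⬝ᵥ w = ∑ k, A⁻¹ k l * w (f k) := by
    intro l w
    simp only [β, dotProduct, Finset.sum_mul]
    rw [Finset.sum_comm]
    simp
  have hβ : ∀ l j, β l ⬝ᵥ v j = if l = j then 1 else 0 := by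
    intro l j
    rw [hβw]
    have := congrFun (congrFun (Matrix.mul_nonsing_inv A hu) j) l
    rw [Matrix.mul_apply, Matrix.one_apply] at this
    simp only [eq_comm (a := l)]
    rw [← this]
    exact Finset.sum_congr rfl fun k _ => mul_comm _ _
  let α : Fin n → Fin n → F := fun a b => (if a = b then 1 else 0) - ∑ l, v l a * β l b
  have hαw : ∀ a w, α a ⬝ᵥ w = w a - ∑ l, (β l ⬝ᵥ w) * v l a := by
    intro a w
    simp only [α, dotProduct, sub_mul, Finset.sum_sub_distrib, Finset.sum_mul]
    congr 1
    · simp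
    · rw [Finset.sum_comm]
      exact Finset.sum_congr rfl fun _ _ => Finset.sum_congr rfl fun _ _ => by ring
  refine ⟨f, ⟨⟨β, α, ?_, hβ, ?_, ?_, ?_, ?_, ?_⟩⟩⟩
  · intro i j hij
    by_contra hne
    exact hf (Matrix.det_zero_of_column_eq hne (fun l => by simp [hA, hij]))
  · intro l a ha
    exact Finset.sum_eq_zero fun k _ => if_neg fun hk => ha ⟨k, hk⟩
  · intro a j
    rw [hαw]
    simp [hβ]
  · intro a a' ha'
    have : ∀ l, β l a' = 0 := fun l =>
      Finset.sum_eq_zero fun k _ => if_neg fun hk => ha' ⟨k, hk⟩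
    simp [α, this]
  · intro w a
    rw [hαw]
    ring
  · intro k
    funext b
    have : ∑ l, v l (f k) * β l b = ∑ k', if f k' = b then (A⁻¹ * A) k' k else 0 := by
      simp only [β, Finset.mul_sum]
      rw [Finset.sum_comm]
      refine Finset.sum_congr rfl fun k' _ => ?_
      split_ifs
      · rw [Matrix.mul_apply]
        exact Finset.sum_congr rfl fun l _ => mul_comm _ _
      · simp
    simp only [α, this, Matrix.nonsing_inv_mul A hu, Matrix.one_apply, Pi.zero_apply]
    rw [Finset.sum_eq_single k] <;> simp +contextual

namespace Frame
variable {v : Fin d → Fin n → F} {f : Fin d → Fin n} (B : Frame v f)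

/-- The tensor obtained from `wedge v` by replacing row `l` with the coordinate vector `a`. -/
def elem (_ : Frame v f) (l : Fin d) (a : Fin n) : (Fin d → Fin n) → F :=
  wedge F n d (Function.update v l (Pi.single a 1))

lemma wedge_update_row (v : Fin d → Fin n → F) (l j : Fin d) :
    wedge F n d (Function.update v l (v j)) = if l = j then wedge F n d v else 0 := by
  split_ifs with h
  · subst h; rw [Function.update_eq_self]
  · exact (wedge F n d).map_update_self v h

lemma act_α (w : Fin n → F) (a : Fin n) :
    act (Matrix.vecMulVec w (B.α a)) (wedge F n d v) = 0 := by
  rw [act_vecMulVec_wedge]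
  exact Finset.sum_eq_zero fun l _ => by rw [B.α_dot, zero_smul]

lemma act_β (w : Fin n → F) (l : Fin d) :
    act (Matrix.vecMulVec w (B.β l)) (wedge F n d v) = wedge F n d (Function.update v l w) := by
  rw [act_vecMulVec_wedge]
  simp [B.β_dot]

lemma act_elem (w γ : Fin n → F) (l : Fin d) (a : Fin n) :
    act (Matrix.vecMulVec w γ) (B.elem l a) = γ a • wedge F n d (Function.update v l w) +
      ∑ j ∈ Finset.univ.erase l,
        (γ ⬝ᵥ v j) • wedge F n d (Function.update (Function.update v l (Pi.single a 1)) j w) := by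
  rw [elem, act_vecMulVec_wedge, ← Finset.add_sum_erase _ _ (Finset.mem_univ l)]
  congr 1
  · simp
  · refine Finset.sum_congr rfl fun j hj => ?_
    rw [Function.update_of_ne (Finset.ne_of_mem_erase hj)]

lemma act_α_elem (w : Fin n → F) (a' : Fin n) (l : Fin d) {a : Fin n} (ha : a ∉ Set.range f) :
    act (Matrix.vecMulVec w (B.α a')) (B.elem l a) =
      if a' = a then wedge F n d (Function.update v l w) else 0 := by
  rw [act_elem, B.α_apply _ _ ha, Finset.sum_eq_zero fun j _ => by rw [B.α_dot, zero_smul]]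
  split_ifs <;> simp

lemma act_β_elem (w : Fin n → F) (l' l : Fin d) {a : Fin n} (ha : a ∉ Set.range f) :
    act (Matrix.vecMulVec w (B.β l')) (B.elem l a) = if l' = l then 0 else
      wedge F n d (Function.update (Function.update v l (Pi.single a 1)) l' w) := by
  rw [act_elem, B.β_apply _ _ ha, zero_smul, zero_add]
  split_ifs with h
  · refine Finset.sum_eq_zero fun j hj => ?_
    rw [B.β_dot, if_neg, zero_smul]
    rintro rfl
    exact Finset.ne_of_mem_erase hj h
  · rw [Finset.sum_eq_single_of_mem l' (by simp [h])]
    · simp [B.β_dot]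
    · intro j _ hj
      rw [B.β_dot, if_neg (Ne.symm hj), zero_smul]

lemma act_scale_elem (l' l : Fin d) {a : Fin n} (ha : a ∉ Set.range f) :
    act (Matrix.vecMulVec (v l') (B.β l')) (B.elem l a) = if l' = l then 0 else B.elem l a := by
  rw [B.act_β_elem _ _ _ ha]
  split_ifs with h
  · rfl
  · rw [elem]
    congr 1
    rw [Function.update_eq_self_iff.2]
    rw [Function.update_of_ne h]

lemma act_shift_elem {l' l : Fin d} (h : l' ≠ l) {a : Fin n} (ha : a ∉ Set.range f) :
    act (Matrix.vecMulVec (v l) (B.β l')) (B.elem l a) = - B.elem l' a := by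
  rw [B.act_β_elem _ _ _ ha, if_neg h, elem, ← (wedge F n d).map_swap _ h]
  congr 1
  funext i
  rcases eq_or_ne i l with rfl | hi
  · simp [h.symm]
  · rcases eq_or_ne i l' with rfl | hi'
    · simp [h.symm]
    · simp [hi, hi', Equiv.swap_apply_of_ne_of_ne]

lemma wedge_update_mem (B : Frame v f) (l : Fin d) (w : Fin n → F) :
    wedge F n d (Function.update v l w) ∈ tangent v :=
  ⟨_, B.act_β w l⟩

/-- The spanning family of the tangent space. -/
def family (i : Option (Fin d × {a : Fin n // a ∉ Set.range f})) : (Fin d → Fin n) → F :=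
  i.elim (wedge F n d v) fun p => B.elem p.1 p.2

lemma wedge_update_eq (l : Fin d) (w : Fin n → F) :
    wedge F n d (Function.update v l w) = (B.β l ⬝ᵥ w) • wedge F n d v +
      ∑ a : {a : Fin n // a ∉ Set.range f}, (B.α a ⬝ᵥ w) • B.elem l a := by
  have hw : w = (∑ j, (B.β j ⬝ᵥ w) • v j) +
      ∑ a : {a : Fin n // a ∉ Set.range f}, (B.α a ⬝ᵥ w) • (Pi.single a.1 (1 : F)) := by
    funext b
    rw [B.expand w b, Pi.add_apply]
    congr 1
    · simp
    · rw [Finset.sum_apply]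
      by_cases hb : b ∈ Set.range f
      · obtain ⟨k, rfl⟩ := hb
        rw [B.α_range, zero_dotProduct, Finset.sum_eq_zero]
        intro a _
        have : f k ≠ a := fun h => a.2 ⟨k, h⟩
        simp [this]
      · rw [Finset.sum_eq_single (⟨b, hb⟩ : {a : Fin n // a ∉ Set.range f})]
        · simp
        · intro a _ ha
          have : b ≠ a := fun h => ha (Subtype.ext h.symm)
          simp [this]
        · simp
  conv_lhs => rw [hw]
  have hlin : ∀ w, wedge F n d (Function.update v l w) =
      (wedge F n d).toMultilinearMap.toLinearMap v l w := fun _ => rfl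
  rw [hlin, map_add, map_sum, map_sum]
  congr 1
  · rw [Finset.sum_eq_single l]
    · rw [map_smul, ← hlin, wedge_update_row, if_pos rfl]
    · intro j _ hj
      rw [map_smul, ← hlin, wedge_update_row, if_neg hj.symm, smul_zero]
    · simp
  · exact Finset.sum_congr rfl fun a _ => by rw [map_smul, ← hlin, elem]

lemma wedge_mem [NeZero d] (B : Frame v f) : wedge F n d v ∈ tangent v := by
  have := B.wedge_update_mem 0 (v 0)
  rwa [Function.update_eq_self] at this

lemma span_family [NeZero d] : Submodule.span F (Set.range B.family) = tangent v := by
  apply le_antisymm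
  · rw [Submodule.span_le]
    rintro _ ⟨_ | ⟨l, a⟩, rfl⟩
    · exact B.wedge_mem
    · exact B.wedge_update_mem _ _
  · rintro _ ⟨X, rfl⟩
    change act X (wedge F n d v) ∈ _
    rw [act_wedge]
    refine Submodule.sum_mem _ fun l _ => ?_
    rw [B.wedge_update_eq]
    refine add_mem (Submodule.smul_mem _ _ (Submodule.subset_span ⟨none, rfl⟩))
      (Submodule.sum_mem _ fun a _ =>
        Submodule.smul_mem _ _ (Submodule.subset_span ⟨some (l, a), rfl⟩))

lemma act_contract (c₀ : F) (c : Fin d → {a : Fin n // a ∉ Set.range f} → F) (w : Fin n → F)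
    (a : {a : Fin n // a ∉ Set.range f}) :
    act (Matrix.vecMulVec w (B.α a)) (c₀ • wedge F n d v + ∑ l, ∑ a, c l a • B.elem l a) =
      ∑ l, c l a • wedge F n d (Function.update v l w) := by
  rw [map_add, map_smul, B.act_α, smul_zero, zero_add, map_sum]
  refine Finset.sum_congr rfl fun l _ => ?_
  rw [map_sum, Finset.sum_eq_single a]
  · rw [map_smul, B.act_α_elem _ _ _ a.2, if_pos rfl]
  · intro b _ hb
    rw [map_smul, B.act_α_elem _ _ _ b.2, if_neg, smul_zero]
    exact fun h => hb (Subtype.ext h.symm)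
  · simp

lemma act_contract_row (c₀ : F) (c : Fin d → {a : Fin n // a ∉ Set.range f} → F) (l : Fin d)
    (a : {a : Fin n // a ∉ Set.range f}) :
    act (Matrix.vecMulVec (v l) (B.α a))
      (c₀ • wedge F n d v + ∑ l, ∑ a, c l a • B.elem l a) = c l a • wedge F n d v := by
  rw [act_contract]
  simp only [wedge_update_row]
  simp

lemma linearIndependent_family (h : wedge F n d v ≠ 0) : LinearIndependent F B.family := by
  rw [Fintype.linearIndependent_iff]
  intro g hg
  have hg' : g none • wedge F n d v + ∑ l, ∑ a, g (some (l, a)) • B.elem l a = 0 := by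
    rw [Fintype.sum_option, Fintype.sum_prod_type] at hg
    exact hg
  have h1 : ∀ l a, g (some (l, a)) = 0 := by
    intro l a
    have := B.act_contract_row (g none) (fun l a => g (some (l, a))) l a
    rw [hg', map_zero] at this
    exact (smul_eq_zero.1 this.symm).resolve_right h
  rintro (_ | ⟨l, a⟩)
  · simp only [h1, zero_smul, Finset.sum_const_zero, add_zero] at hg'
    exact (smul_eq_zero.1 hg').resolve_right h
  · exact h1 l a

lemma exists_coords [NeZero d] {u : (Fin d → Fin n) → F} (hu : u ∈ tangent v) :
    ∃ (c₀ : F) (c : Fin d → {a : Fin n // a ∉ Set.range f} → F), u = c₀ • wedge F n d v +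
      ∑ l, ∑ a, c l a • B.elem l a := by
  rw [← B.span_family, Submodule.mem_span_range_iff_exists_fun] at hu
  obtain ⟨c, rfl⟩ := hu
  refine ⟨c none, fun l a => c (some (l, a)), ?_⟩
  rw [Fintype.sum_option, Fintype.sum_prod_type]
  rfl

lemma finrank_tangent [NeZero d] (B : Frame v f) (h : wedge F n d v ≠ 0) :
    Module.finrank F (tangent v) = d * (n - d) + 1 := by
  rw [← B.span_family, finrank_span_eq_card (B.linearIndependent_family h), Fintype.card_option,
    Fintype.card_prod, Fintype.card_fin]
  congr 2
  have h1 := Fintype.card_subtype_compl (fun a => a ∈ Set.range f)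
  have h2 : Fintype.card {a // a ∈ Set.range f} = d := by
    have := Set.card_range_of_injective B.inj
    rw [Fintype.card_fin] at this
    convert this
  rw [h2, Fintype.card_fin] at h1
  convert h1
end Frame

lemma finrank_tangent [NeZero d] {v : Fin d → Fin n → F} (h : wedge F n d v ≠ 0) :
    Module.finrank F (tangent v) = d * (n - d) + 1 := by
  obtain ⟨f, ⟨B⟩⟩ := exists_frame h
  exact B.finrank_tangent h

lemma finrank_tangent_le [NeZero d] (v : Fin d → Fin n → F) :
    Module.finrank F (tangent v) ≤ d * (n - d) + 1 := by
  by_cases h : wedge F n d v = 0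
  · rw [tangent_eq_bot h, finrank_bot]
    exact Nat.zero_le _
  · exact (finrank_tangent h).le

lemma wedge_mem_tangent [NeZero d] (v : Fin d → Fin n → F) : wedge F n d v ∈ tangent v := by
  by_cases h : wedge F n d v = 0
  · rw [h]
    exact zero_mem _
  · obtain ⟨f, ⟨B⟩⟩ := exists_frame h
    exact B.wedge_mem

lemma derivation_wedge_mem_tangent {R : Type*} [CommRing R] [Algebra R F] (D : Derivation R F F)
    (v : Fin d → Fin n → F) : (fun f => D (wedge F n d v f)) ∈ tangent v := by
  by_cases h : wedge F n d v = 0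
  · rw [h]
    convert zero_mem (tangent v)
    simp
  · obtain ⟨f, ⟨B⟩⟩ := exists_frame h
    rw [derivation_wedge]
    exact Submodule.sum_mem _ fun l _ => B.wedge_update_mem _ _

/-- Stability under the stabilizer of the line spanned by `x`. -/
def IsParabolicStable (x : (Fin d → Fin n) → F) (W : Submodule F ((Fin d → Fin n) → F)) : Prop :=
  ∀ (X : Matrix (Fin n) (Fin n) F) (c : F), act X x = c • x → ∀ u ∈ W, act X u ∈ W

lemma wedge_mem_of_isParabolicStable [NeZero d] {v : Fin d → Fin n → F}
    {W : Submodule F ((Fin d → Fin n) → F)} (hW : W ≤ tangent v)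
    (hs : IsParabolicStable (wedge F n d v) W) (hne : W ≠ ⊥) : wedge F n d v ∈ W := by
  by_cases h : wedge F n d v = 0
  · rw [h]; exact zero_mem _
  obtain ⟨f, ⟨B⟩⟩ := exists_frame h
  obtain ⟨u, hu, hu0⟩ := Submodule.exists_mem_ne_zero_of_ne_bot hne
  obtain ⟨c₀, c, rfl⟩ := B.exists_coords (hW hu)
  by_cases hc : ∃ l a, c l a ≠ 0
  · obtain ⟨l, a, hla⟩ := hc
    have := hs (Matrix.vecMulVec (v l) (B.α a)) 0 (by rw [B.act_α, zero_smul]) _ hu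
    rw [B.act_contract_row] at this
    exact (Submodule.smul_mem_iff _ hla).1 this
  · push Not at hc
    simp only [hc, zero_smul, Finset.sum_const_zero, add_zero] at hu hu0
    exact (Submodule.smul_mem_iff _ (fun h0 => hu0 (by rw [h0, zero_smul]))).1 hu

lemma eq_tangent_of_isParabolicStable [NeZero d] {v : Fin d → Fin n → F}
    {W : Submodule F ((Fin d → Fin n) → F)} (hW : W ≤ tangent v)
    (hs : IsParabolicStable (wedge F n d v) W) (hne : ¬ W ≤ F ∙ wedge F n d v) :
    W = tangent v := by
  by_cases h : wedge F n d v = 0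
  · refine absurd (hW.trans ?_) hne
    rw [tangent_eq_bot h]
    exact bot_le
  obtain ⟨f, ⟨B⟩⟩ := exists_frame h
  have hmem : wedge F n d v ∈ W := wedge_mem_of_isParabolicStable hW hs (by
    rintro rfl
    exact hne bot_le)
  obtain ⟨u, hu, hu0⟩ := SetLike.not_le_iff_exists.1 hne
  obtain ⟨c₀, c, rfl⟩ := B.exists_coords (hW hu)
  have hc : ∃ l a, c l a ≠ 0 := by
    by_contra hc
    push Not at hc
    simp only [hc, zero_smul, Finset.sum_const_zero, add_zero] at hu0
    exact hu0 (Submodule.smul_mem _ _ (Submodule.mem_span_singleton_self _))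
  obtain ⟨l₀, a₀, h0⟩ := hc
  have hrow : ∀ a : {a : Fin n // a ∉ Set.range f}, B.elem l₀ a ∈ W := by
    intro a
    have h1 := hs (Matrix.vecMulVec (Pi.single a.1 1) (B.α a₀)) 0 (by rw [B.act_α, zero_smul]) _ hu
    rw [B.act_contract] at h1
    have h2 := hs (Matrix.vecMulVec (v l₀) (B.β l₀)) 1
      (by rw [B.act_β, Function.update_eq_self, one_smul]) _ h1
    have h3 := sub_mem h1 h2
    rw [map_sum, ← Finset.sum_sub_distrib, Finset.sum_eq_single l₀] at h3
    · rw [map_smul] at h3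
      change c l₀ a₀ • B.elem l₀ a - c l₀ a₀ • act _ (B.elem l₀ a) ∈ W at h3
      rw [B.act_scale_elem _ _ a.2, if_pos rfl, smul_zero, sub_zero] at h3
      exact (Submodule.smul_mem_iff _ h0).1 h3
    · intro l _ hl
      rw [map_smul]
      change c l a₀ • B.elem l a - c l a₀ • act _ (B.elem l a) = 0
      rw [B.act_scale_elem _ _ a.2, if_neg hl.symm, sub_self]
    · simp
  refine le_antisymm hW ?_
  rw [← B.span_family, Submodule.span_le]
  rintro _ ⟨_ | ⟨l, a⟩, rfl⟩
  · exact hmem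
  · rcases eq_or_ne l l₀ with rfl | hl
    · exact hrow a
    · have := hs (Matrix.vecMulVec (v l₀) (B.β l)) 0
        (by rw [B.act_β, Frame.wedge_update_row, if_neg hl, zero_smul]) _ (hrow a)
      rw [B.act_shift_elem hl a.2] at this
      exact (Submodule.neg_mem_iff _).1 this

end

section

variable {n d : ℕ}

/-- A sequence of generic frames over a field of characteristic zero: every assignment of values to
the coordinates extends to a derivation, and every permutation of the indices extends to a field
automorphism. -/
structure GenericFrames (Ω : Type*) [Field Ω] [Algebra ℂ Ω] (n d : ℕ) where
  /-- the frames -/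
  z : ℕ → Fin d → Fin n → Ω
  exists_derivation : ∀ V : ℕ → Fin d → Fin n → Ω,
    ∃ D : Derivation ℂ Ω Ω, ∀ i l a, D (z i l a) = V i l a
  exists_equiv : ∀ τ : Equiv.Perm ℕ, ∃ φ : Ω ≃+* Ω, ∀ i l a, φ (z i l a) = z (τ i) l a
  ne_zero : ∀ i, wedge Ω n d (z i) ≠ 0

namespace GenericFrames
variable {Ω : Type*} [Field Ω] [Algebra ℂ Ω] (G : GenericFrames Ω n d)

/-- The decomposable tensor of the `i`-th frame. -/
def x (i : ℕ) : (Fin d → Fin n) → Ω := wedge Ω n d (G.z i)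

/-- The tangent space at the `i`-th point. -/
def T (i : ℕ) : Submodule Ω ((Fin d → Fin n) → Ω) := tangent (G.z i)

/-- The sum of the tangent spaces at the points indexed by `J`. -/
def TT (J : Finset ℕ) : Submodule Ω ((Fin d → Fin n) → Ω) := ⨆ i ∈ J, G.T i

variable {G}

lemma mem_T {i : ℕ} {u : (Fin d → Fin n) → Ω} : u ∈ G.T i ↔ ∃ X, act X (G.x i) = u := Iff.rfl

lemma mem_TT {J : Finset ℕ} {u : (Fin d → Fin n) → Ω} :
    u ∈ G.TT J ↔ ∃ X : ℕ → Matrix (Fin n) (Fin n) Ω, ∑ i ∈ J, act (X i) (G.x i) = u := by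
  rw [TT, Submodule.mem_iSup_finset_iff_exists_sum]
  constructor
  · rintro ⟨μ, rfl⟩
    choose X hX using fun i => mem_T.1 (μ i).2
    exact ⟨X, Finset.sum_congr rfl fun i _ => hX i⟩
  · rintro ⟨X, rfl⟩
    exact ⟨fun i => ⟨_, mem_T.2 ⟨X i, rfl⟩⟩, rfl⟩

lemma T_le_TT {i : ℕ} {J : Finset ℕ} (h : i ∈ J) : G.T i ≤ G.TT J :=
  le_iSup₂_of_le i h le_rfl

lemma TT_mono {J J' : Finset ℕ} (h : J ⊆ J') : G.TT J ≤ G.TT J' :=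
  iSup₂_le fun _ hi => T_le_TT (h hi)

lemma TT_insert (c : ℕ) (J : Finset ℕ) : G.TT (insert c J) = G.T c ⊔ G.TT J :=
  Finset.iSup_insert _ _ _

lemma finrank_TT_le [NeZero d] (J : Finset ℕ) :
    Module.finrank Ω (G.TT J) ≤ J.card * (d * (n - d) + 1) := by
  induction J using Finset.induction_on with
  | empty =>
    have : G.TT ∅ = ⊥ := by simp [TT]
    rw [this, finrank_bot]
    exact Nat.zero_le _
  | insert c J hc ih =>
    rw [TT_insert, Finset.card_insert_of_notMem hc, add_mul, one_mul, add_comm]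
    exact (Submodule.finrank_add_le_finrank_add_finrank _ _).trans
      (add_le_add (finrank_tangent_le _) ih)

lemma x_mem_T [NeZero d] (i : ℕ) : G.x i ∈ G.T i := wedge_mem_tangent _

/-- A derivation applied to the coordinates of a tensor. -/
def der (D : Derivation ℂ Ω Ω) (u : (Fin d → Fin n) → Ω) : (Fin d → Fin n) → Ω := fun f => D (u f)

lemma der_sum (D : Derivation ℂ Ω Ω) {ι : Type*} (s : Finset ι) (u : ι → (Fin d → Fin n) → Ω) :
    der D (∑ i ∈ s, u i) = ∑ i ∈ s, der D (u i) := by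
  funext f
  simp [der]

lemma der_smul (D : Derivation ℂ Ω Ω) (c : Ω) (u : (Fin d → Fin n) → Ω) :
    der D (c • u) = D c • u + c • der D u := by
  funext f
  simp [der, mul_comm, add_comm]

lemma der_act (D : Derivation ℂ Ω Ω) (X : Matrix (Fin n) (Fin n) Ω) (u : (Fin d → Fin n) → Ω) :
    der D (act X u) = act (X.map D) u + act X (der D u) :=
  derivation_act D X u

lemma der_x_eq_act {D : Derivation ℂ Ω Ω} {X : Matrix (Fin n) (Fin n) Ω} {i : ℕ}
    (h : ∀ l a, D (G.z i l a) = X.mulVec (G.z i l) a) : der D (G.x i) = act X (G.x i) := by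
  rw [x, act_wedge]
  refine (derivation_wedge D _).trans ?_
  refine Finset.sum_congr rfl fun l _ => ?_
  congr 2
  funext a
  exact h l a

lemma der_x_eq_zero {D : Derivation ℂ Ω Ω} {i : ℕ}
    (h : ∀ l a, D (G.z i l a) = 0) : der D (G.x i) = 0 := by
  rw [der_x_eq_act (X := 0) (by simpa using h), act_zero]

lemma der_x_mem (D : Derivation ℂ Ω Ω) (i : ℕ) : der D (G.x i) ∈ G.T i :=
  derivation_wedge_mem_tangent D _

lemma der_sub_act {D : Derivation ℂ Ω Ω} {X : Matrix (Fin n) (Fin n) Ω} {c : Ω}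
    {x : (Fin d → Fin n) → Ω} (h : der D x - act X x = c • x) (Y : Matrix (Fin n) (Fin n) Ω) :
    der D (act Y x) - act X (act Y x) = act (Y.map D - (X * Y - Y * X) + c • Y) x := by
  have h' : der D x = act X x + c • x := by rw [← h]; abel
  rw [der_act, h', act_act X Y, act_add, act_sub (Y.map D), act_smul, map_add, map_smul]
  abel

lemma der_sub_act_mem_TT {D : Derivation ℂ Ω Ω} {X : Matrix (Fin n) (Fin n) Ω} {J : Finset ℕ}
    (h : ∀ i ∈ J, ∃ c : Ω, der D (G.x i) - act X (G.x i) = c • G.x i) {u : (Fin d → Fin n) → Ω}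
    (hu : u ∈ G.TT J) : der D u - act X u ∈ G.TT J := by
  obtain ⟨Y, rfl⟩ := mem_TT.1 hu
  rw [der_sum, map_sum, ← Finset.sum_sub_distrib]
  refine Submodule.sum_mem _ fun i hi => ?_
  obtain ⟨c, hc⟩ := h i hi
  rw [der_sub_act hc]
  exact T_le_TT hi (mem_T.2 ⟨_, rfl⟩)

lemma der_sub_act_mem_T {D : Derivation ℂ Ω Ω} {X : Matrix (Fin n) (Fin n) Ω} {i : ℕ} {c : Ω}
    (h : der D (G.x i) - act X (G.x i) = c • G.x i) {u : (Fin d → Fin n) → Ω}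
    (hu : u ∈ G.T i) : der D u - act X u ∈ G.T i := by
  obtain ⟨Y, rfl⟩ := mem_T.1 hu
  rw [der_sub_act h]
  exact mem_T.2 ⟨_, rfl⟩

/-- The field automorphism `φ` carries the `i`-th frame to the `τ i`-th. -/
def Lifts (G : GenericFrames Ω n d) (φ : Ω ≃+* Ω) (τ : Equiv.Perm ℕ) : Prop :=
  ∀ i l a, φ (G.z i l a) = G.z (τ i) l a

lemma Lifts.symm {φ : Ω ≃+* Ω} {τ : Equiv.Perm ℕ} (h : G.Lifts φ τ) : G.Lifts φ.symm τ.symm := by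
  intro i l a
  rw [RingEquiv.symm_apply_eq, h, Equiv.apply_symm_apply]

lemma Lifts.act_x {φ : Ω ≃+* Ω} {τ : Equiv.Perm ℕ} (h : G.Lifts φ τ) (i : ℕ)
    (X : Matrix (Fin n) (Fin n) Ω) :
    (fun f => φ (act X (G.x i) f)) = act (X.map φ) (G.x (τ i)) := by
  refine (map_act (φ : Ω →+* Ω) X _).trans ?_
  have : (fun f => (φ : Ω →+* Ω) (G.x i f)) = G.x (τ i) := by
    refine (map_wedge (φ : Ω →+* Ω) (G.z i)).trans ?_
    rw [x]
    congr 1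
    funext l a
    exact h i l a
  rw [this]
  rfl

lemma Lifts.mem_T {φ : Ω ≃+* Ω} {τ : Equiv.Perm ℕ} (h : G.Lifts φ τ) {i : ℕ}
    {u : (Fin d → Fin n) → Ω} (hu : u ∈ G.T i) : (fun f => φ (u f)) ∈ G.T (τ i) := by
  obtain ⟨X, rfl⟩ := GenericFrames.mem_T.1 hu
  rw [h.act_x]
  exact GenericFrames.mem_T.2 ⟨_, rfl⟩

lemma Lifts.mem_TT {φ : Ω ≃+* Ω} {τ : Equiv.Perm ℕ} (h : G.Lifts φ τ) {J : Finset ℕ}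
    {u : (Fin d → Fin n) → Ω} (hu : u ∈ G.TT J) :
    (fun f => φ (u f)) ∈ G.TT (J.map τ.toEmbedding) := by
  obtain ⟨X, rfl⟩ := GenericFrames.mem_TT.1 hu
  have : (fun f => φ ((∑ i ∈ J, act (X i) (G.x i)) f)) =
      ∑ i ∈ J, fun f => φ (act (X i) (G.x i) f) := by
    funext f
    simp
  rw [this]
  refine Submodule.sum_mem _ fun i hi => T_le_TT (Finset.mem_map_of_mem _ hi) ?_
  exact h.mem_T (GenericFrames.mem_T.2 ⟨_, rfl⟩)

/-- A family of subspaces of tangent spaces, functorial in the generic frames. -/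
structure IsExchangeFamily (G : GenericFrames Ω n d)
    (κ : ℕ → Finset ℕ → Submodule Ω ((Fin d → Fin n) → Ω)) : Prop where
  le : ∀ c J, κ c J ≤ G.T c
  mono : ∀ c {J J'}, J ⊆ J' → κ c J ≤ κ c J'
  transport : ∀ {φ τ}, G.Lifts φ τ → ∀ {c J u}, u ∈ κ c J →
    (fun f => φ (u f)) ∈ κ (τ c) (J.map τ.toEmbedding)
  deriv : ∀ {D : Derivation ℂ Ω Ω} {X : Matrix (Fin n) (Fin n) Ω} {b : Ω} {c J},
    (∀ i ∈ J, der D (G.x i) = act X (G.x i)) → der D (G.x c) = 0 → act X (G.x c) = b • G.x c →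
    ∀ {u}, u ∈ κ c J → der D u - act X u ∈ κ c J

lemma isExchangeFamily_inf : G.IsExchangeFamily fun c J => G.T c ⊓ G.TT J where
  le _ _ := inf_le_left
  mono _ _ _ h := inf_le_inf_left _ (TT_mono h)
  transport h _ _ _ hu := ⟨h.mem_T hu.1, h.mem_TT hu.2⟩
  deriv {D X b c J} hJ hc hb u hu := by
    refine ⟨der_sub_act_mem_T (c := -b) ?_ hu.1, der_sub_act_mem_TT (fun i hi => ⟨0, ?_⟩) hu.2⟩
    · rw [hc, hb, zero_sub, neg_smul]
    · rw [hJ i hi, sub_self, zero_smul]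

/-- The vectors of `T c` whose images under all matrices lie in the sum of the tangent spaces. -/
def prolong (G : GenericFrames Ω n d) (c : ℕ) (J : Finset ℕ) :
    Submodule Ω ((Fin d → Fin n) → Ω) where
  carrier := {u | u ∈ G.T c ∧ ∀ Z, act Z u ∈ G.TT (insert c J)}
  zero_mem' := ⟨zero_mem _, fun Z => by rw [map_zero]; exact zero_mem _⟩
  add_mem' h h' := ⟨add_mem h.1 h'.1, fun Z => by rw [map_add]; exact add_mem (h.2 Z) (h'.2 Z)⟩
  smul_mem' c _ h := ⟨Submodule.smul_mem _ c h.1, fun Z => by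
    rw [map_smul]; exact Submodule.smul_mem _ _ (h.2 Z)⟩

lemma isExchangeFamily_prolong : G.IsExchangeFamily G.prolong where
  le _ _ _ h := h.1
  mono _ _ _ h _ hu := ⟨hu.1, fun Z => TT_mono (Finset.insert_subset_insert _ h) (hu.2 Z)⟩
  transport {φ τ} h c J u hu := by
    refine ⟨h.mem_T hu.1, fun Z => ?_⟩
    have h1 := h.mem_TT (hu.2 (Z.map φ.symm))
    rw [Finset.map_insert] at h1
    have h2 := map_act (φ : Ω →+* Ω) (Z.map φ.symm) u
    have h3 : (Z.map φ.symm).map (φ : Ω →+* Ω) = Z := by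
      ext i j
      simp
    rw [h3] at h2
    change act Z (fun f => (φ : Ω →+* Ω) (u f)) ∈ _
    rw [← h2]
    exact h1
  deriv {D X b c J} hJ hc hb u hu := by
    have hc' : der D (G.x c) - act X (G.x c) = (-b) • G.x c := by rw [hc, hb, zero_sub, neg_smul]
    refine ⟨der_sub_act_mem_T hc' hu.1, fun Z => ?_⟩
    have h1 : der D (act Z u) - act X (act Z u) ∈ G.TT (insert c J) := by
      refine der_sub_act_mem_TT (fun i hi => ?_) (hu.2 Z)
      rcases Finset.mem_insert.1 hi with rfl | hi
      · exact ⟨_, hc'⟩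
      · exact ⟨0, by rw [hJ i hi, sub_self, zero_smul]⟩
    have h2 : act Z (der D u - act X u) = der D (act Z u) - act X (act Z u) -
        act (Z.map D) u - act (Z * X - X * Z) u := by
      rw [map_sub, der_act, act_act Z X]
      abel
    rw [h2]
    exact sub_mem (sub_mem h1 (hu.2 _)) (hu.2 _)

namespace IsExchangeFamily
variable {κ : ℕ → Finset ℕ → Submodule Ω ((Fin d → Fin n) → Ω)}
variable {c j : ℕ} {J : Finset ℕ}

lemma le_of_perm (hκ : G.IsExchangeFamily κ) (τ : Equiv.Perm ℕ) {c c' : ℕ} {J J' : Finset ℕ}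
    (h : κ c J ≤ κ c' J') :
    κ (τ c) (J.map τ.toEmbedding) ≤ κ (τ c') (J'.map τ.toEmbedding) := by
  obtain ⟨φ, hφ⟩ := G.exists_equiv τ
  have hφ : G.Lifts φ τ := hφ
  intro u hu
  have h1 := hκ.transport hφ.symm hu
  have h2 : (J.map τ.toEmbedding).map τ.symm.toEmbedding = J := by
    ext i
    simp
  rw [Equiv.symm_apply_apply, h2] at h1
  have h3 := hκ.transport hφ (h h1)
  simpa using h3

lemma le_of_swap (hκ : G.IsExchangeFamily κ) (hjc : j ≠ c) (hj : j ∉ J)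
    {j' : ℕ} (hjc' : j' ≠ c) (hj' : j' ∉ J)
    (h : κ c (insert j J) ≤ κ c J) : κ c (insert j' J) ≤ κ c J := by
  have h1 := hκ.le_of_perm (Equiv.swap j j') h
  have h2 : J.map (Equiv.swap j j').toEmbedding = J := by
    ext i
    simp only [Finset.mem_map_equiv, Equiv.symm_swap]
    by_cases h : i = j
    · subst h; simp [hj, hj']
    · by_cases h' : i = j'
      · subst h'; simp [hj, hj']
      · rw [Equiv.swap_apply_of_ne_of_ne h h']
  rwa [Equiv.swap_apply_of_ne_of_ne hjc.symm hjc'.symm, Finset.map_insert, h2,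
    Equiv.coe_toEmbedding, Equiv.swap_apply_left] at h1

lemma eq_of_card_eq (hκ : G.IsExchangeFamily κ) {J₁ : Finset ℕ} (hc₁ : c ∉ J₁) :
    ∀ {J : Finset ℕ} {j : ℕ}, c ∉ J → j ≠ c → j ∉ J → κ c (insert j J) ≤ κ c J →
      J₁.card = J.card → κ c J = κ c J₁ := by
  intro J
  induction hk : (J₁ \ J).card generalizing J with
  | zero =>
    intro j _ _ _ _ hcard
    rw [Finset.card_eq_zero, Finset.sdiff_eq_empty_iff_subset] at hk
    rw [Finset.eq_of_subset_of_card_le hk hcard.ge]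
  | succ k ih =>
    intro j hcJ hjc hj h hcard
    obtain ⟨j', hj'⟩ : (J₁ \ J).Nonempty := Finset.card_pos.1 (by omega)
    obtain ⟨i, hi⟩ : (J \ J₁).Nonempty := by
      rw [← Finset.card_pos, ← Finset.card_sdiff_comm hcard]
      omega
    rw [Finset.mem_sdiff] at hj' hi
    have hjc' : j' ≠ c := by rintro rfl; exact hc₁ hj'.1
    have hic : i ≠ c := by rintro rfl; exact hcJ hi.1
    have hij : i ≠ j' := by rintro rfl; exact hi.2 hj'.1
    have h1 : κ c (insert j' J) ≤ κ c J := hκ.le_of_swap hjc hj hjc' hj'.2 h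
    set L := insert j' (J.erase i) with hL
    have hLJ : insert i L = insert j' J := by
      rw [hL, Finset.insert_comm, Finset.insert_erase hi.1]
    have hmap : J.map (Equiv.swap i j').toEmbedding = L := by
      have : J = insert i (J.erase i) := (Finset.insert_erase hi.1).symm
      conv_lhs => rw [this]
      rw [Finset.map_insert, Equiv.coe_toEmbedding, Equiv.swap_apply_left, hL]
      congr 1
      ext a
      simp only [Finset.mem_map_equiv, Equiv.symm_swap]
      by_cases h : a = i
      · subst h; simp [hj'.2]
      · by_cases h' : a = j'
        · subst h'; simp [hj'.2]
        · rw [Equiv.swap_apply_of_ne_of_ne h h']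
    have h2 := hκ.le_of_perm (Equiv.swap i j') h1
    rw [Equiv.swap_apply_of_ne_of_ne hic.symm hjc'.symm, Finset.map_insert, hmap,
      Equiv.coe_toEmbedding, Equiv.swap_apply_right] at h2
    have hiL : i ∉ L := by simp [hL, hij]
    have hcL : c ∉ L := by simp [hL, hjc'.symm, hcJ]
    have hLc : L.card = J.card := by
      rw [← hmap, Finset.card_map]
    have h3 : κ c J = κ c L := by
      apply le_antisymm
      · refine (hκ.mono c (Finset.subset_insert j' J)).trans ?_
        rw [← hLJ]
        exact h2
      · refine (hκ.mono c (Finset.subset_insert i L)).trans ?_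
        rw [hLJ]
        exact h1
    rw [h3]
    refine ih ?_ hcL hic hiL h2 (hcard.trans hLc.symm)
    have : J₁ \ L = (J₁ \ J).erase j' := by
      ext a
      simp only [hL, Finset.mem_sdiff, Finset.mem_insert, Finset.mem_erase]
      constructor
      · rintro ⟨ha, hb⟩
        push Not at hb
        refine ⟨hb.1, ha, fun haJ => ?_⟩
        by_cases hai : a = i
        · subst hai; exact hi.2 ha
        · exact hb.2 hai haJ
      · rintro ⟨ha, hb, hc⟩
        exact ⟨hb, by simp [ha, hc]⟩
    rw [this, Finset.card_erase_of_mem (Finset.mem_sdiff.2 hj'), hk]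
    rfl

lemma isParabolicStable (hκ : G.IsExchangeFamily κ) (hcJ : c ∉ J) (hjc : j ≠ c) (hj : j ∉ J)
    (h : κ c (insert j J) ≤ κ c J) : IsParabolicStable (G.x c) (κ c J) := by
  intro X b hb u hu
  obtain ⟨J₁, hJ₁, hcard⟩ :=
    (insert c J).finite_toSet.infinite_compl.exists_subset_card_eq J.card
  have hdisj : ∀ i ∈ J₁, i ≠ c ∧ i ∉ J := by
    intro i hi
    have := hJ₁ hi
    simpa [not_or] using this
  have hc₁ : c ∉ J₁ := fun hc => (hdisj c hc).1 rfl
  obtain ⟨D, hD⟩ := G.exists_derivation fun i l a => if i ∈ J₁ then X.mulVec (G.z i l) a else 0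
  have hzero : ∀ i, i ∉ J₁ → der D (G.x i) = 0 := fun i hi =>
    der_x_eq_zero fun l a => by rw [hD, if_neg hi]
  have h1 := hκ.deriv (D := D) (X := 0) (b := 0) (c := c) (J := J)
    (fun i hi => by rw [hzero i (fun hi' => (hdisj i hi').2 hi), act_zero]) (hzero c hc₁)
    (by rw [act_zero, zero_smul]) hu
  have heq := hκ.eq_of_card_eq hc₁ hcJ hjc hj h hcard
  have h2 := hκ.deriv (D := D) (X := X) (b := b) (c := c) (J := J₁)
    (fun i hi => der_x_eq_act fun l a => by rw [hD, if_pos hi]) (hzero c hc₁) hb (heq ▸ hu)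
  rw [← heq] at h2
  have h3 := sub_mem h1 h2
  rw [act_zero] at h3
  simpa using h3

lemma exists_isParabolicStable [NeZero d] (hκ : G.IsExchangeFamily κ) (hcJ : c ∉ J) :
    ∃ J', J ⊆ J' ∧ c ∉ J' ∧ J'.card ≤ J.card + (d * (n - d) + 1) ∧
      IsParabolicStable (G.x c) (κ c J') := by
  have key : ∀ t, (∃ J', J ⊆ J' ∧ c ∉ J' ∧ J'.card < J.card + t ∧
      IsParabolicStable (G.x c) (κ c J')) ∨
      ∃ J', J ⊆ J' ∧ c ∉ J' ∧ J'.card = J.card + t ∧ t ≤ Module.finrank Ω (κ c J') := by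
    intro t
    induction t with
    | zero => exact Or.inr ⟨J, subset_rfl, hcJ, rfl, Nat.zero_le _⟩
    | succ t ih =>
      rcases ih with ⟨J', h1, h2, h3, h4⟩ | ⟨J', h1, h2, h3, h4⟩
      · exact Or.inl ⟨J', h1, h2, by omega, h4⟩
      · obtain ⟨j, hj⟩ := Infinite.exists_notMem_finset (insert c J')
        rw [Finset.mem_insert, not_or] at hj
        by_cases hle : κ c (insert j J') ≤ κ c J'
        · exact Or.inl ⟨J', h1, h2, by omega, hκ.isParabolicStable h2 hj.1 hj.2 hle⟩
        · refine Or.inr ⟨insert j J', h1.trans (Finset.subset_insert _ _), ?_, ?_, ?_⟩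
          · rw [Finset.mem_insert, not_or]
            exact ⟨Ne.symm hj.1, h2⟩
          · rw [Finset.card_insert_of_notMem hj.2, h3]
            rfl
          · exact Nat.succ_le_of_lt (h4.trans_lt (Submodule.finrank_lt_finrank_of_lt
              (lt_of_le_not_ge (hκ.mono c (Finset.subset_insert _ _)) hle)))
  rcases key (d * (n - d) + 1 + 1) with ⟨J', h1, h2, h3, h4⟩ | ⟨J', h1, h2, h3, h4⟩
  · exact ⟨J', h1, h2, by omega, h4⟩
  · have h5 := Submodule.finrank_mono (hκ.le c J')
    have h6 : Module.finrank Ω (G.T c) ≤ d * (n - d) + 1 := finrank_tangent_le (G.z c)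
    omega

end IsExchangeFamily
end GenericFrames

end

section

variable {n d : ℕ}

/-- The wedge of the coordinate vectors indexed by `g`. -/
def wedgeSingle (F : Type*) [Field F] (g : Fin d → Fin n) : (Fin d → Fin n) → F :=
  wedge F n d fun l => Pi.single (g l) 1

lemma wedgeSingle_orderEmb (F : Type*) [Field F] (S S' : {S : Finset (Fin n) // S.card = d}) :
    wedgeSingle F (S.1.orderEmbOfFin S.2) (S'.1.orderEmbOfFin S'.2) = if S = S' then 1 else 0 := by
  rw [wedgeSingle, wedge_apply]
  split_ifs with h
  · subst h
    convert Matrix.det_one (n := Fin d) (R := F)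
    ext l k
    simp [Matrix.one_apply, Pi.single_apply, eq_comm]
  · obtain ⟨a, ha, ha'⟩ : ∃ a ∈ S.1, a ∉ S'.1 := by
      by_contra hcon
      push Not at hcon
      exact h (Subtype.ext (Finset.eq_of_subset_of_card_le hcon (by rw [S.2, S'.2])))
    obtain ⟨l, rfl⟩ : a ∈ Set.range (S.1.orderEmbOfFin S.2) := by
      rw [Finset.range_orderEmbOfFin]
      exact ha
    refine Matrix.det_eq_zero_of_row_eq_zero l fun k => ?_
    rw [Matrix.of_apply, Pi.single_apply, if_neg]
    rintro hk
    exact ha' (hk ▸ Finset.orderEmbOfFin_mem _ _ _)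

lemma choose_le_finrank {F : Type*} [Field F] (W : Submodule F ((Fin d → Fin n) → F))
    (hW : ∀ g : Fin d → Fin n, wedgeSingle F g ∈ W) : n.choose d ≤ Module.finrank F W := by
  have hli : LinearIndependent F fun S : {S : Finset (Fin n) // S.card = d} =>
      (⟨wedgeSingle F (S.1.orderEmbOfFin S.2), hW _⟩ : W) := by
    rw [Fintype.linearIndependent_iff]
    intro g hg S
    have := congrArg (fun w : W => w.1 (S.1.orderEmbOfFin S.2)) hg
    simpa [wedgeSingle_orderEmb] using this
  simpa using hli.fintype_card_le_finrank

namespace GenericFrames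
variable {Ω : Type*} [Field Ω] [Algebra ℂ Ω] {G : GenericFrames Ω n d}

lemma choose_le_of_stable {W : Submodule Ω ((Fin d → Fin n) → Ω)} {J : Finset ℕ} {c : ℕ}
    (hc : c ∉ J) (hx : G.x c ∈ W)
    (hW : ∀ D : Derivation ℂ Ω Ω, (∀ i ∈ J, der D (G.x i) = 0) → ∀ u ∈ W, der D u ∈ W) :
    n.choose d ≤ Module.finrank Ω W := by
  refine choose_le_finrank W fun g => ?_
  have key : ∀ s : Finset (Fin d),
      wedge Ω n d (fun l => if l ∈ s then Pi.single (g l) 1 else G.z c l) ∈ W := by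
    intro s
    induction s using Finset.induction_on with
    | empty =>
      simp only [Finset.notMem_empty, if_false]
      exact hx
    | insert k s hk ih =>
      obtain ⟨D, hD⟩ := G.exists_derivation fun i l =>
        if i = c ∧ l = k then Pi.single (g k) 1 else 0
      have h1 := hW D (fun i hi => der_x_eq_zero fun l a => by
        rw [hD, if_neg]
        · rfl
        · rintro ⟨rfl, -⟩
          exact hc hi) _ ih
      have h2 := derivation_wedge D fun l => if l ∈ s then Pi.single (g l) 1 else G.z c l
      rw [Finset.sum_eq_single k] at h2
      · change (fun f => D _) ∈ W at h1
        rw [h2] at h1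
        convert h1 using 2
        funext l
        rcases eq_or_ne l k with rfl | hl
        · rw [if_pos (Finset.mem_insert_self _ _), Function.update_self]
          funext a
          simp only [if_neg hk]
          rw [hD, if_pos ⟨rfl, rfl⟩]
        · rw [Function.update_of_ne hl]
          simp [hl]
      · intro l _ hl
        refine (wedge Ω n d).map_coord_zero l ?_
        rw [Function.update_self]
        funext a
        split_ifs with hls
        · by_cases ha : a = g l
          · subst ha; simp
          · simp [ha]
        · rw [hD, if_neg fun h => hl h.2]
      · simp
  simpa [wedgeSingle] using key Finset.univ

variable [NeZero d] {m : ℕ}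

lemma disjoint_T_TT (hb : (d * (n - d) + 1) * (m + 1 + (d * (n - d) + 1)) ≤ n.choose d)
    {c : ℕ} {J : Finset ℕ} (hc : c ∉ J) (hJ : J.card < m) : Disjoint (G.T c) (G.TT J) := by
  rw [disjoint_iff]
  by_contra hne
  obtain ⟨J', h1, h2, h3, h4⟩ := (isExchangeFamily_inf (G := G)).exists_isParabolicStable hc
  have hle : G.T c ⊓ G.TT J ≤ G.T c ⊓ G.TT J' := isExchangeFamily_inf.mono c h1
  have hx : G.x c ∈ G.T c ⊓ G.TT J' := wedge_mem_of_isParabolicStable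
    (inf_le_left : G.T c ⊓ G.TT J' ≤ G.T c) h4 fun h => hne (le_bot_iff.1 (h ▸ hle))
  have h5 : n.choose d ≤ Module.finrank Ω (G.TT J') := by
    refine choose_le_of_stable h2 hx.2 fun D hD u hu => ?_
    have := der_sub_act_mem_TT (X := 0) (D := D)
      (fun i hi => ⟨0, by rw [hD i hi, act_zero, sub_zero, zero_smul]⟩) hu
    rwa [act_zero, sub_zero] at this
  have h6 := finrank_TT_le (G := G) J'
  have hN : 0 < d * (n - d) + 1 := Nat.succ_pos _
  generalize d * (n - d) + 1 = N at *
  have h7 : N * (m + 1 + N) ≤ N * J'.card := by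
    rw [mul_comm N J'.card]; omega
  exact absurd (Nat.le_of_mul_le_mul_left h7 hN) (by omega)

lemma prolong_le_span (hb : (d * (n - d) + 1) * (m + 1 + (d * (n - d) + 1)) ≤ n.choose d)
    {c : ℕ} {J : Finset ℕ} (hc : c ∉ J) (hJ : J.card < m) : G.prolong c J ≤ Ω ∙ G.x c := by
  by_contra hne
  obtain ⟨J', h1, h2, h3, h4⟩ := (isExchangeFamily_prolong (G := G)).exists_isParabolicStable hc
  have hle : G.prolong c J ≤ G.prolong c J' := isExchangeFamily_prolong.mono c h1
  have heq : G.prolong c J' = G.T c := eq_tangent_of_isParabolicStable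
    (isExchangeFamily_prolong.le c J') h4 fun h => hne (hle.trans h)
  have hmem : ∀ i ∈ insert c J', ∀ u ∈ G.T i, ∀ Z, act Z u ∈ G.TT (insert c J') := by
    intro i hi u hu Z
    rcases eq_or_ne i c with rfl | hic
    · rw [← heq] at hu
      exact hu.2 Z
    · obtain ⟨φ, hφ⟩ := G.exists_equiv (Equiv.swap c i)
      have hφ : G.Lifts φ (Equiv.swap c i) := hφ
      have h5 := hφ.symm.mem_T hu
      rw [Equiv.symm_swap, Equiv.swap_apply_right, ← heq] at h5
      have h6 := (isExchangeFamily_prolong.transport hφ h5).2 Z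
      rw [← Equiv.coe_toEmbedding, ← Finset.map_insert] at h6
      have h7 : (insert c J').map (Equiv.swap c i).toEmbedding = insert c J' := by
        ext a
        simp only [Finset.mem_map_equiv, Equiv.symm_swap]
        by_cases h : a = c
        · subst h; simp only [Equiv.swap_apply_left, hi, Finset.mem_insert_self]
        · by_cases h' : a = i
          · subst h'; simp only [Equiv.swap_apply_right, hi, Finset.mem_insert_self]
          · rw [Equiv.swap_apply_of_ne_of_ne h h']
      rw [h7] at h6
      simpa using h6
  have h5 : n.choose d ≤ Module.finrank Ω (G.TT (insert c J')) := by
    refine choose_le_of_stable (Finset.notMem_empty c)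
      (T_le_TT (Finset.mem_insert_self _ _) (x_mem_T c)) fun D _ u hu => ?_
    obtain ⟨Y, rfl⟩ := mem_TT.1 hu
    rw [der_sum]
    refine Submodule.sum_mem _ fun i hi => ?_
    rw [der_act]
    exact add_mem (T_le_TT hi (mem_T.2 ⟨_, rfl⟩)) (hmem i hi _ (der_x_mem D i) _)
  have h6 := finrank_TT_le (G := G) (insert c J')
  rw [Finset.card_insert_of_notMem h2] at h6
  have hN : 0 < d * (n - d) + 1 := Nat.succ_pos _
  generalize d * (n - d) + 1 = N at *
  have h7 : N * (m + 1 + N) ≤ N * (J'.card + 1) := by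
    rw [mul_comm N (J'.card + 1)]; omega
  exact absurd (Nat.le_of_mul_le_mul_left h7 hN) (by omega)

end GenericFrames

end

section

variable {n d : ℕ}

/-- The tangent spaces at the points of the family are independent, and no point is zero. -/
lemma tangent_independent {F : Type*} [Field F] [NeZero d] {m : ℕ} (y : Fin m → Fin d → Fin n → F)
    (h : m * (d * (n - d) + 1) ≤ Module.finrank F (⨆ j, tangent (y j) : Submodule F _)) :
    (∀ w : Fin m → (Fin d → Fin n) → F, (∀ j, w j ∈ tangent (y j)) → ∑ j, w j = 0 →
      ∀ j, w j = 0) ∧ (∀ j, wedge F n d (y j) ≠ 0) ∧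
      Module.finrank F (⨆ j, tangent (y j) : Submodule F _) ≤ m * (d * (n - d) + 1) := by
  let Φ : (Π j, tangent (y j)) →ₗ[F] ((Fin d → Fin n) → F) :=
    ∑ j, (tangent (y j)).subtype ∘ₗ LinearMap.proj j
  have hΦ : ∀ w, Φ w = ∑ j, (w j : (Fin d → Fin n) → F) := fun w => by simp [Φ]
  have hrange : (⨆ j, tangent (y j) : Submodule F _) ≤ LinearMap.range Φ := by
    refine iSup_le fun j u hu => ⟨Pi.single j ⟨u, hu⟩, ?_⟩
    rw [hΦ, Finset.sum_eq_single j]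
    · simp
    · intro l _ hl
      simp [hl]
    · simp
  have h1 : Module.finrank F (Π j, tangent (y j)) = ∑ j, Module.finrank F (tangent (y j)) :=
    Module.finrank_pi_fintype F
  have h2 : ∑ j, Module.finrank F (tangent (y j)) ≤ ∑ _j : Fin m, (d * (n - d) + 1) :=
    Finset.sum_le_sum fun j _ => finrank_tangent_le (y j)
  have h3 : ∑ _j : Fin m, (d * (n - d) + 1) = m * (d * (n - d) + 1) := by simp
  have h4 := LinearMap.finrank_range_add_finrank_ker Φ
  have h5 := Submodule.finrank_mono hrange
  have h6 : Module.finrank F (LinearMap.ker Φ) = 0 := by omega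
  have h7 : ∑ j, Module.finrank F (tangent (y j)) = ∑ _j : Fin m, (d * (n - d) + 1) := by omega
  refine ⟨?_, ?_, by omega⟩
  · intro w hw hsum j
    have : (fun j => (⟨w j, hw j⟩ : tangent (y j))) ∈ LinearMap.ker Φ := by
      rw [LinearMap.mem_ker, hΦ, hsum]
    rw [Submodule.finrank_eq_zero.1 h6, Submodule.mem_bot] at this
    exact congrArg Subtype.val (congrFun this j)
  · intro j hj
    have := (Finset.sum_eq_sum_iff_of_le fun j _ => finrank_tangent_le (y j)).1 h7 j
      (Finset.mem_univ j)
    rw [tangent_eq_bot hj, finrank_bot] at this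
    omega

namespace GenericFrames
variable {Ω : Type*} [Field Ω] [Algebra ℂ Ω] {G : GenericFrames Ω n d} {m : ℕ}

lemma finrank_TT [NeZero d] (hb : (d * (n - d) + 1) * (m + 1 + (d * (n - d) + 1)) ≤ n.choose d)
    {J : Finset ℕ} (hJ : J.card ≤ m) :
    Module.finrank Ω (G.TT J) = J.card * (d * (n - d) + 1) := by
  induction J using Finset.induction_on with
  | empty =>
    have : G.TT ∅ = ⊥ := by simp [TT]
    rw [this, finrank_bot, Finset.card_empty, zero_mul]
  | insert c J hc ih =>
    rw [Finset.card_insert_of_notMem hc] at hJ ⊢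
    have h1 := Submodule.finrank_sup_add_finrank_inf_eq (G.T c) (G.TT J)
    have h2 : Module.finrank Ω (G.T c) = d * (n - d) + 1 := finrank_tangent (G.ne_zero c)
    rw [(disjoint_T_TT hb hc (by omega)).eq_bot, finrank_bot, ih (by omega), h2] at h1
    rw [TT_insert, add_mul, one_mul]
    omega

lemma iSup_T_eq (G : GenericFrames Ω n d) (m : ℕ) :
    (⨆ i : Fin m, tangent (G.z i)) = G.TT (Finset.range m) := by
  apply le_antisymm
  · exact iSup_le fun i => T_le_TT (Finset.mem_range.2 i.2)
  · exact iSup₂_le fun i hi => le_iSup_of_le ⟨i, Finset.mem_range.1 hi⟩ le_rfl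

lemma sum_T_independent [NeZero d]
    (hb : (d * (n - d) + 1) * (m + 1 + (d * (n - d) + 1)) ≤ n.choose d)
    {w : Fin m → (Fin d → Fin n) → Ω} (hw : ∀ i : Fin m, w i ∈ G.T i) (h : ∑ i, w i = 0)
    (i : Fin m) : w i = 0 := by
  refine (tangent_independent (fun i : Fin m => G.z i) ?_).1 w hw h i
  rw [iSup_T_eq, finrank_TT hb (by simp)]
  simp

section Decomposition
variable {y : Fin m → Fin d → Fin n → Ω}

lemma TT_le_iSup_tangent (hsum : ∑ j, wedge Ω n d (y j) = ∑ i : Fin m, G.x i) :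
    G.TT (Finset.range m) ≤ ⨆ j, tangent (y j) := by
  refine iSup₂_le fun i hi u hu => ?_
  obtain ⟨X, rfl⟩ := mem_T.1 hu
  rw [Finset.mem_range] at hi
  obtain ⟨D, hD⟩ := G.exists_derivation fun k l a => if k = i then X.mulVec (G.z k l) a else 0
  have h1 : der D (∑ k : Fin m, G.x k) = act X (G.x i) := by
    rw [der_sum, Finset.sum_eq_single ⟨i, hi⟩]
    · exact der_x_eq_act fun l a => by simp [hD]
    · intro k _ hk
      exact der_x_eq_zero fun l a => by
        rw [hD, if_neg fun h => hk (Fin.ext h)]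
    · simp
  rw [← h1, ← hsum, der_sum]
  exact Submodule.sum_mem _ fun j _ => Submodule.mem_iSup_of_mem j
    (derivation_wedge_mem_tangent D (y j))

variable [NeZero d]

lemma le_finrank_iSup_tangent
    (hb : (d * (n - d) + 1) * (m + 1 + (d * (n - d) + 1)) ≤ n.choose d)
    (hsum : ∑ j, wedge Ω n d (y j) = ∑ i : Fin m, G.x i) :
    m * (d * (n - d) + 1) ≤ Module.finrank Ω (⨆ j, tangent (y j) : Submodule Ω _) := by
  have h := Submodule.finrank_mono (TT_le_iSup_tangent hsum)
  rwa [finrank_TT hb (by simp), Finset.card_range] at h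

lemma TT_eq_iSup_tangent
    (hb : (d * (n - d) + 1) * (m + 1 + (d * (n - d) + 1)) ≤ n.choose d)
    (hsum : ∑ j, wedge Ω n d (y j) = ∑ i : Fin m, G.x i) :
    G.TT (Finset.range m) = ⨆ j, tangent (y j) := by
  refine Submodule.eq_of_le_of_finrank_le (TT_le_iSup_tangent hsum) ?_
  rw [finrank_TT hb (by simp), Finset.card_range]
  exact (tangent_independent y (le_finrank_iSup_tangent hb hsum)).2.2

lemma sum_tangent_independent
    (hb : (d * (n - d) + 1) * (m + 1 + (d * (n - d) + 1)) ≤ n.choose d)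
    (hsum : ∑ j, wedge Ω n d (y j) = ∑ i : Fin m, G.x i)
    {w : Fin m → (Fin d → Fin n) → Ω} (hw : ∀ j, w j ∈ tangent (y j))
    (h : ∑ j, w j = 0) (j : Fin m) : w j = 0 :=
  (tangent_independent y (le_finrank_iSup_tangent hb hsum)).1 w hw h j

lemma wedge_mem_span
    (hb : (d * (n - d) + 1) * (m + 1 + (d * (n - d) + 1)) ≤ n.choose d)
    (hsum : ∑ j, wedge Ω n d (y j) = ∑ i : Fin m, G.x i)
    (j : Fin m) :
    wedge Ω n d (y j) ∈ Submodule.span Ω (Set.range fun i : Fin m => G.x i) := by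
  have hmem : wedge Ω n d (y j) ∈ G.TT (Finset.range m) := by
    rw [TT_eq_iSup_tangent hb hsum]
    exact Submodule.mem_iSup_of_mem j (wedge_mem_tangent _)
  obtain ⟨X, hX⟩ := mem_TT.1 hmem
  obtain ⟨D, hD⟩ := G.exists_derivation fun k l a => (X k).mulVec (G.z k l) a
  have hDx : ∀ i, der D (G.x i) = act (X i) (G.x i) := fun i => der_x_eq_act fun l a => hD i l a
  have hDsum : ∑ i : Fin m, der D (G.x i) = wedge Ω n d (y j) := by
    rw [← hX, Finset.sum_range]
    exact Finset.sum_congr rfl fun i _ => hDx i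
  have hDy : ∀ l, der D (wedge Ω n d (y l)) =
      (if l = j then (1 : Ω) else 0) • wedge Ω n d (y l) := by
    intro l
    rw [← sub_eq_zero]
    refine sum_tangent_independent hb hsum (w := fun l => der D (wedge Ω n d (y l)) -
      (if l = j then (1 : Ω) else 0) • wedge Ω n d (y l)) (fun l => ?_) ?_ l
    · exact sub_mem (derivation_wedge_mem_tangent D (y l))
        (Submodule.smul_mem _ _ (wedge_mem_tangent _))
    · rw [Finset.sum_sub_distrib, ← der_sum, hsum, der_sum, hDsum]
      simp
  have hstab : ∀ u ∈ G.TT (Finset.range m), der D u ∈ G.TT (Finset.range m) := by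
    rw [TT_eq_iSup_tangent hb hsum]
    intro u hu
    induction hu using Submodule.iSup_induction' with
    | mem l u hu =>
      obtain ⟨Y, rfl⟩ := mem_tangent.1 hu
      rw [der_act, hDy, map_smul]
      exact Submodule.mem_iSup_of_mem l (add_mem (act_wedge_mem_tangent _ _)
        (Submodule.smul_mem _ _ (act_wedge_mem_tangent _ _)))
    | zero =>
      convert zero_mem (⨆ j, tangent (y j))
      funext f
      simp [der]
    | add u v _ _ hu hv =>
      have : der D (u + v) = der D u + der D v := by funext f; simp [der]
      rw [this]
      exact add_mem hu hv
  rw [← hDsum]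
  refine Submodule.sum_mem _ fun i _ => ?_
  have hi : (i : ℕ) ∈ Finset.range m := Finset.mem_range.2 i.2
  have hp : der D (G.x i) ∈ G.prolong i ((Finset.range m).erase i) := by
    refine ⟨der_x_mem D i, fun Z => ?_⟩
    rw [Finset.insert_erase hi]
    have h1 := hstab (act Z (G.x i)) (T_le_TT hi (mem_T.2 ⟨Z, rfl⟩))
    rw [der_act] at h1
    exact (Submodule.add_mem_iff_right _ (T_le_TT hi (mem_T.2 ⟨_, rfl⟩))).1 h1
  have hcard : ((Finset.range m).erase (i : ℕ)).card < m := by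
    rw [Finset.card_erase_of_mem hi, Finset.card_range]
    have := i.2
    omega
  obtain ⟨a, ha⟩ := Submodule.mem_span_singleton.1
    (prolong_le_span hb (Finset.notMem_erase _ _) hcard hp)
  rw [← ha]
  exact Submodule.smul_mem _ _ (Submodule.subset_span ⟨i, rfl⟩)

lemma linearIndependent_wedge
    (hb : (d * (n - d) + 1) * (m + 1 + (d * (n - d) + 1)) ≤ n.choose d)
    (hsum : ∑ j, wedge Ω n d (y j) = ∑ i : Fin m, G.x i) :
    LinearIndependent Ω fun j => wedge Ω n d (y j) := by
  rw [Fintype.linearIndependent_iff]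
  intro g hg j
  have := sum_tangent_independent hb hsum
    (fun j => Submodule.smul_mem _ (g j) (wedge_mem_tangent (y j))) hg j
  exact (smul_eq_zero.1 this).resolve_right
    ((tangent_independent y (le_finrank_iSup_tangent hb hsum)).2.1 j)

lemma span_wedge_eq
    (hb : (d * (n - d) + 1) * (m + 1 + (d * (n - d) + 1)) ≤ n.choose d)
    (hsum : ∑ j, wedge Ω n d (y j) = ∑ i : Fin m, G.x i) :
    Submodule.span Ω (Set.range fun j => wedge Ω n d (y j)) =
    Submodule.span Ω (Set.range fun i : Fin m => G.x i) := by
  refine Submodule.eq_of_le_of_finrank_le ?_ ?_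
  · rw [Submodule.span_le]
    rintro _ ⟨j, rfl⟩
    exact wedge_mem_span hb hsum j
  · rw [finrank_span_eq_card (linearIndependent_wedge hb hsum)]
    exact finrank_range_le_card _

lemma exists_column
    (hb : (d * (n - d) + 1) * (m + 1 + (d * (n - d) + 1)) ≤ n.choose d)
    (hsum : ∑ j, wedge Ω n d (y j) = ∑ i : Fin m, G.x i)
    (hN : 0 < d * (n - d)) {c : Fin m → Fin m → Ω}
    (hc : ∀ i : Fin m, G.x i = ∑ j, c i j • wedge Ω n d (y j)) (i₀ : Fin m) :
    ∃ j, ∀ i, i ≠ i₀ → c i j = 0 := by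
  by_contra hcon
  push Not at hcon
  have hder : ∀ (D : Derivation ℂ Ω Ω) (i : Fin m), der D (G.x i) =
      ∑ j, (D (c i j) • wedge Ω n d (y j) + c i j • der D (wedge Ω n d (y j))) := by
    intro D i
    rw [hc i, der_sum]
    exact Finset.sum_congr rfl fun j _ => der_smul _ _ _
  have hT : ∀ u ∈ G.T i₀, u ∈ Submodule.span Ω (Set.range fun j => wedge Ω n d (y j)) := by
    intro u hu
    obtain ⟨X, rfl⟩ := mem_T.1 hu
    obtain ⟨D, hD⟩ := G.exists_derivation fun k l a =>
      if k = i₀ then X.mulVec (G.z k l) a else 0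
    have h0 : der D (G.x i₀) = act X (G.x i₀) := der_x_eq_act fun l a => by simp [hD]
    rw [← h0, hder]
    refine Submodule.sum_mem _ fun j _ => ?_
    have hyj : wedge Ω n d (y j) ∈ Submodule.span Ω (Set.range fun j => wedge Ω n d (y j)) :=
      Submodule.subset_span ⟨j, rfl⟩
    refine add_mem (Submodule.smul_mem _ _ hyj) (Submodule.smul_mem _ _ ?_)
    obtain ⟨i, hi, hij⟩ := hcon j
    have h1 : der D (G.x i) = 0 := der_x_eq_zero fun l a => by
      rw [hD, if_neg fun h => hi (Fin.ext h)]
    rw [hder] at h1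
    have h2 := sum_tangent_independent hb hsum (fun j => add_mem
      (Submodule.smul_mem _ _ (wedge_mem_tangent _))
      (Submodule.smul_mem _ _ (derivation_wedge_mem_tangent D (y j)))) h1 j
    refine (Submodule.smul_mem_iff _ hij).1 ?_
    change c i j • der D (wedge Ω n d (y j)) ∈ _
    change _ + c i j • der D (wedge Ω n d (y j)) = 0 at h2
    rw [← neg_eq_iff_add_eq_zero.2 h2]
    exact neg_mem (Submodule.smul_mem _ _ hyj)
  have hT' : G.T i₀ ≤ Ω ∙ G.x i₀ := by
    intro u hu
    have h1 := hT u hu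
    rw [span_wedge_eq hb hsum, Submodule.mem_span_range_iff_exists_fun] at h1
    obtain ⟨b, rfl⟩ := h1
    have h2 := sum_T_independent (G := G) hb (w := fun i => b i • G.x i -
      if i = i₀ then ∑ i : Fin m, b i • G.x i else 0) (fun i => ?_) (by simp) i₀
    · rw [if_pos rfl, sub_eq_zero] at h2
      rw [← h2]
      exact Submodule.smul_mem _ _ (Submodule.mem_span_singleton_self _)
    · refine sub_mem (Submodule.smul_mem _ _ (x_mem_T _)) ?_
      split_ifs with h
      · rw [h]; exact hu
      · exact zero_mem _
  have h1 := (Submodule.finrank_mono hT').trans_eq (finrank_span_singleton (G.ne_zero i₀))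
  have h2 : Module.finrank Ω (G.T i₀) = d * (n - d) + 1 := finrank_tangent (G.ne_zero i₀)
  omega

/-- A sum of generic decomposable tensors has a unique decomposition. -/
theorem unique_decomposition
    (hb : (d * (n - d) + 1) * (m + 1 + (d * (n - d) + 1)) ≤ n.choose d)
    (hsum : ∑ j, wedge Ω n d (y j) = ∑ i : Fin m, G.x i)
    (hN : 0 < d * (n - d)) :
    ∃ e : Equiv.Perm (Fin m), ∀ j, wedge Ω n d (y j) = G.x (e j) := by
  have hx : ∀ i : Fin m, ∃ c : Fin m → Ω, ∑ j, c j • wedge Ω n d (y j) = G.x i := by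
    intro i
    rw [← Submodule.mem_span_range_iff_exists_fun, span_wedge_eq hb hsum]
    exact Submodule.subset_span ⟨i, rfl⟩
  choose c hc using hx
  have hli := linearIndependent_wedge hb hsum
  rw [Fintype.linearIndependent_iff] at hli
  have hcol : ∀ j, ∑ i, c i j = 1 := by
    intro j
    have h1 : ∑ j, ((∑ i, c i j) - 1) • wedge Ω n d (y j) = 0 := by
      have h2 : ∀ j, ((∑ i, c i j) - 1) • wedge Ω n d (y j) =
          (∑ i, c i j • wedge Ω n d (y j)) - wedge Ω n d (y j) := fun j => by
        rw [sub_smul, one_smul, Finset.sum_smul]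
      rw [Finset.sum_congr rfl fun j _ => h2 j, Finset.sum_sub_distrib, Finset.sum_comm,
        Finset.sum_congr rfl fun i _ => hc i, hsum, sub_self]
    exact sub_eq_zero.1 (hli (fun j => (∑ i, c i j) - 1) h1 j)
  choose σ hσ using exists_column hb hsum hN fun i => (hc i).symm
  have hone : ∀ i, c i (σ i) = 1 := by
    intro i
    rw [← hcol (σ i), Finset.sum_eq_single i (fun k _ hk => hσ i k hk) (by simp)]
  have hinj : Function.Injective σ := by
    intro i k hik
    by_contra hne
    have h1 := hσ k i hne
    rw [← hik, hone] at h1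
    exact one_ne_zero h1
  have hbij : Function.Bijective σ := Finite.injective_iff_bijective.1 hinj
  have hxy : ∀ i : Fin m, G.x i = wedge Ω n d (y (σ i)) := by
    intro i
    rw [← hc i, Finset.sum_eq_single (σ i)]
    · rw [hone, one_smul]
    · intro j _ hj
      obtain ⟨k, rfl⟩ := hbij.2 j
      rw [hσ k i fun h => hj (by rw [h]), zero_smul]
    · simp
  refine ⟨(Equiv.ofBijective σ hbij).symm, fun j => ?_⟩
  rw [hxy]
  exact congrArg (fun k => wedge Ω n d (y k)) ((Equiv.ofBijective σ hbij).apply_symm_apply j).symm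

end Decomposition
end GenericFrames

end

section

lemma exists_derivation_extension {R S T : Type*} [CommRing R] [CommRing S] [CommRing T]
    [Algebra R S] [Algebra R T] [Algebra S T] [IsScalarTower R S T] [Algebra.FormallyEtale S T]
    (D₀ : Derivation R S T) : ∃ D : Derivation R T T, ∀ s, D (algebraMap S T s) = D₀ s := by
  refine ⟨(D₀.liftKaehlerDifferential.liftBaseChange T ∘ₗ
    (KaehlerDifferential.tensorKaehlerEquivOfFormallyEtale R S T).symm.toLinearMap).compDer
    (KaehlerDifferential.D R T), fun s => ?_⟩
  change D₀.liftKaehlerDifferential.liftBaseChange T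
    ((KaehlerDifferential.tensorKaehlerEquivOfFormallyEtale R S T).symm
      (KaehlerDifferential.D R T (algebraMap S T s))) = _
  rw [KaehlerDifferential.tensorKaehlerEquivOfFormallyEtale_symm_D_algebraMap,
    LinearMap.liftBaseChange_tmul, one_smul, Derivation.liftKaehlerDifferential_comp_D]

/-- The coordinate ring of sequences of `d × n` matrices. -/
abbrev FrameRing (n d : ℕ) : Type := MvPolynomial (ℕ × Fin d × Fin n) ℂ

/-- An algebraic closure of the function field of sequences of `d × n` matrices. -/
abbrev FrameField (n d : ℕ) : Type := AlgebraicClosure (FractionRing (FrameRing n d))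

instance frameField_formallyEtale (n d : ℕ) :
    Algebra.FormallyEtale (FrameRing n d) (FrameField n d) := by
  have : Algebra.FormallyEtale (FrameRing n d) (FractionRing (FrameRing n d)) :=
    Algebra.FormallyEtale.of_isLocalization (nonZeroDivisors (FrameRing n d))
  have : Algebra.FormallyEtale (FractionRing (FrameRing n d)) (FrameField n d) :=
    Algebra.FormallyEtale.of_isSeparable _ _
  exact Algebra.FormallyEtale.comp _ (FractionRing (FrameRing n d)) _

lemma algebraMap_frameField_injective (n d : ℕ) :
    Function.Injective (algebraMap (FrameRing n d) (FrameField n d)) := by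
  rw [IsScalarTower.algebraMap_eq _ (FractionRing (FrameRing n d))]
  exact (algebraMap (FractionRing (FrameRing n d)) (FrameField n d)).injective.comp
    (IsFractionRing.injective _ _)

/-- The frames with independent transcendental coordinates. -/
def genericFrames (n d : ℕ) (h : d ≤ n) : GenericFrames (FrameField n d) n d where
  z i l a := algebraMap (FrameRing n d) _ (MvPolynomial.X (i, l, a))
  exists_derivation V := by
    obtain ⟨D, hD⟩ := exists_derivation_extension
      (MvPolynomial.mkDerivation ℂ (fun p => V p.1 p.2.1 p.2.2) :
        Derivation ℂ (FrameRing n d) (FrameField n d))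
    exact ⟨D, fun i l a => by rw [hD, MvPolynomial.mkDerivation_X]⟩
  exists_equiv τ := by
    let ρ : FrameRing n d ≃+* FrameRing n d :=
      (MvPolynomial.renameEquiv ℂ (τ.prodCongr (Equiv.refl (Fin d × Fin n)))).toRingEquiv
    let ψ : FractionRing (FrameRing n d) ≃+* FractionRing (FrameRing n d) :=
      IsFractionRing.ringEquivOfRingEquiv ρ
    refine ⟨IsAlgClosure.equivOfEquiv _ _ ψ, fun i l a => ?_⟩
    rw [IsScalarTower.algebraMap_apply (FrameRing n d) (FractionRing (FrameRing n d)),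
      IsAlgClosure.equivOfEquiv_algebraMap, IsFractionRing.ringEquivOfRingEquiv_algebraMap,
      ← IsScalarTower.algebraMap_apply]
    congr 1
    simp [ρ]
  ne_zero i hi := by
    have h1 := map_wedge (algebraMap (FrameRing n d) (FrameField n d))
      (fun l a => (MvPolynomial.X (i, l, a) : FrameRing n d))
    rw [hi] at h1
    have h2 : wedge (FrameRing n d) n d (fun l a => MvPolynomial.X (i, l, a))
        (Fin.castLE h) = 0 := by
      apply algebraMap_frameField_injective
      rw [map_zero]
      exact congrFun h1 (Fin.castLE h)
    have h3 := congrFun (map_wedge (MvPolynomial.eval fun p : ℕ × Fin d × Fin n =>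
      if p.2.2 = Fin.castLE h p.2.1 then (1 : ℂ) else 0)
      (fun l a => (MvPolynomial.X (i, l, a) : FrameRing n d))) (Fin.castLE h)
    simp only [h2, map_zero, MvPolynomial.eval_X] at h3
    rw [wedge_apply] at h3
    refine zero_ne_one (h3.trans ?_)
    convert Matrix.det_one (n := Fin d) (R := ℂ)
    ext l k
    simp [Matrix.one_apply, eq_comm]

end

section

/-- A polynomial system over a domain without solutions over an algebraically closed extension of
the fraction field has no solutions over a nonempty open set of parameters. -/
lemma exists_ne_zero_of_no_solution {A K Ω : Type*} [CommRing A] [IsDomain A] [Field K]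
    [Algebra A K] [IsFractionRing A K] [Field Ω] [IsAlgClosed Ω] [Algebra K Ω] [Algebra A Ω]
    [IsScalarTower A K Ω] {σ : Type*} [Finite σ] (s : Set (MvPolynomial σ A))
    (hs : ∀ y : σ → Ω, ∃ p ∈ s, MvPolynomial.eval₂ (algebraMap A Ω) y p ≠ 0) :
    ∃ a : A, a ≠ 0 ∧ ∀ {L : Type} [Field L] (θ : A →+* L), θ a ≠ 0 →
      ∀ y : σ → L, ∃ p ∈ s, MvPolynomial.eval₂ θ y p ≠ 0 := by
  let := MvPolynomial.algebraMvPolynomial (σ := σ) (R := A) (S := K)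
  set I := Ideal.span s
  have htop : I.map (algebraMap (MvPolynomial σ A) (MvPolynomial σ K)) = ⊤ := by
    by_contra hne
    obtain ⟨𝔪, h𝔪, hle⟩ := Ideal.exists_le_maximal _ hne
    let L := MvPolynomial σ K ⧸ 𝔪
    let : Field L := Ideal.Quotient.field 𝔪
    have : Module.Finite K L := finite_of_finite_type_of_isJacobsonRing K L
    let g : L →ₐ[K] Ω := IsAlgClosed.lift
    obtain ⟨p, hp, hp0⟩ := hs fun i => g (Ideal.Quotient.mkₐ K 𝔪 (MvPolynomial.X i))
    apply hp0
    have h1 : (Ideal.Quotient.mkₐ K 𝔪) (MvPolynomial.map (algebraMap A K) p) = 0 :=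
      Ideal.Quotient.eq_zero_iff_mem.2 (hle (Ideal.mem_map_of_mem _ (Ideal.subset_span hp)))
    have h2 : ∀ q : MvPolynomial σ K, MvPolynomial.eval₂ (algebraMap K Ω)
        (fun i => g (Ideal.Quotient.mkₐ K 𝔪 (MvPolynomial.X i))) q =
        g (Ideal.Quotient.mkₐ K 𝔪 q) := by
      intro q
      rw [← MvPolynomial.aeval_def]
      exact (DFunLike.congr_fun
        (MvPolynomial.aeval_unique (g.comp (Ideal.Quotient.mkₐ K 𝔪))) q).symm
    have h3 := h2 (MvPolynomial.map (algebraMap A K) p)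
    rw [h1, map_zero, MvPolynomial.eval₂_map, ← IsScalarTower.algebraMap_eq] at h3
    exact h3
  have hloc : IsLocalization ((nonZeroDivisors A).map (MvPolynomial.C (σ := σ)))
      (MvPolynomial σ K) := MvPolynomial.isLocalization (nonZeroDivisors A) K
  have hdis := (IsLocalization.map_algebraMap_ne_top_iff_disjoint
    ((nonZeroDivisors A).map (MvPolynomial.C (σ := σ))) (MvPolynomial σ K) I).not.1
      (not_not.2 htop)
  obtain ⟨_, ⟨a, ha, rfl⟩, haI⟩ := Set.not_disjoint_iff.1 hdis
  refine ⟨a, nonZeroDivisors.ne_zero ha, fun θ hθ y => ?_⟩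
  by_contra hcon
  push Not at hcon
  have hle : I ≤ RingHom.ker (MvPolynomial.eval₂Hom θ y) := Ideal.span_le.2 hcon
  have := hle haI
  rw [RingHom.mem_ker, MvPolynomial.coe_eval₂Hom] at this
  exact hθ (by simpa using this)

variable {n d : ℕ}

/-- The equation expressing that two sums of decomposable tensors agree in the coordinate `f`. -/
def sumEquation (n d m : ℕ) (f : Fin d → Fin n) :
    MvPolynomial (Option (Fin m × Fin d × Fin n)) (FrameRing n d) :=
  (∑ j, wedge (MvPolynomial (Option (Fin m × Fin d × Fin n)) (FrameRing n d)) n d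
      (fun l a => MvPolynomial.X (some (j, l, a))) f) -
    ∑ i : Fin m, wedge (MvPolynomial (Option (Fin m × Fin d × Fin n)) (FrameRing n d)) n d
      (fun l a => MvPolynomial.C (MvPolynomial.X ((i : ℕ), l, a))) f

/-- The equation expressing that the coordinates selected by `c` witness the failure of every
permutation. -/
def separationEquation (n d m : ℕ) (c : Equiv.Perm (Fin m) → Fin m × (Fin d → Fin n)) :
    MvPolynomial (Option (Fin m × Fin d × Fin n)) (FrameRing n d) :=
  1 - MvPolynomial.X none * ∏ e,
    (wedge (MvPolynomial (Option (Fin m × Fin d × Fin n)) (FrameRing n d)) n d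
      (fun l a => MvPolynomial.X (some ((c e).1, l, a))) (c e).2 -
      wedge (MvPolynomial (Option (Fin m × Fin d × Fin n)) (FrameRing n d)) n d
      (fun l a => MvPolynomial.C (MvPolynomial.X ((e (c e).1 : ℕ), l, a))) (c e).2)

lemma eval₂_wedge {R S σ : Type*} [CommRing R] [CommRing S] (θ : R →+* S) (y : σ → S)
    (v : Fin d → Fin n → MvPolynomial σ R) (f : Fin d → Fin n) :
    MvPolynomial.eval₂ θ y (wedge _ n d v f) =
      wedge S n d (fun l a => MvPolynomial.eval₂ θ y (v l a)) f :=
  congrFun (map_wedge (MvPolynomial.eval₂Hom θ y) v) f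

lemma eval₂_sumEquation {S : Type*} [CommRing S] {m : ℕ} (θ : FrameRing n d →+* S)
    (y : Option (Fin m × Fin d × Fin n) → S) (f : Fin d → Fin n) :
    MvPolynomial.eval₂ θ y (sumEquation n d m f) =
      (∑ j, wedge S n d fun l a => y (some (j, l, a))) f -
      (∑ i : Fin m, wedge S n d fun l a => θ (MvPolynomial.X ((i : ℕ), l, a))) f := by
  simp [sumEquation, MvPolynomial.eval₂_sub, MvPolynomial.eval₂_sum, eval₂_wedge]

lemma eval₂_separationEquation {S : Type*} [CommRing S] {m : ℕ} (θ : FrameRing n d →+* S)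
    (y : Option (Fin m × Fin d × Fin n) → S)
    (c : Equiv.Perm (Fin m) → Fin m × (Fin d → Fin n)) :
    MvPolynomial.eval₂ θ y (separationEquation n d m c) = 1 - y none * ∏ e,
      (wedge S n d (fun l a => y (some ((c e).1, l, a))) (c e).2 -
        wedge S n d (fun l a => θ (MvPolynomial.X ((e (c e).1 : ℕ), l, a))) (c e).2) := by
  simp [separationEquation, MvPolynomial.eval₂_sub, MvPolynomial.eval₂_mul,
    MvPolynomial.eval₂_prod, eval₂_wedge]

/-- Decompositions of a generic sum of decomposable tensors over `ℂ` are unique. -/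
theorem exists_polynomial_unique_decomposition [NeZero d] (hdn : d < n) {m : ℕ}
    (hb : (d * (n - d) + 1) * (m + 1 + (d * (n - d) + 1)) ≤ n.choose d) :
    ∃ q : MvPolynomial (Fin m × Fin d × Fin n) ℂ, q ≠ 0 ∧
      ∀ M : Fin m → Fin d → Fin n → ℂ, MvPolynomial.eval (fun p => M p.1 p.2.1 p.2.2) q ≠ 0 →
      ∀ y : Fin m → Fin d → Fin n → ℂ, ∑ j, wedge ℂ n d (y j) = ∑ i, wedge ℂ n d (M i) →
      ∃ e : Equiv.Perm (Fin m), ∀ j, wedge ℂ n d (y j) = wedge ℂ n d (M (e j)) := by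
  have hN : 0 < d * (n - d) := Nat.mul_pos (NeZero.pos d) (by omega)
  have key : ∀ c : Equiv.Perm (Fin m) → Fin m × (Fin d → Fin n), ∃ a : FrameRing n d, a ≠ 0 ∧
      ∀ {L : Type} [Field L] (θ : FrameRing n d →+* L), θ a ≠ 0 → ∀ y : _ → L,
      ∃ p ∈ insert (separationEquation n d m c) (Set.range (sumEquation n d m)),
        MvPolynomial.eval₂ θ y p ≠ 0 := by
    intro c
    refine exists_ne_zero_of_no_solution (K := FractionRing (FrameRing n d))
      (Ω := FrameField n d) _ fun y => ?_
    by_contra hcon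
    push Not at hcon
    have hsum : ∑ j, wedge (FrameField n d) n d (fun l a => y (some (j, l, a))) =
        ∑ i : Fin m, (genericFrames n d hdn.le).x i := by
      funext f
      have := hcon _ (Set.mem_insert_of_mem _ ⟨f, rfl⟩)
      rw [eval₂_sumEquation] at this
      exact sub_eq_zero.1 this
    obtain ⟨e, he⟩ := GenericFrames.unique_decomposition hb hsum hN
    have := hcon _ (Set.mem_insert _ _)
    rw [eval₂_separationEquation, Finset.prod_eq_zero (Finset.mem_univ e), mul_zero,
      sub_zero] at this
    · exact one_ne_zero this
    · exact sub_eq_zero.2 (congrFun (he (c e).1) (c e).2)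
  choose a ha0 ha using key
  have hprod : ∏ c, a c ≠ 0 := Finset.prod_ne_zero_iff.2 fun c _ => ha0 c
  obtain ⟨M₀, hM₀⟩ : ∃ M₀ : ℕ × Fin d × Fin n → ℂ, MvPolynomial.eval M₀ (∏ c, a c) ≠ 0 := by
    by_contra hcon
    push Not at hcon
    exact hprod (MvPolynomial.funext fun M => by rw [hcon, map_zero])
  let q : MvPolynomial (Fin m × Fin d × Fin n) ℂ := MvPolynomial.aeval (fun p : ℕ × Fin d × Fin n =>
    if h : p.1 < m then MvPolynomial.X (⟨p.1, h⟩, p.2.1, p.2.2) else MvPolynomial.C (M₀ p))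
    (∏ c, a c)
  have hq : ∀ M : Fin m × Fin d × Fin n → ℂ, MvPolynomial.eval M q =
      MvPolynomial.eval (fun p : ℕ × Fin d × Fin n =>
        if h : p.1 < m then M (⟨p.1, h⟩, p.2.1, p.2.2) else M₀ p) (∏ c, a c) := by
    intro M
    change MvPolynomial.eval M (MvPolynomial.aeval _ _) = _
    rw [MvPolynomial.aeval_def, ← MvPolynomial.coe_eval₂Hom, ← RingHom.comp_apply,
      MvPolynomial.eval, MvPolynomial.eval]
    congr 1
    ext p
    · simp
    · simp only [RingHom.comp_apply, MvPolynomial.coe_eval₂Hom, MvPolynomial.eval₂_X]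
      split_ifs <;> simp
  refine ⟨q, fun h0 => hM₀ ?_, fun M hM y hy => ?_⟩
  · have := hq fun p => M₀ (p.1, p.2.1, p.2.2)
    rw [h0, map_zero] at this
    rw [this]
    congr 2
    funext p
    split_ifs <;> rfl
  · by_contra hcon
    push Not at hcon
    have hex : ∀ e : Equiv.Perm (Fin m), ∃ c : Fin m × (Fin d → Fin n),
        wedge ℂ n d (y c.1) c.2 - wedge ℂ n d (M (e c.1)) c.2 ≠ 0 := by
      intro e
      obtain ⟨j, hj⟩ := hcon e
      obtain ⟨f, hf⟩ := Function.ne_iff.1 hj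
      exact ⟨(j, f), sub_ne_zero.2 hf⟩
    choose c hc using hex
    rw [hq, map_prod] at hM
    set M' : ℕ × Fin d × Fin n → ℂ := fun p =>
      if h : p.1 < m then M ⟨p.1, h⟩ p.2.1 p.2.2 else M₀ p with hM'
    have hM'M : ∀ (i : Fin m) l a, M' ((i : ℕ), l, a) = M i l a := fun i l a => by simp [hM']
    have hne := Finset.prod_ne_zero_iff.1 hM c (Finset.mem_univ c)
    obtain ⟨p, hp, hp0⟩ := ha c (MvPolynomial.eval M') hne fun o => o.elim
      (∏ e, (wedge ℂ n d (y (c e).1) (c e).2 - wedge ℂ n d (M (e (c e).1)) (c e).2))⁻¹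
      fun p => y p.1 p.2.1 p.2.2
    apply hp0
    rcases hp with rfl | ⟨f, rfl⟩
    · rw [eval₂_separationEquation]
      simp only [Option.elim, MvPolynomial.eval_X, hM'M]
      rw [inv_mul_cancel₀ (Finset.prod_ne_zero_iff.2 fun e _ => hc e), sub_self]
    · rw [eval₂_sumEquation]
      simp only [Option.elim, MvPolynomial.eval_X, hM'M]
      exact sub_eq_zero.2 (congrFun hy f)

end

section

lemma isTopologicalBasis_zt (ι : Type*) : @TopologicalSpace.IsTopologicalBasis _ (zt ι)
    { U | ∃ f : MvPolynomial ι ℂ, U = { x | MvPolynomial.eval x f ≠ 0 } } := by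
  let := zt ι
  have h := TopologicalSpace.isTopologicalBasis_of_subbasis_of_inter (t := zt ι) rfl (by
    rintro _ ⟨f, rfl⟩ _ ⟨g, rfl⟩
    exact ⟨f * g, by ext; simp⟩)
  have huniv : Set.univ ∈ { U | ∃ f : MvPolynomial ι ℂ, U = { x | MvPolynomial.eval x f ≠ 0 } } :=
    ⟨1, by simp⟩
  rwa [Set.insert_eq_of_mem huniv] at h

lemma mem_zClosure_iff {ι : Type*} {S : Set (ι → ℂ)} {x : ι → ℂ} :
    x ∈ zClosure S ↔
      ∀ f : MvPolynomial ι ℂ, (∀ s ∈ S, MvPolynomial.eval s f = 0) → MvPolynomial.eval x f = 0 := by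
  let := zt ι
  refine (isTopologicalBasis_zt ι).mem_closure_iff.trans ?_
  constructor
  · intro h f hf
    by_contra hx
    obtain ⟨s, hs, hsS⟩ := h _ ⟨f, rfl⟩ hx
    exact hs (hf s hsS)
  · rintro h _ ⟨f, rfl⟩ hx
    by_contra hne
    exact hx (h f fun s hs => by_contra fun hs0 => hne ⟨s, hs0, hs⟩)

lemma subset_zClosure {ι : Type*} (S : Set (ι → ℂ)) : S ⊆ zClosure S :=
  @subset_closure _ (zt ι) S

/-- The image of a nonempty basic open set under a polynomial map contains a nonempty basic open
set of the closure of the image. -/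
lemma exists_basicOpen_subset_image {σ τ : Type*} [Finite σ] [Finite τ]
    (F : τ → MvPolynomial σ ℂ) {q : MvPolynomial σ ℂ} (hq : q ≠ 0) :
    ∃ b : MvPolynomial τ ℂ, MvPolynomial.aeval F b ≠ 0 ∧ ∀ p : τ → ℂ,
      (∀ r, MvPolynomial.aeval F r = 0 → MvPolynomial.eval p r = 0) → MvPolynomial.eval p b ≠ 0 →
      ∃ x, MvPolynomial.eval x q ≠ 0 ∧ ∀ t, MvPolynomial.eval x (F t) = p t := by
  let φ : MvPolynomial τ ℂ →ₐ[ℂ] MvPolynomial σ ℂ := MvPolynomial.aeval F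
  have hφ : φ.toRingHom.FinitePresentation := by
    have : φ.toRingHom.FiniteType := by
      have h : (φ.toRingHom.comp (algebraMap ℂ (MvPolynomial τ ℂ))).FiniteType := by
        have e : φ.toRingHom.comp (algebraMap ℂ (MvPolynomial τ ℂ)) =
          algebraMap ℂ (MvPolynomial σ ℂ) := φ.comp_algebraMap
        rw [e, RingHom.finiteType_algebraMap]
        infer_instance
      exact RingHom.FiniteType.of_comp_finiteType h
    exact RingHom.FinitePresentation.of_finiteType.1 this
  have hc := PrimeSpectrum.isConstructible_comap_image hφ
    (s := (PrimeSpectrum.basicOpen q : Set (PrimeSpectrum (MvPolynomial σ ℂ))))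
    PrimeSpectrum.isConstructible_basicOpen
  obtain ⟨C, hC⟩ := PrimeSpectrum.exists_constructibleSetData_iff.2 hc
  let z : PrimeSpectrum (MvPolynomial σ ℂ) := ⟨⊥, Ideal.isPrime_bot⟩
  have hz : PrimeSpectrum.comap φ.toRingHom z ∈ C.toSet := by
    rw [hC]
    exact ⟨z, hq, rfl⟩
  simp only [PrimeSpectrum.ConstructibleSetData.toSet, Set.mem_iUnion] at hz
  obtain ⟨B, hB, hzg, hzf⟩ := hz
  refine ⟨B.f, fun h => hzf ?_, fun p hp hpB => ?_⟩
  · rw [PrimeSpectrum.mem_zeroLocus, Set.singleton_subset_iff]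
    exact h
  · let P : PrimeSpectrum (MvPolynomial τ ℂ) := MvPolynomial.pointToPoint p
    have hP : ∀ r, r ∈ P.asIdeal ↔ MvPolynomial.eval p r = 0 := fun r => by
      simp [P, MvPolynomial.pointToPoint, MvPolynomial.aeval_eq_eval]
    have hPC : P ∈ C.toSet := by
      simp only [PrimeSpectrum.ConstructibleSetData.toSet, Set.mem_iUnion]
      refine ⟨B, hB, ?_, fun h => hpB ?_⟩
      · rintro _ ⟨i, rfl⟩
        exact (hP _).2 (hp _ (hzg ⟨i, rfl⟩))
      · exact (hP _).1 (h rfl)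
    rw [hC] at hPC
    obtain ⟨Q, hQ, hQP⟩ := hPC
    have hvan := MvPolynomial.IsPrime.vanishingIdeal_zeroLocus (K := ℂ) Q.asIdeal
    have hqv : q ∉ MvPolynomial.vanishingIdeal ℂ (MvPolynomial.zeroLocus ℂ Q.asIdeal) := by
      rw [hvan]
      exact hQ
    rw [MvPolynomial.mem_vanishingIdeal_iff] at hqv
    push Not at hqv
    obtain ⟨x, hx, hxq⟩ := hqv
    refine ⟨x, by simpa [MvPolynomial.aeval_eq_eval] using hxq, fun t => ?_⟩
    have hmem : MvPolynomial.X t - MvPolynomial.C (p t) ∈ P.asIdeal := (hP _).2 (by simp)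
    rw [← hQP] at hmem
    have := hx _ (show φ _ ∈ Q.asIdeal from hmem)
    simpa [φ, MvPolynomial.aeval_eq_eval, sub_eq_zero] using this

end

section

instance (n d : ℕ) : Fintype (Lam n d) :=
  inferInstanceAs (Fintype { S : Finset (Fin n) // S.card = d })

variable {n d : ℕ}

/-- The increasing enumeration of a `d`-element subset. -/
def Lam.enum (S : Lam n d) (i : Fin d) : Fin n := S.1.orderIsoOfFin S.2 i

lemma plucker_eq_wedge (v : Fin d → Fin n → ℂ) (S : Lam n d) :
    plucker (Matrix.of v).transpose S = wedge ℂ n d v S.enum := by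
  rw [wedge_apply, plucker, ← Matrix.det_transpose]
  rfl

lemma exists_enum_eq_comp {f : Fin d → Fin n} (hf : Function.Injective f) :
    ∃ (S : Lam n d) (e : Equiv.Perm (Fin d)), f = S.enum ∘ e := by
  let S : Lam n d := ⟨Finset.univ.image f, by
    rw [Finset.card_image_of_injective _ hf, Finset.card_univ, Fintype.card_fin]⟩
  have hmem : ∀ i, f i ∈ S.1 := fun i => Finset.mem_image_of_mem f (Finset.mem_univ i)
  let e : Fin d → Fin d := fun i => (S.1.orderIsoOfFin S.2).symm ⟨f i, hmem i⟩
  have he : Function.Injective e := fun i j h =>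
    hf (congrArg Subtype.val ((S.1.orderIsoOfFin S.2).symm.injective h))
  refine ⟨S, Equiv.ofBijective e (Finite.injective_iff_bijective.1 he), funext fun i => ?_⟩
  change f i = ((S.1.orderIsoOfFin S.2) ((S.1.orderIsoOfFin S.2).symm ⟨f i, hmem i⟩) : Fin n)
  rw [OrderIso.apply_symm_apply]

lemma wedge_comp_perm {R : Type*} [CommRing R] (v : Fin d → Fin n → R) (f : Fin d → Fin n)
    (e : Equiv.Perm (Fin d)) :
    wedge R n d v (f ∘ e) = ((Equiv.Perm.sign e : ℤ) : R) * wedge R n d v f := by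
  rw [wedge_apply, wedge_apply, ← Matrix.det_permute']
  rfl

lemma exists_wedge_eq_sum_plucker (n d : ℕ) : ∃ c : (Fin d → Fin n) → Lam n d → ℂ,
    ∀ (v : Fin d → Fin n → ℂ) (f : Fin d → Fin n),
      wedge ℂ n d v f = ∑ S, c f S * plucker (Matrix.of v).transpose S := by
  have key : ∀ f : Fin d → Fin n, ∃ c : Lam n d → ℂ, ∀ v : Fin d → Fin n → ℂ,
      wedge ℂ n d v f = ∑ S, c S * plucker (Matrix.of v).transpose S := by
    classical
    intro f
    by_cases hf : Function.Injective f
    · obtain ⟨S, e, rfl⟩ := exists_enum_eq_comp hf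
      refine ⟨Pi.single S ((Equiv.Perm.sign e : ℤ) : ℂ), fun v => ?_⟩
      rw [wedge_comp_perm, Finset.sum_eq_single S (fun T _ hT => by simp [hT]) (by simp),
        Pi.single_eq_same, plucker_eq_wedge]
    · refine ⟨0, fun v => ?_⟩
      simp only [Function.Injective, not_forall] at hf
      obtain ⟨i, j, hij, hne⟩ := hf
      rw [wedge_apply, Matrix.det_zero_of_column_eq hne fun l => by simp [hij]]
      simp
  choose c hc using key
  exact ⟨c, fun v f => hc f v⟩

lemma wedge_sum_mul {R : Type*} [CommRing R] (B : Matrix (Fin d) (Fin d) R)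
    (v : Fin d → Fin n → R) (f : Fin d → Fin n) :
    wedge R n d (fun l a => ∑ k, B l k * v k a) f = B.det * wedge R n d v f := by
  rw [wedge_apply, wedge_apply, ← Matrix.det_mul]
  rfl

lemma wedge_update_eq_sum_adjugate_mul {R : Type*} [CommRing R] (v : Fin d → Fin n → R)
    (f : Fin d → Fin n) (l : Fin d) (a : Fin n) :
    wedge R n d v (Function.update f l a) =
      ∑ k, (Matrix.of fun l k => v l (f k)).adjugate l k * v k a := by
  have h := congrFun (Matrix.cramer_eq_adjugate_mulVec (Matrix.of fun l k => v l (f k))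
    fun i => v i a) l
  rw [Matrix.cramer_apply] at h
  rw [wedge_apply]
  refine Eq.trans (congrArg Matrix.det ?_) h
  ext i k
  by_cases hk : k = l
  · subst hk; simp
  · simp [hk]

/-- The cone over the Grassmannian consists of vectors of maximal minors. -/
lemma mem_grassCone_iff [NeZero d] {p : Lam n d → ℂ} :
    p ∈ GrassCone n d ↔ ∃ v : Fin d → Fin n → ℂ, p = plucker (Matrix.of v).transpose := by
  constructor
  swap
  · rintro ⟨v, rfl⟩
    exact subset_zClosure _ ⟨_, rfl⟩
  intro hp
  by_cases hp0 : p = 0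
  · refine ⟨0, funext fun S => ?_⟩
    rw [hp0, plucker_eq_wedge]
    exact (congrFun ((wedge ℂ n d).map_coord_zero (m := 0) (0 : Fin d) rfl) S.enum).symm
  obtain ⟨S₀, hS₀⟩ := Function.ne_iff.1 hp0
  obtain ⟨c, hc⟩ := exists_wedge_eq_sum_plucker n d
  let C : (Lam n d → ℂ) → Fin d → Fin n → ℂ := fun p l a =>
    ∑ T, c (Function.update S₀.enum l a) T * p T
  have hC : ∀ S, wedge ℂ n d (C p) S.enum = p S₀ ^ (d - 1) * p S := by
    intro S
    have h := mem_zClosure_iff.1 hp (wedge (MvPolynomial (Lam n d) ℂ) n d (fun l a =>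
      ∑ T, MvPolynomial.C (c (Function.update S₀.enum l a) T) * MvPolynomial.X T) S.enum -
      MvPolynomial.X S₀ ^ (d - 1) * MvPolynomial.X S)
    have hev : ∀ p, MvPolynomial.eval p (wedge (MvPolynomial (Lam n d) ℂ) n d (fun l a =>
      ∑ T, MvPolynomial.C (c (Function.update S₀.enum l a) T) * MvPolynomial.X T) S.enum -
      MvPolynomial.X S₀ ^ (d - 1) * MvPolynomial.X S) =
      wedge ℂ n d (C p) S.enum - p S₀ ^ (d - 1) * p S := by
      intro p
      have := congrFun (map_wedge (MvPolynomial.eval p) (fun l a =>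
        ∑ T, MvPolynomial.C (c (Function.update S₀.enum l a) T) * MvPolynomial.X T)) S.enum
      rw [map_sub, this]
      simp [C]
    simp only [hev] at h
    refine sub_eq_zero.1 (h ?_)
    rintro _ ⟨M, rfl⟩
    obtain ⟨v, rfl⟩ : ∃ v, M = (Matrix.of v).transpose := ⟨M.transpose, rfl⟩
    have hCv : C (plucker (Matrix.of v).transpose) = fun l a =>
        ∑ k, (Matrix.of fun l k => v l (S₀.enum k)).adjugate l k * v k a := by
      funext l a
      rw [← wedge_update_eq_sum_adjugate_mul, hc]
    rw [hCv, wedge_sum_mul, Matrix.det_adjugate, Fintype.card_fin, plucker_eq_wedge,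
      plucker_eq_wedge, wedge_apply (R := ℂ) _ S₀.enum, sub_self]
  refine ⟨Function.update (C p) 0 ((p S₀ ^ (d - 1))⁻¹ • C p 0), funext fun S => ?_⟩
  rw [plucker_eq_wedge]
  have hpow : p S₀ ^ (d - 1) ≠ 0 := pow_ne_zero _ hS₀
  have := congrFun ((wedge ℂ n d).map_update_smul (C p) 0 (p S₀ ^ (d - 1))⁻¹ (C p 0)) S.enum
  refine Eq.trans ?_ this.symm
  rw [Function.update_eq_self, Pi.smul_apply, hC, smul_eq_mul, inv_mul_cancel_left₀ hpow]

end

section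

variable {n d : ℕ}

lemma sum_wedge_eq_of_sum_plucker_eq {ι : Type*} [Fintype ι] {v w : ι → Fin d → Fin n → ℂ}
    (h : ∑ i, plucker (Matrix.of (v i)).transpose = ∑ i, plucker (Matrix.of (w i)).transpose) :
    ∑ i, wedge ℂ n d (v i) = ∑ i, wedge ℂ n d (w i) := by
  obtain ⟨c, hc⟩ := exists_wedge_eq_sum_plucker n d
  have key : ∀ (v : ι → Fin d → Fin n → ℂ) (f : Fin d → Fin n),
      (∑ i, wedge ℂ n d (v i)) f =
        ∑ S, c f S * (∑ i, plucker (Matrix.of (v i)).transpose) S := by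
    intro v f
    simp only [Finset.sum_apply, hc, Finset.mul_sum]
    exact Finset.sum_comm
  funext f
  rw [key, h, key]

/-- The generic sum of `m` vectors of maximal minors. -/
def genericSum (n d m : ℕ) (S : Lam n d) : MvPolynomial (Fin m × Fin d × Fin n) ℂ :=
  ∑ i, wedge (MvPolynomial (Fin m × Fin d × Fin n) ℂ) n d (fun l a => MvPolynomial.X (i, l, a))
    S.enum

lemma eval_genericSum {m : ℕ} (x : Fin m × Fin d × Fin n → ℂ) (S : Lam n d) :
    MvPolynomial.eval x (genericSum n d m S) =
      (∑ i, plucker (Matrix.of fun l a => x (i, l, a)).transpose) S := by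
  rw [genericSum, map_sum, Finset.sum_apply]
  refine Finset.sum_congr rfl fun i _ => ?_
  rw [plucker_eq_wedge]
  refine (congrFun (map_wedge (MvPolynomial.eval x) fun l a => MvPolynomial.X (i, l, a)) _).trans ?_
  simp

lemma eval_aeval_genericSum {m : ℕ} (x : Fin m × Fin d × Fin n → ℂ)
    (r : MvPolynomial (Lam n d) ℂ) :
    MvPolynomial.eval x (MvPolynomial.aeval (genericSum n d m) r) =
      MvPolynomial.eval (∑ i, plucker (Matrix.of fun l a => x (i, l, a)).transpose) r := by
  rw [← funext (eval_genericSum x)]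
  induction r using MvPolynomial.induction_on with
  | C a => simp
  | add p q hp hq => rw [map_add, map_add, map_add, hp, hq]
  | mul_X p i hp => rw [map_mul, map_mul, map_mul, hp, MvPolynomial.aeval_X, MvPolynomial.eval_X]

end

theorem stmt_10 (n d : ℕ) (hd : 1 ≤ d) (hdn : d ≤ n)
    (N : ℕ) (hN : N = d * (n - d) + 1)
    (m : ℕ) (hm : 1 ≤ m)
    (hbound : N * (m + 1 + N) ≤ Nat.choose n d) :
    IsIdentifiable m (GrassCone n d) := by
  subst hN
  have : NeZero d := ⟨by omega⟩
  have hlt : d < n := by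
    refine lt_of_le_of_ne hdn fun h => ?_
    subst h
    simp at hbound
  obtain ⟨q, hq0, hq⟩ := exists_polynomial_unique_decomposition hlt hbound
  obtain ⟨b, hb0, hb⟩ := exists_basicOpen_subset_image (genericSum n d m) hq0
  have hzero : ∀ r : MvPolynomial (Lam n d) ℂ, MvPolynomial.aeval (genericSum n d m) r = 0 →
      ∀ p ∈ secant m (GrassCone n d), MvPolynomial.eval p r = 0 := by
    intro r hr p hp
    refine mem_zClosure_iff.1 hp r ?_
    rintro _ ⟨x, hx, rfl⟩
    choose v hv using fun i => mem_grassCone_iff.1 (hx i)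
    have h := eval_aeval_genericSum (fun t => v t.1 t.2.1 t.2.2) r
    rw [hr, map_zero] at h
    rw [funext hv]
    exact h.symm
  refine ⟨{p | MvPolynomial.eval p b ≠ 0} ∩ secant m (GrassCone n d), Set.inter_subset_right,
    ⟨_, TopologicalSpace.isOpen_generateFrom_of_mem ⟨b, rfl⟩, rfl⟩, fun p hp => ?_, ?_⟩
  · refine mem_zClosure_iff.2 fun r hr => hzero r ?_ p hp
    suffices h : MvPolynomial.aeval (genericSum n d m) r *
        MvPolynomial.aeval (genericSum n d m) b = 0 from (mul_eq_zero.1 h).resolve_right hb0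
    refine MvPolynomial.funext fun x => ?_
    rw [← map_mul, eval_aeval_genericSum, map_mul, map_zero, mul_eq_zero, or_iff_not_imp_right]
    exact fun hx => hr _ ⟨hx, subset_zClosure _
      ⟨_, fun i => mem_grassCone_iff.2 ⟨fun l a => x (i, l, a), rfl⟩, rfl⟩⟩
  · rintro p ⟨hpb, hp⟩
    obtain ⟨x, hxq, hxp⟩ := hb p (fun r hr => hzero r hr p hp) hpb
    have hpx : p = ∑ i, plucker (Matrix.of fun l a => x (i, l, a)).transpose :=
      funext fun S => by rw [← hxp, eval_genericSum]
    refine ⟨⟨_, fun i => mem_grassCone_iff.2 ⟨fun l a => x (i, l, a), rfl⟩, hpx⟩, ?_⟩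
    have key : ∀ y : Fin m → Lam n d → ℂ, (∀ i, y i ∈ GrassCone n d) → p = ∑ i, y i →
        ∃ e : Equiv.Perm (Fin m), ∀ j,
          y j = plucker (Matrix.of fun l a => x (e j, l, a)).transpose := by
      intro y hy hpy
      choose v hv using fun i => mem_grassCone_iff.1 (hy i)
      obtain rfl : y = _ := funext hv
      obtain ⟨e, he⟩ := hq (fun i l a => x (i, l, a)) hxq v
        (sum_wedge_eq_of_sum_plucker_eq (hpy.symm.trans hpx))
      exact ⟨e, fun j => funext fun S => by rw [hv, plucker_eq_wedge, plucker_eq_wedge, he]⟩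
    intro y z hy hz hpy hpz
    obtain ⟨e, he⟩ := key y hy hpy
    obtain ⟨e', he'⟩ := key z hz hpz
    exact ⟨e'.trans e.symm, fun i => by rw [he', he]; simp⟩
end
end

section
/- (Nondefectivity and generic rank for Chow varieties.) Let n ≥ 1, d ≥ 1, let Chow_{d,n} ⊆ S^d_n be the Zariski closure of the set of products ℓ₁ * ℓ₂ * ⋯ * ℓ_d of d homogeneous linear forms ℓᵢ ∈ S^1_n, and set N := d*(n−1)+1. Then dim Chow_{d,n} = N; for every m ≥ 1 with N * (m + N) ≤ choose (n+d−1) d, the m-th secant variety σ_m Chow_{d,n} has dimension exactly m * N; and for every m ≥ 1 with m * N ≥ choose (n+d−1) d + N^2, σ_m Chow_{d,n} equals all of S^d_n. -/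
noncomputable section

open MvPolynomial

/-- The Zariski topology on a `ℂ`-vector space `M` (for finite-dimensional `M`,
identified with a coordinate space via a basis, this is the topology in which a set
is closed iff it is the common zero locus of a family of polynomial functions
of the coordinates). -/
def ztV (M : Type*) [AddCommGroup M] [Module ℂ M] : TopologicalSpace M :=
  TopologicalSpace.generateFrom
    { U | ∃ (k : ℕ) (p : MvPolynomial (Fin k) ℂ) (L : Fin k → M →ₗ[ℂ] ℂ),
        U = { x | MvPolynomial.eval (fun i => L i x) p ≠ 0 } }

def zIsOpenV {M : Type*} [AddCommGroup M] [Module ℂ M] (S : Set M) : Prop :=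
  @IsOpen _ (ztV M) S

def zClosureV {M : Type*} [AddCommGroup M] [Module ℂ M] (S : Set M) : Set M :=
  @closure _ (ztV M) S

/-- The topological Krull dimension of `S` (with the subspace Zariski topology):
the supremum of lengths of chains of irreducible closed subsets. -/
def zDimV {M : Type*} [AddCommGroup M] [Module ℂ M] (S : Set M) : WithBot ℕ∞ :=
  @topologicalKrullDim ↥S (TopologicalSpace.induced Subtype.val (ztV M))

/-- The `m`-th secant variety: the Zariski closure of the set of sums of `m` points of `V`. -/
def secantV {M : Type*} [AddCommGroup M] [Module ℂ M] (m : ℕ) (V : Set M) : Set M :=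
  zClosureV { p | ∃ x : Fin m → M, (∀ i, x i ∈ V) ∧ p = ∑ i, x i }

/-- `V` is `m`-identifiable: there is a dense open subset `O` of `σ_m V` such that every
`p ∈ O` is a sum of `m` points of `V`, uniquely up to a permutation of the summands. -/
def IsIdentifiableV {M : Type*} [AddCommGroup M] [Module ℂ M] (m : ℕ) (V : Set M) : Prop :=
  ∃ O : Set M, O ⊆ secantV m V ∧
    (∃ U, zIsOpenV U ∧ O = U ∩ secantV m V) ∧
    secantV m V ⊆ zClosureV O ∧
    ∀ p ∈ O,
      (∃ x : Fin m → M, (∀ i, x i ∈ V) ∧ p = ∑ i, x i) ∧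
      ∀ x y : Fin m → M, (∀ i, x i ∈ V) → (∀ i, y i ∈ V) →
        p = ∑ i, x i → p = ∑ i, y i →
          ∃ e : Equiv.Perm (Fin m), ∀ i, y i = x (e i)

/-- The Chow variety: the Zariski closure in `S^d_n` of the set of products of `d`
homogeneous linear forms. -/
def ChowVariety (n d : ℕ) : Set ↥(homogeneousSubmodule (Fin n) ℂ d) :=
  zClosureV { f | ∃ ℓ : Fin d → MvPolynomial (Fin n) ℂ,
    (∀ i, ℓ i ∈ homogeneousSubmodule (Fin n) ℂ 1) ∧
    (f : MvPolynomial (Fin n) ℂ) = ∏ i, ℓ i }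


section CommutativeAlgebra

theorem ringKrullDim_eq_of_isIntegral_of_injective {R S : Type*} [CommRing R] [CommRing S]
    [Algebra R S] [Algebra.IsIntegral R S] (hinj : Function.Injective (algebraMap R S)) :
    ringKrullDim S = ringKrullDim R := by
  apply le_antisymm
  · refine Order.krullDim_le_of_strictMono (PrimeSpectrum.comap (algebraMap R S)) ?_
    intro I J hIJ
    exact Ideal.IsIntegral.comap_lt_comap (R := R) (I := I.asIdeal) (J := J.asIdeal) hIJ
  · refine iSup_le fun l => ?_
    obtain ⟨Q, -, hQ, hQl⟩ := Ideal.exists_ideal_over_prime_of_isIntegral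
      (S := S) l.head.asIdeal (⊥ : Ideal S) (by
        rw [Ideal.comap_bot_of_injective _ hinj]; exact bot_le)
    have : Q.LiesOver (RelSeries.head l).asIdeal := ⟨hQl.symm⟩
    obtain ⟨L, hL, -⟩ := Ideal.exists_ltSeries_of_hasGoingUp (S := S) l Q
    rw [← hL]
    exact Order.LTSeries.length_le_krullDim L

/-- The Krull dimension of a finitely generated domain over a field is its transcendence degree. -/
theorem ringKrullDim_eq_trdeg (k A : Type*) [Field k] [CommRing A] [IsDomain A] [Algebra k A]
    [Algebra.FiniteType k A] :
    ∃ s : ℕ, ringKrullDim A = s ∧ Algebra.trdeg k A = s := by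
  obtain ⟨s, g, hg, hgi⟩ := exists_integral_inj_algHom_of_fg k A
  refine ⟨s, ?_, ?_⟩
  · let _ := g.toRingHom.toAlgebra
    have : Algebra.IsIntegral (MvPolynomial (Fin s) k) A := ⟨hgi⟩
    rw [ringKrullDim_eq_of_isIntegral_of_injective (R := MvPolynomial (Fin s) k) (S := A) hg]
    simp
  · have hind : AlgebraicIndependent k (fun i => g (X i)) := by
      have : (aeval fun i => g (X i)) = g := by ext; simp
      rw [AlgebraicIndependent, this]
      exact hg
    have hr : Algebra.adjoin k (Set.range fun i => g (X i)) = g.range := by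
      rw [Algebra.adjoin_range_eq_range_aeval]
      congr 1
      ext; simp
    have halg : Algebra.IsAlgebraic (Algebra.adjoin k (Set.range fun i => g (X i))) A := by
      rw [hr]
      refine ⟨fun a => ?_⟩
      refine IsIntegral.isAlgebraic ?_
      obtain ⟨p, hp, hpa⟩ := hgi a
      refine ⟨p.map g.rangeRestrict.toRingHom, hp.map _, ?_⟩
      rw [Polynomial.eval₂_map]
      exact hpa
    have hb := hind.isTranscendenceBasis_iff_isAlgebraic.2 halg
    simpa using hb.lift_cardinalMk_eq_trdeg.symm

end CommutativeAlgebra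

section Topology

open Topology

theorem Topology.IsInducing.isPreirreducible_preimage {X Y : Type*} [TopologicalSpace X]
    [TopologicalSpace Y] {j : X → Y} (hj : IsInducing j) {C : Set Y}
    (hC : IsPreirreducible (C ∩ Set.range j)) : IsPreirreducible (j ⁻¹' C) := by
  intro u v hu hv ⟨x, hx, hxu⟩ ⟨y, hy, hyv⟩
  obtain ⟨u', hu', rfl⟩ := hj.isOpen_iff.1 hu
  obtain ⟨v', hv', rfl⟩ := hj.isOpen_iff.1 hv
  obtain ⟨_, ⟨hz, z, rfl⟩, hzu, hzv⟩ := hC u' v' hu' hv' ⟨j x, ⟨hx, x, rfl⟩, hxu⟩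
    ⟨j y, ⟨hy, y, rfl⟩, hyv⟩
  exact ⟨z, hz, hzu, hzv⟩

/-- An inducing map whose range is very dense preserves the Krull dimension. -/
theorem Topology.IsInducing.topologicalKrullDim_eq {X Y : Type*} [TopologicalSpace X]
    [TopologicalSpace Y] {j : X → Y} (hj : IsInducing j)
    (hd : ∀ C : Set Y, IsClosed C → C ⊆ closure (C ∩ Set.range j)) :
    topologicalKrullDim X = topologicalKrullDim Y := by
  refine le_antisymm hj.topologicalKrullDim_le ?_
  have hpre : ∀ C : TopologicalSpace.IrreducibleCloseds Y, IsIrreducible (j ⁻¹' (C : Set Y)) := by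
    intro C
    have hcl : closure ((C : Set Y) ∩ Set.range j) = C :=
      (closure_minimal Set.inter_subset_left C.isClosed).antisymm (hd C C.isClosed)
    refine ⟨?_, hj.isPreirreducible_preimage ?_⟩
    · have : ((C : Set Y) ∩ Set.range j).Nonempty := by
        rw [← closure_nonempty_iff, hcl]; exact C.isIrreducible.nonempty
      obtain ⟨_, hy, x, rfl⟩ := this
      exact ⟨x, hy⟩
    · rw [← isPreirreducible_iff_closure, hcl]
      exact C.isIrreducible.isPreirreducible
  refine Order.krullDim_le_of_strictMono
    (fun C => ⟨j ⁻¹' (C : Set Y), hpre C, C.isClosed.preimage hj.continuous⟩) ?_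
  refine Monotone.strictMono_of_injective (fun C D h x hx => h hx) ?_
  intro C D h
  have h' : j ⁻¹' (C : Set Y) = j ⁻¹' (D : Set Y) := congrArg (fun K => K.carrier) h
  have key : ∀ C : TopologicalSpace.IrreducibleCloseds Y,
      (C : Set Y) = closure (j '' (j ⁻¹' (C : Set Y))) := fun C => by
    rw [Set.image_preimage_eq_inter_range]
    exact (hd C C.isClosed).antisymm (closure_minimal Set.inter_subset_left C.isClosed)
  apply SetLike.coe_injective
  rw [key C, key D, h']

end Topology

section Zariski

open Module Topology

variable {E : Type*} [AddCommGroup E] [Module ℂ E] {σ : Type*} (b : Basis σ ℂ E)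

/-- The point of the prime spectrum of the coordinate ring given by a vector. -/
def specPoint (x : E) : PrimeSpectrum (MvPolynomial σ ℂ) :=
  pointToPoint (fun i => b.repr x i)

theorem mem_asIdeal_specPoint {x : E} {h : MvPolynomial σ ℂ} :
    h ∈ (specPoint b x).asIdeal ↔ eval (fun i => b.repr x i) h = 0 := by
  simp [specPoint, pointToPoint, aeval_eq_eval]

theorem ztV_eq_induced [Finite σ] :
    ztV E = TopologicalSpace.induced (specPoint b) inferInstance := by
  rw [PrimeSpectrum.isTopologicalBasis_basic_opens.eq_generateFrom, induced_generateFrom_eq, ztV]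
  congr 1
  have hpre : ∀ h : MvPolynomial σ ℂ, specPoint b ⁻¹' (PrimeSpectrum.basicOpen h) =
      {x | eval (fun i => b.repr x i) h ≠ 0} := by
    intro h; ext x
    simp [mem_asIdeal_specPoint]
  ext U
  constructor
  · rintro ⟨k, p, L, rfl⟩
    have := Fintype.ofFinite σ
    refine ⟨_, ⟨aeval (fun i => ∑ j, C (L i (b j)) * X j) p, rfl⟩, ?_⟩
    rw [hpre]
    ext x
    have hL : ∀ i, L i x = ∑ j, L i (b j) * b.repr x j := by
      intro i
      conv_lhs => rw [← b.sum_repr x, map_sum]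
      exact Finset.sum_congr rfl fun j _ => by rw [map_smul, smul_eq_mul, mul_comm]
    rw [Set.mem_ofPred_eq, Set.mem_ofPred_eq, ← aeval_eq_eval, ← aeval_eq_eval,
      MvPolynomial.comp_aeval_apply]
    simp [hL]
  · rintro ⟨_, ⟨h, rfl⟩, rfl⟩
    obtain ⟨k, ⟨e⟩⟩ := Finite.exists_equiv_fin σ
    refine ⟨k, rename e h, fun i => b.coord (e.symm i), ?_⟩
    rw [hpre]
    ext x
    simp [eval_rename, Function.comp_def]

/-- The ideal of polynomials in the coordinates that vanish on a set. -/
def coordIdeal (S : Set E) : Ideal (MvPolynomial σ ℂ) :=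
  MvPolynomial.vanishingIdeal ℂ ((fun x i => b.repr x i) '' S)

theorem mem_coordIdeal {S : Set E} {h : MvPolynomial σ ℂ} :
    h ∈ coordIdeal b S ↔ ∀ x ∈ S, eval (fun i => b.repr x i) h = 0 := by
  simp [coordIdeal, aeval_eq_eval]

theorem mem_zClosureV [Finite σ] {S : Set E} {x : E} : x ∈ zClosureV S ↔
    ∀ h : MvPolynomial σ ℂ, (∀ y ∈ S, eval (fun i => b.repr y i) h = 0) →
      eval (fun i => b.repr x i) h = 0 := by
  rw [zClosureV, ztV_eq_induced b, closure_induced,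
    ← PrimeSpectrum.zeroLocus_vanishingIdeal_eq_closure]
  have : PrimeSpectrum.vanishingIdeal (specPoint b '' S) = coordIdeal b S := by
    rw [coordIdeal, ← vanishingIdeal_pointToPoint, Set.image_image]; rfl
  rw [this, PrimeSpectrum.mem_zeroLocus]
  simp only [Set.subset_def, SetLike.mem_coe, mem_coordIdeal,
    mem_asIdeal_specPoint]

theorem subset_zClosureV (S : Set E) : S ⊆ zClosureV S :=
  @subset_closure _ (ztV E) S

theorem zClosureV_minimal {S T : Set E} (h : S ⊆ zClosureV T) : zClosureV S ⊆ zClosureV T :=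
  @closure_minimal _ (ztV E) _ _ h (@isClosed_closure _ (ztV E) T)

theorem zDimV_zClosureV [Finite σ] (S : Set E) :
    zDimV (zClosureV S) = ringKrullDim (MvPolynomial σ ℂ ⧸ coordIdeal b S) := by
  let _ : TopologicalSpace E := ztV E
  let ev : zClosureV S → (MvPolynomial σ ℂ ⧸ coordIdeal b S) →+* ℂ := fun x =>
    Ideal.Quotient.lift _ (eval fun i => b.repr x.1 i) fun h hh =>
      (mem_zClosureV b).1 x.2 h ((mem_coordIdeal b).1 hh)
  let j : zClosureV S → PrimeSpectrum (MvPolynomial σ ℂ ⧸ coordIdeal b S) :=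
    fun x => PrimeSpectrum.comap (ev x) ⊥
  have hcomp : PrimeSpectrum.comap (Ideal.Quotient.mk (coordIdeal b S)) ∘ j =
      specPoint b ∘ Subtype.val := by
    funext x
    ext h
    simp [j, ev, mem_asIdeal_specPoint]
  have hj : IsInducing j := by
    have h1 : IsInducing (PrimeSpectrum.comap (Ideal.Quotient.mk (coordIdeal b S))) :=
      (PrimeSpectrum.isClosedEmbedding_comap_of_surjective _ _
        Ideal.Quotient.mk_surjective).isInducing
    rw [← IsInducing.of_comp_iff h1, hcomp]
    have h2 : IsInducing (specPoint b) := ⟨ztV_eq_induced b⟩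
    exact h2.comp IsInducing.subtypeVal
  have hrange : closedPoints (PrimeSpectrum (MvPolynomial σ ℂ ⧸ coordIdeal b S)) ⊆
      Set.range j := by
    intro q hq
    have hmax : q.asIdeal.IsMaximal := (PrimeSpectrum.isClosed_singleton_iff_isMaximal q).1 hq
    have hmax' : (q.asIdeal.comap (Ideal.Quotient.mk (coordIdeal b S))).IsMaximal :=
      Ideal.comap_isMaximal_of_surjective _ Ideal.Quotient.mk_surjective
    obtain ⟨a, ha⟩ := isMaximal_iff_eq_vanishingIdeal_singleton.1 hmax'
    have := Fintype.ofFinite σ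
    have hrepr : (fun i => b.repr (b.equivFun.symm a) i) = a := b.equivFun.apply_symm_apply a
    have hmem : ∀ h : MvPolynomial σ ℂ,
        Ideal.Quotient.mk (coordIdeal b S) h ∈ q.asIdeal ↔ eval a h = 0 := by
      intro h
      rw [← Ideal.mem_comap, ha, MvPolynomial.mem_vanishingIdeal_singleton_iff, aeval_eq_eval]
    have hx : b.equivFun.symm a ∈ zClosureV S := by
      rw [mem_zClosureV b]
      intro h hh
      rw [hrepr, ← hmem, Ideal.Quotient.eq_zero_iff_mem.2 ((mem_coordIdeal b).2 hh)]
      exact zero_mem _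
    refine ⟨⟨_, hx⟩, ?_⟩
    apply PrimeSpectrum.ext
    ext r
    obtain ⟨h, rfl⟩ := Ideal.Quotient.mk_surjective r
    rw [hmem]
    simp [j, ev, -Basis.equivFun_symm_apply, hrepr]
  rw [← PrimeSpectrum.topologicalKrullDim_eq_ringKrullDim]
  refine hj.topologicalKrullDim_eq fun C hC => ?_
  calc C = closure (C ∩ closedPoints _) := by
        rw [JacobsonSpace.closure_inter_closedPoints_eq_closure hC.isLocallyClosed, hC.closure_eq]
    _ ⊆ _ := closure_mono (Set.inter_subset_inter_right _ hrange)

/-- Dimension bounds for the Zariski closure of the image of a polynomial map. -/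
theorem zDimV_bounds [Finite σ] {τ : Type} [Finite τ] (ψ : (τ → ℂ) → E)
    (hψ : ∀ i, ∃ P : MvPolynomial τ ℂ, ∀ a, b.repr (ψ a) i = eval a P) :
    zDimV (zClosureV (Set.range ψ)) ≤ Nat.card τ ∧
    ∀ (r : ℕ) (f : E →ₗ[ℂ] (Fin r → ℂ)),
      (∀ Q : MvPolynomial (Fin r) ℂ, (∀ y ∈ Set.range ψ, eval (f y) Q = 0) → Q = 0) →
      (r : WithBot ℕ∞) ≤ zDimV (zClosureV (Set.range ψ)) := by
  choose P hP using hψ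
  rw [zDimV_zClosureV b]
  have hker : coordIdeal b (Set.range ψ) = RingHom.ker (aeval (R := ℂ) P) := by
    ext h
    rw [mem_coordIdeal, RingHom.mem_ker]
    simp only [Set.forall_mem_range, hP]
    have : ∀ a, eval (fun i => eval a (P i)) h = eval a (aeval P h) := fun a => by
      rw [← aeval_eq_eval a, MvPolynomial.comp_aeval_apply, aeval_eq_eval]
      simp [aeval_eq_eval]
    simp only [this]
    exact ⟨fun H => MvPolynomial.funext fun a => by simpa using H a, fun H a => by rw [H, map_zero]⟩
  rw [hker]
  have hprime : (RingHom.ker (aeval (R := ℂ) P)).IsPrime := RingHom.ker_isPrime _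
  obtain ⟨s, hs, ht⟩ := ringKrullDim_eq_trdeg ℂ (MvPolynomial σ ℂ ⧸ RingHom.ker (aeval (R := ℂ) P))
  rw [hs]
  constructor
  · have h1 := lift_trdeg_le_of_injective _
      (Ideal.kerLiftAlg_injective (aeval (R := ℂ) P))
    rw [ht, MvPolynomial.trdeg_of_isDomain] at h1
    have := Fintype.ofFinite τ
    rw [Nat.card_eq_fintype_card]
    simp only [Cardinal.lift_natCast, Cardinal.mk_fintype, Nat.cast_le] at h1
    exact_mod_cast h1
  · intro r f hf
    have := Fintype.ofFinite σ
    let y : Fin r → MvPolynomial σ ℂ := fun i => ∑ j, C (f (b j) i) * X j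
    have hy : ∀ x : E, ∀ i, eval (fun j => b.repr x j) (y i) = f x i := by
      intro x i
      conv_rhs => rw [← b.sum_repr x, map_sum]
      simp only [y, map_sum, map_mul, eval_C, eval_X, map_smul, Finset.sum_apply, Pi.smul_apply,
        smul_eq_mul, mul_comm]
    have hind : AlgebraicIndependent ℂ (fun i =>
        Ideal.Quotient.mkₐ ℂ (RingHom.ker (aeval (R := ℂ) P)) (y i)) := by
      rw [algebraicIndependent_iff]
      intro Q hQ
      refine hf Q fun x hx => ?_
      rw [← MvPolynomial.comp_aeval_apply, Ideal.Quotient.mkₐ_eq_mk,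
        Ideal.Quotient.eq_zero_iff_mem, ← hker, mem_coordIdeal] at hQ
      have := hQ x hx
      rw [← aeval_eq_eval, MvPolynomial.comp_aeval_apply, aeval_eq_eval] at this
      simpa [aeval_eq_eval, hy] using this
    have h1 := hind.lift_cardinalMk_le_trdeg
    rw [ht] at h1
    simp only [Cardinal.lift_natCast, Cardinal.mk_fin, Nat.cast_le] at h1
    exact_mod_cast h1

end Zariski

section PolynomialFunctions

theorem Subalgebra.multilinear_apply_mem {X ν κ : Type*} [Fintype ν] [Fintype κ]
    (A : Subalgebra ℂ (X → ℂ)) (F : MultilinearMap ℂ (fun _ : κ => ν → ℂ) ℂ)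
    (p : X → κ → ν → ℂ) (hp : ∀ i j, (fun x => p x i j) ∈ A) : (fun x => F (p x)) ∈ A := by
  classical
  have h : (fun x => F (p x)) = ∑ r : κ → ν,
      (∏ i, fun x => p x i (r i)) * (fun _ => F fun i => Pi.single (r i) 1) := by
    funext x
    have hx : p x = fun i => ∑ j, p x i j • (Pi.single j 1 : ν → ℂ) := by
      funext i
      exact pi_eq_sum_univ' (p x i)
    conv_lhs => rw [hx, MultilinearMap.map_sum]
    simp only [MultilinearMap.map_smul_univ, Finset.sum_apply, Pi.mul_apply, Finset.prod_apply,
      smul_eq_mul]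
  rw [h]
  exact sum_mem fun r _ => mul_mem (prod_mem fun i _ => hp i (r i)) (A.algebraMap_mem _)

theorem Subalgebra.eval_mem {X σ : Type*} (A : Subalgebra ℂ (X → ℂ)) (g : X → σ → ℂ)
    (hg : ∀ i, (fun x => g x i) ∈ A) (h : MvPolynomial σ ℂ) : (fun x => eval (g x) h) ∈ A := by
  induction h using MvPolynomial.induction_on with
  | C a =>
    simp only [eval_C]
    exact A.algebraMap_mem a
  | add p q hp hq =>
    simp only [map_add]
    exact add_mem hp hq
  | mul_X p i hp =>
    simp only [map_mul, eval_X]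
    exact mul_mem hp (hg i)

/-- The algebra of polynomial functions of one complex variable. -/
def polyFun : Subalgebra ℂ (ℂ → ℂ) := (Polynomial.aeval (id : ℂ → ℂ)).range

theorem mem_polyFun {f : ℂ → ℂ} : f ∈ polyFun ↔ ∃ P : Polynomial ℂ, ∀ s, P.eval s = f s := by
  have : ∀ (P : Polynomial ℂ) (s : ℂ), Polynomial.aeval (id : ℂ → ℂ) P s = P.eval s := by
    intro P s
    exact (Polynomial.aeval_algHom_apply (Pi.evalAlgHom ℂ (fun _ : ℂ => ℂ) s) id P).symm
  simp only [polyFun, AlgHom.mem_range, funext_iff, this]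

theorem affine_mem_polyFun (a c : ℂ) : (fun s => a + s * c) ∈ polyFun :=
  mem_polyFun.2 ⟨Polynomial.C a + Polynomial.X * Polynomial.C c, fun s => by simp; ring⟩

theorem finite_zeros_of_mem_polyFun {f : ℂ → ℂ} (hf : f ∈ polyFun) {s₀ : ℂ} (h₀ : f s₀ ≠ 0) :
    {s | f s = 0}.Finite := by
  obtain ⟨P, hP⟩ := mem_polyFun.1 hf
  have hP0 : P ≠ 0 := by
    rintro rfl
    exact h₀ (by simp [← hP])
  refine (P.rootSet_finite ℂ).subset fun s hs => ?_
  rw [Polynomial.mem_rootSet]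
  exact ⟨hP0, by simpa [Polynomial.aeval_def, hP] using hs⟩

/-- A set in a complex vector space whose intersection with every line meeting it is cofinite. -/
def LineOpen {M : Type*} [AddCommGroup M] [Module ℂ M] (U : Set M) : Prop :=
  ∀ u ∈ U, ∀ w : M, {s : ℂ | u + s • w ∉ U}.Finite

variable {M M' : Type*} [AddCommGroup M] [Module ℂ M] [AddCommGroup M'] [Module ℂ M']

theorem LineOpen.univ : LineOpen (Set.univ : Set M) := fun _ _ _ => by simp

theorem LineOpen.inter {U U' : Set M} (h : LineOpen U) (h' : LineOpen U') :
    LineOpen (U ∩ U') := by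
  intro u hu w
  refine ((h u hu.1 w).union (h' u hu.2 w)).subset fun s hs => ?_
  by_contra hc
  simp only [Set.mem_union, Set.mem_ofPred_eq, not_or, not_not] at hc
  exact hs hc

theorem LineOpen.nonempty_inter {U U' : Set M} (h : LineOpen U) (h' : LineOpen U')
    (hU : U.Nonempty) (hU' : U'.Nonempty) : (U ∩ U').Nonempty := by
  obtain ⟨u, hu⟩ := hU
  obtain ⟨u', hu'⟩ := hU'
  have h1 := h u hu (u' - u)
  have h2 := (h' u' hu' (u - u')).preimage
    (f := fun s : ℂ => 1 - s) (sub_right_injective.injOn)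
  obtain ⟨s, hs⟩ := ((h1.union h2).infinite_compl).nonempty
  simp only [Set.mem_compl_iff, Set.mem_union, Set.mem_ofPred_eq, Set.mem_preimage, not_or,
    not_not] at hs
  refine ⟨_, hs.1, ?_⟩
  convert hs.2 using 1
  module

theorem LineOpen.iInter {α : Type*} [Finite α] {U : α → Set M} (h : ∀ a, LineOpen (U a))
    (hne : ∀ a, (U a).Nonempty) : LineOpen (⋂ a, U a) ∧ (⋂ a, U a).Nonempty := by
  classical
  have := Fintype.ofFinite α
  have key : ∀ s : Finset α, LineOpen (⋂ a ∈ s, U a) ∧ (⋂ a ∈ s, U a).Nonempty := by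
    intro s
    induction s using Finset.induction_on with
    | empty => exact ⟨by simpa using! LineOpen.univ, by simp⟩
    | insert a s ha ih =>
      rw [Finset.set_biInter_insert]
      exact ⟨(h a).inter ih.1, (h a).nonempty_inter ih.1 (hne a) ih.2⟩
  simpa using key Finset.univ

end PolynomialFunctions

section TangentSpaces

open Module

variable {ι ν κ E : Type*} [Fintype κ] [DecidableEq κ] [AddCommGroup E] [Module ℂ E]
  (F : MultilinearMap ℂ (fun _ : κ => ν → ℂ) E)

/-- The tangent space at `F p` of the image of a multilinear map `F`. -/
def tangentSpan (p : κ → ν → ℂ) : Submodule ℂ E := LinearMap.range (F.linearDeriv p)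

/-- The span of the tangent spaces at several points. -/
def joinTangent (s : Finset ι) (p : ι → κ → ν → ℂ) : Submodule ℂ E :=
  ⨆ i ∈ s, tangentSpan F (p i)

theorem mem_joinTangent {s : Finset ι} {p : ι → κ → ν → ℂ} {x : E} :
    x ∈ joinTangent F s p ↔ ∃ q : ι → κ → ν → ℂ, ∑ i ∈ s, F.linearDeriv (p i) (q i) = x := by
  rw [joinTangent, Submodule.mem_iSup_finset_iff_exists_sum]
  constructor
  · rintro ⟨μ, rfl⟩
    choose q hq using fun i => (μ i).2
    exact ⟨q, Finset.sum_congr rfl fun i _ => hq i⟩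
  · rintro ⟨q, rfl⟩
    exact ⟨fun i => ⟨_, LinearMap.mem_range_self _ (q i)⟩, rfl⟩

theorem linearDeriv_mem_subalgebra [Fintype ν] {X : Type*} (A : Subalgebra ℂ (X → ℂ))
    (φ : E →ₗ[ℂ] ℂ)
    (p q : X → κ → ν → ℂ) (hp : ∀ i j, (fun x => p x i j) ∈ A)
    (hq : ∀ i j, (fun x => q x i j) ∈ A) : (fun x => φ (F.linearDeriv (p x) (q x))) ∈ A := by
  have h : (fun x => φ (F.linearDeriv (p x) (q x))) =
      ∑ i, fun x => φ.compMultilinearMap F (Function.update (p x) i (q x i)) := by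
    funext x
    simp
  rw [h]
  refine sum_mem fun i _ => A.multilinear_apply_mem _ _ fun i' j => ?_
  by_cases hi : i' = i
  · subst hi
    simpa using hq i' j
  · simpa [hi] using hp i' j

theorem exists_linearMap_eq_single {r : ℕ} {w : Fin r → E} (hw : LinearIndependent ℂ w) :
    ∃ f : E →ₗ[ℂ] (Fin r → ℂ), ∀ k, f (w k) = Pi.single k 1 := by
  obtain ⟨f, hf⟩ := LinearMap.exists_leftInverse_of_injective (Fintype.linearCombination ℂ w)
    (LinearMap.ker_eq_bot.2 hw.fintypeLinearCombination_injective)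
  refine ⟨f, fun k => ?_⟩
  have := LinearMap.congr_fun hf (Pi.single k 1)
  simpa [Fintype.linearCombination_apply_single] using this

theorem lineOpen_le_finrank_joinTangent [Fintype ν] [FiniteDimensional ℂ E]
    (s : Finset ι) (r : ℕ) :
    LineOpen {p : ι → κ → ν → ℂ | r ≤ finrank ℂ (joinTangent F s p)} := by
  intro u hu w
  obtain ⟨v, hv⟩ := exists_linearIndependent_of_le_finrank (R := ℂ) hu
  have hv' : LinearIndependent ℂ fun k => (v k : E) :=
    hv.map' (joinTangent F s u).subtype (Submodule.ker_subtype _)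
  choose q hq using fun k => (mem_joinTangent F).1 (v k).2
  obtain ⟨f, hf⟩ := exists_linearMap_eq_single hv'
  let A : ℂ → Matrix (Fin r) (Fin r) ℂ := fun c =>
    Matrix.of fun k => f (∑ i ∈ s, F.linearDeriv (u i + c • w i) (q k i))
  have hA : (fun c => (A c).det) ∈ polyFun := by
    have : (fun c => (A c).det) = ∑ e : Equiv.Perm (Fin r),
        (fun _ => ((Equiv.Perm.sign e : ℤ) : ℂ)) * ∏ k, fun c => A c (e k) k := by
      funext c
      simp [Matrix.det_apply']
    rw [this]
    refine sum_mem fun e _ => mul_mem (polyFun.algebraMap_mem _) (prod_mem fun k _ => ?_)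
    have : (fun c => A c (e k) k) = ∑ i ∈ s, fun c =>
        (LinearMap.proj k ∘ₗ f) (F.linearDeriv (u i + c • w i) (q (e k) i)) := by
      funext c
      simp [A]
    rw [this]
    refine sum_mem fun i _ => linearDeriv_mem_subalgebra F _ _ _ _ (fun a b => ?_)
      fun a b => polyFun.algebraMap_mem _
    simpa using! affine_mem_polyFun (u i a b) (w i a b)
  have hA0 : (A 0).det ≠ 0 := by
    have : A 0 = 1 := by
      ext k j
      simp only [A, Matrix.of_apply, zero_smul, add_zero, hq, hf, Matrix.one_apply,
        Pi.single_apply, eq_comm]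
    simp [this]
  refine (finite_zeros_of_mem_polyFun hA hA0).subset fun c hc => ?_
  by_contra hne
  have hli : LinearIndependent ℂ fun k => ∑ i ∈ s, F.linearDeriv (u i + c • w i) (q k i) :=
    LinearIndependent.of_comp f (Matrix.linearIndependent_rows_of_det_ne_zero hne)
  have hli' : LinearIndependent ℂ fun k =>
      (⟨_, (mem_joinTangent F).2 ⟨q k, rfl⟩⟩ : joinTangent F s (u + c • w)) :=
    LinearIndependent.of_comp (joinTangent F s (u + c • w)).subtype hli
  exact hc (by simpa using hli'.fintype_card_le_finrank)

/-- The generic dimension of the span of the tangent spaces at `m` points. -/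
def tangentRank (m : ℕ) : ℕ :=
  sSup (Set.range fun p : Fin m → κ → ν → ℂ => finrank ℂ (joinTangent F Finset.univ p))

theorem joinTangent_comp_equiv {s : Finset ι} {m : ℕ} (e : Fin m ≃ s) (p : ι → κ → ν → ℂ) :
    joinTangent F Finset.univ (fun j => p (e j)) = joinTangent F s p := by
  simp only [joinTangent, Finset.mem_univ, iSup_pos]
  rw [e.iSup_comp (g := fun i : s => tangentSpan F (p i)), iSup_subtype]

theorem bddAbove_finrank_joinTangent [FiniteDimensional ℂ E] (m : ℕ) :
    BddAbove (Set.range fun p : Fin m → κ → ν → ℂ => finrank ℂ (joinTangent F Finset.univ p)) :=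
  ⟨finrank ℂ E, by rintro _ ⟨p, rfl⟩; exact Submodule.finrank_le _⟩

theorem finrank_joinTangent_le [FiniteDimensional ℂ E] (s : Finset ι) (p : ι → κ → ν → ℂ) :
    finrank ℂ (joinTangent F s p) ≤ tangentRank F s.card := by
  rw [← joinTangent_comp_equiv F s.equivFin.symm p]
  exact le_csSup (bddAbove_finrank_joinTangent F _) ⟨_, rfl⟩

theorem exists_finrank_joinTangent_eq [FiniteDimensional ℂ E] (s : Finset ι) :
    ∃ p : ι → κ → ν → ℂ, finrank ℂ (joinTangent F s p) = tangentRank F s.card := by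
  classical
  obtain ⟨p, hp⟩ := Nat.sSup_mem (Set.range_nonempty _) (bddAbove_finrank_joinTangent F s.card)
  refine ⟨fun i => if h : i ∈ s then p (s.equivFin ⟨i, h⟩) else 0, ?_⟩
  have h : (fun j => if h : (s.equivFin.symm j : ι) ∈ s then
      p (s.equivFin ⟨s.equivFin.symm j, h⟩) else 0) = p := by
    funext j
    simp
  rw [← joinTangent_comp_equiv F s.equivFin.symm, h]
  exact hp

theorem tangentRank_le_finrank [FiniteDimensional ℂ E] (m : ℕ) :
    tangentRank F m ≤ finrank ℂ E := by
  obtain ⟨p, hp⟩ := exists_finrank_joinTangent_eq F (Finset.univ : Finset (Fin m))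
  rw [Finset.card_fin] at hp
  exact hp ▸ Submodule.finrank_le _

theorem joinTangent_insert [DecidableEq ι] (i : ι) (s : Finset ι) (p : ι → κ → ν → ℂ) :
    joinTangent F (insert i s) p = tangentSpan F (p i) ⊔ joinTangent F s p :=
  Finset.iSup_insert _ _ _

theorem joinTangent_mono {s s' : Finset ι} (h : s ⊆ s') (p : ι → κ → ν → ℂ) :
    joinTangent F s p ≤ joinTangent F s' p :=
  biSup_mono fun _ hi => h hi

theorem joinTangent_singleton (i : ι) (p : ι → κ → ν → ℂ) :
    joinTangent F {i} p = tangentSpan F (p i) := by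
  simp [joinTangent]

theorem joinTangent_congr {s : Finset ι} {p p' : ι → κ → ν → ℂ} (h : ∀ i ∈ s, p i = p' i) :
    joinTangent F s p = joinTangent F s p' :=
  biSup_congr fun i hi => by rw [h i hi]

/-- Configurations of points whose subsets all have tangent spaces in general position. -/
def goodPoints (ι : Type*) : Set (ι → κ → ν → ℂ) :=
  ⋂ s : Finset ι, {p | tangentRank F s.card ≤ finrank ℂ (joinTangent F s p)}

theorem lineOpen_goodPoints [Fintype ν] [FiniteDimensional ℂ E] (ι : Type*) [Finite ι] :
    LineOpen (goodPoints F ι) ∧ (goodPoints F ι).Nonempty :=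
  LineOpen.iInter (fun s => lineOpen_le_finrank_joinTangent F s _) fun s =>
    (exists_finrank_joinTangent_eq F s).imp fun _ h => h.ge

theorem finrank_joinTangent_of_mem_goodPoints [FiniteDimensional ℂ E] {p : ι → κ → ν → ℂ}
    (hp : p ∈ goodPoints F ι) (s : Finset ι) :
    finrank ℂ (joinTangent F s p) = tangentRank F s.card :=
  (finrank_joinTangent_le F s p).antisymm (Set.mem_iInter.1 hp s)

theorem tangentRank_zero [FiniteDimensional ℂ E] : tangentRank F 0 = 0 := by
  obtain ⟨p, hp⟩ := exists_finrank_joinTangent_eq F (∅ : Finset (Fin 0))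
  rw [show joinTangent F (∅ : Finset (Fin 0)) p = ⊥ by simp [joinTangent], finrank_bot] at hp
  exact hp.symm

theorem tangentRank_le_succ [FiniteDimensional ℂ E] (k : ℕ) :
    tangentRank F k ≤ tangentRank F (k + 1) := by
  obtain ⟨p, hp⟩ := exists_finrank_joinTangent_eq F (Finset.range k)
  rw [Finset.card_range] at hp
  rw [← hp]
  refine (Submodule.finrank_mono (joinTangent_mono F
    (Finset.range_subset_range.2 k.le_succ) p)).trans ?_
  simpa using finrank_joinTangent_le F (Finset.range (k + 1)) p

theorem tangentRank_succ_le [FiniteDimensional ℂ E] (k : ℕ) :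
    tangentRank F (k + 1) ≤ tangentRank F k + tangentRank F 1 := by
  obtain ⟨p, hp⟩ := exists_finrank_joinTangent_eq F (Finset.range (k + 1))
  rw [Finset.card_range] at hp
  rw [← hp, Finset.range_add_one, joinTangent_insert, ← joinTangent_singleton F k p, add_comm]
  refine (Submodule.finrank_add_le_finrank_add_finrank _ _).trans (add_le_add ?_ ?_)
  · simpa using finrank_joinTangent_le F {k} p
  · simpa using finrank_joinTangent_le F (Finset.range k) p

end TangentSpaces

section StepLemma

open Module

variable {ι ν κ E : Type*} [Fintype κ] [DecidableEq κ] [AddCommGroup E] [Module ℂ E]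
  (F : MultilinearMap ℂ (fun _ : κ => ν → ℂ) E)

theorem finrank_tangentSpan_inf_joinTangent [FiniteDimensional ℂ E] [DecidableEq ι]
    {p : ι → κ → ν → ℂ}
    (hp : p ∈ goodPoints F ι) {s : Finset ι} {x : ι} (hx : x ∉ s) :
    tangentRank F (s.card + 1) +
      finrank ℂ (tangentSpan F (p x) ⊓ joinTangent F s p : Submodule ℂ E) =
        tangentRank F 1 + tangentRank F s.card := by
  have h := Submodule.finrank_sup_add_finrank_inf_eq (tangentSpan F (p x)) (joinTangent F s p)
  rw [← joinTangent_insert, finrank_joinTangent_of_mem_goodPoints F hp,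
    finrank_joinTangent_of_mem_goodPoints F hp, Finset.card_insert_of_notMem hx] at h
  rw [h, ← joinTangent_singleton F x p, finrank_joinTangent_of_mem_goodPoints F hp,
    Finset.card_singleton]

theorem tangentSpan_inf_joinTangent_insert [FiniteDimensional ℂ E] [DecidableEq ι]
    {p : ι → κ → ν → ℂ}
    (hp : p ∈ goodPoints F ι) {k : ℕ}
    (hk : 2 * tangentRank F (k + 1) ≤ tangentRank F (k + 2) + tangentRank F k) {s : Finset ι}
    (hs : s.card = k) {x i : ι} (hx : x ∉ s) (hi : i ∉ s) (hxi : x ≠ i) :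
    tangentSpan F (p x) ⊓ joinTangent F s p =
      tangentSpan F (p x) ⊓ joinTangent F (insert i s) p := by
  refine Submodule.eq_of_le_of_finrank_le
    (inf_le_inf_left _ (joinTangent_mono F (Finset.subset_insert i s) p)) ?_
  have h1 := finrank_tangentSpan_inf_joinTangent F hp hx
  have h2 := finrank_tangentSpan_inf_joinTangent F hp (s := insert i s) (x := x) (by simp [hx, hxi])
  rw [Finset.card_insert_of_notMem hi] at h2
  rw [hs] at h1 h2
  have h3 : k + 1 + 1 = k + 2 := rfl
  rw [h3] at h2
  omega

theorem tangentSpan_inf_joinTangent_eq [FiniteDimensional ℂ E] [DecidableEq ι] {p : ι → κ → ν → ℂ}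
    (hp : p ∈ goodPoints F ι) {k : ℕ}
    (hk : 2 * tangentRank F (k + 1) ≤ tangentRank F (k + 2) + tangentRank F k) {x : ι} :
    ∀ {s s' : Finset ι}, s.card = k → s'.card = k → x ∉ s → x ∉ s' →
      tangentSpan F (p x) ⊓ joinTangent F s p = tangentSpan F (p x) ⊓ joinTangent F s' p := by
  intro s s' hs hs' hx hx'
  induction h : (s \ s').card generalizing s with
  | zero =>
    rw [Finset.card_eq_zero, Finset.sdiff_eq_empty_iff_subset] at h
    rw [Finset.eq_of_subset_of_card_le h (hs'.trans hs.symm).le]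
  | succ c ih =>
    obtain ⟨a, ha⟩ : (s \ s').Nonempty := Finset.card_pos.1 (h.symm ▸ c.succ_pos)
    obtain ⟨b, hb⟩ : (s' \ s).Nonempty := by
      rw [← Finset.card_pos, Finset.card_sdiff_comm (hs'.trans hs.symm), h]
      exact c.succ_pos
    rw [Finset.mem_sdiff] at ha hb
    have hxa : x ≠ a := fun h => hx (h ▸ ha.1)
    have hxb : x ≠ b := fun h => hx' (h ▸ hb.1)
    have hba : b ≠ a := fun h => hb.2 (h ▸ ha.1)
    have hcard : (insert b (s.erase a)).card = k := by
      rw [Finset.card_insert_of_notMem (by simp [hb.2]), Finset.card_erase_add_one ha.1, hs]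
    have hxt : x ∉ insert b (s.erase a) := by simp [hxb, hx]
    rw [tangentSpan_inf_joinTangent_insert F hp hk hs hx hb.2 hxb, ← ih hcard hxt,
      tangentSpan_inf_joinTangent_insert F hp hk hcard hxt (i := a) (by simp [hba.symm]) hxa,
      Finset.insert_comm, Finset.insert_erase ha.1]
    rw [Finset.insert_sdiff_of_mem _ hb.1, Finset.erase_sdiff_comm,
      Finset.card_erase_of_mem (by simp [ha]), h, Nat.add_sub_cancel]

theorem map_linearDeriv {ρg : E →ₗ[ℂ] E} {g : (ν → ℂ) →ₗ[ℂ] (ν → ℂ)}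
    (h : ∀ p, ρg (F p) = F fun i => g (p i)) (p q : κ → ν → ℂ) :
    ρg (F.linearDeriv p q) = F.linearDeriv (fun i => g (p i)) (fun i => g (q i)) := by
  simp only [MultilinearMap.linearDeriv_apply, map_sum, h]
  refine Finset.sum_congr rfl fun i _ => congrArg F ?_
  funext j
  by_cases hj : j = i
  · subst hj
    simp
  · simp [hj]

theorem map_mem_joinTangent {ρg : E →ₗ[ℂ] E} {g : (ν → ℂ) →ₗ[ℂ] (ν → ℂ)}
    (h : ∀ p, ρg (F p) = F fun i => g (p i)) {s : Finset ι} {p : ι → κ → ν → ℂ} {v : E}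
    (hv : v ∈ joinTangent F s p) : ρg v ∈ joinTangent F s (fun i j => g (p i j)) := by
  obtain ⟨q, rfl⟩ := (mem_joinTangent F).1 hv
  rw [map_sum]
  simp only [map_linearDeriv F h]
  exact (mem_joinTangent F).2 ⟨fun i j => g (q i j), rfl⟩

/-- Once the slope of the generic tangent rank stops decreasing, either the ambient space is filled
or the slope is still the maximal one. -/
theorem tangentRank_step [Fintype ν] [FiniteDimensional ℂ E]
    (ρ : ((ν → ℂ) →ₗ[ℂ] (ν → ℂ)) → (E →ₗ[ℂ] E))
    (hρ : ∀ g p, ρ g (F p) = F fun i => g (p i))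
    (hirr : ∀ v : E, v ≠ 0 → ∀ φ : E →ₗ[ℂ] ℂ, (∀ g, φ (ρ g v) = 0) → φ = 0) {k : ℕ}
    (hk : 2 * tangentRank F (k + 1) ≤ tangentRank F (k + 2) + tangentRank F k) :
    tangentRank F k = finrank ℂ E ∨ tangentRank F k + tangentRank F 1 ≤ tangentRank F (k + 1) := by
  classical
  let ι := Option (Fin k ⊕ Fin k)
  obtain ⟨hopen, p, hp⟩ := lineOpen_goodPoints F ι
  let S : Finset ι := Finset.univ.map (Function.Embedding.inl.trans Function.Embedding.some)
  let S' : Finset ι := Finset.univ.map (Function.Embedding.inr.trans Function.Embedding.some)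
  let x : ι := none
  have hS : S.card = k := by simp [S]
  have hS' : S'.card = k := by simp [S']
  have hxS : x ∉ S := fun h => by
    obtain ⟨y, -, hy⟩ := Finset.mem_map.1 h
    exact Option.some_ne_none _ hy
  have hxS' : x ∉ S' := fun h => by
    obtain ⟨y, -, hy⟩ := Finset.mem_map.1 h
    exact Option.some_ne_none _ hy
  have hSS' : ∀ i ∈ S', i ∉ S := by simp [S, S']
  by_contra! hcon
  obtain ⟨v, hv, hv0⟩ : ∃ v ∈ tangentSpan F (p x) ⊓ joinTangent F S' p, v ≠ 0 := by
    apply Submodule.exists_mem_ne_zero_of_ne_bot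
    intro h
    have h1 := finrank_tangentSpan_inf_joinTangent F hp hxS'
    rw [h, finrank_bot, hS'] at h1
    omega
  have hlt : joinTangent F S p < ⊤ := by
    rw [lt_top_iff_ne_top]
    intro h
    have h1 := finrank_joinTangent_of_mem_goodPoints F hp S
    rw [h, finrank_top, hS] at h1
    exact hcon.1 h1.symm
  obtain ⟨φ, hφ0, hφ⟩ := Submodule.exists_le_ker_of_lt_top _ hlt
  refine hφ0 (hirr v hv0 φ fun g => ?_)
  obtain ⟨q, hq⟩ := hv.1
  let G : ℂ → (ν → ℂ) →ₗ[ℂ] (ν → ℂ) := fun c => LinearMap.id + c • (g - LinearMap.id)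
  have hG1 : G 1 = g := by simp [G]
  let w : ι → κ → ν → ℂ := fun i => if i ∈ S then 0 else fun j => g (p i j) - p i j
  have hwS : ∀ c : ℂ, ∀ i ∈ S, (p + c • w) i = p i := fun c i hi => by simp [w, hi]
  have hwS' : ∀ (c : ℂ) i, i ∉ S → (p + c • w) i = fun j => G c (p i j) := fun c i hi => by
    funext j
    simp [w, hi, G]
  have hpoly : (fun c => φ (ρ (G c) v)) ∈ polyFun := by
    simp only [← hq, map_linearDeriv F (hρ _)]
    refine linearDeriv_mem_subalgebra F _ _ _ _ (fun a b => ?_) fun a b => ?_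
    · simpa [G] using affine_mem_polyFun (p x a b) (g (p x a) b - p x a b)
    · simpa [G] using affine_mem_polyFun (q a b) (g (q a) b - q a b)
  by_contra hne
  have hfin1 := hopen p hp w
  have hfin2 := finite_zeros_of_mem_polyFun hpoly (s₀ := 1) (by rwa [hG1])
  obtain ⟨c, hc⟩ := (hfin1.union hfin2).infinite_compl.nonempty
  simp only [Set.mem_compl_iff, Set.mem_union, Set.mem_ofPred_eq, not_or, not_not] at hc
  apply hc.2
  apply hφ
  rw [← joinTangent_congr F (hwS c)]
  have heq := tangentSpan_inf_joinTangent_eq F hc.1 hk hS' hS hxS' hxS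
  have hmem : ρ (G c) v ∈ tangentSpan F ((p + c • w) x) ⊓ joinTangent F S' (p + c • w) := by
    constructor
    · rw [hwS' c x hxS, ← hq, map_linearDeriv F (hρ _)]
      exact LinearMap.mem_range_self _ _
    · rw [joinTangent_congr F fun i hi => hwS' c i (hSS' i hi)]
      exact map_mem_joinTangent F (hρ _) hv.2
  rw [heq] at hmem
  exact hmem.2

end StepLemma

section Numerics

/-- A concave integer sequence that loses slope strictly until it reaches its bound. -/
theorem slope_sequence {t : ℕ → ℕ} {D : ℕ} (h0 : t 0 = 0) (hmono : ∀ k, t k ≤ t (k + 1))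
    (hsub : ∀ k, t (k + 1) ≤ t k + t 1) (hD : ∀ k, t k ≤ D)
    (hstep : ∀ k, 2 * t (k + 1) ≤ t (k + 2) + t k → t k = D ∨ t k + t 1 ≤ t (k + 1)) :
    (∀ m, t 1 * (m + t 1) ≤ D → t m = m * t 1) ∧
      (∀ m, D + t 1 ^ 2 ≤ m * t 1 → t m = D) := by
  have hle : ∀ m, t m ≤ m * t 1 := by
    intro m
    induction m with
    | zero => simp [h0]
    | succ m ih => have := hsub m; rw [Nat.succ_mul]; omega
  have hmono' : Monotone t := monotone_nat_of_le_succ hmono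
  have key : ∀ m, t m ≠ m * t 1 → ∃ a < m, t a = a * t 1 ∧ t (a + 1) < t a + t 1 ∧
      t (a + t 1 + 1) = D := by
    classical
    intro m hm
    have hex : ∃ m, t m ≠ m * t 1 := ⟨m, hm⟩
    obtain ⟨a, ha⟩ : ∃ a, Nat.find hex = a + 1 := by
      refine Nat.exists_eq_succ_of_ne_zero fun h => Nat.find_spec hex ?_
      simp [h, h0]
    have haN : t a = a * t 1 := not_not.1 (Nat.find_min hex (m := a) (by omega))
    have hlt : t (a + 1) < t a + t 1 := by
      refine (hsub a).lt_of_ne fun h => Nat.find_spec hex ?_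
      rw [ha, h, haN, Nat.succ_mul]
    have ham : a < m := by
      have := Nat.find_min' hex hm
      omega
    refine ⟨a, ham, haN, hlt, ?_⟩
    have hslope : ∀ j, t (a + j + 1) = D ∨ t (a + j + 1) + j + 1 ≤ t (a + j) + t 1 := by
      intro j
      induction j with
      | zero => exact Or.inr (by simpa using hlt)
      | succ j ih =>
        have h1 := hstep (a + j)
        have h2 := hD (a + j + 2)
        have h3 := hmono (a + j + 1)
        have h4 := hmono (a + j)
        have h5 := hD (a + j + 1)
        have e1 : a + (j + 1) = a + j + 1 := rfl
        have e2 : a + j + 1 + 1 = a + j + 2 := rfl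
        rw [e1, e2]
        rw [e2] at h3
        by_cases h : 2 * t (a + j + 1) ≤ t (a + j + 2) + t (a + j)
        · rcases h1 h with h1 | h1 <;> omega
        · omega
    have := hslope (t 1)
    have := hmono (a + t 1)
    omega
  refine ⟨fun m hm => ?_, fun m hm => ?_⟩
  · by_contra hne
    obtain ⟨a, ham, haN, hlt, haD⟩ := key m hne
    have hgrow : ∀ j, t (a + 1 + j) ≤ t (a + 1) + j * t 1 := by
      intro j
      induction j with
      | zero => simp
      | succ j ih =>
        have := hsub (a + 1 + j)
        rw [Nat.succ_mul, ← add_assoc]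
        omega
    have h1 := hgrow (t 1)
    rw [add_right_comm, haD] at h1
    have h2 : (a + 1) * t 1 ≤ m * t 1 := Nat.mul_le_mul_right _ ham
    nlinarith
  · by_cases hne : t m = m * t 1
    · have h1 := hD m
      rcases Nat.eq_zero_or_pos (t 1) with h | h
      · rw [h] at hm hne
        simp only [mul_zero] at hm hne
        omega
      · have : 0 < t 1 ^ 2 := by positivity
        omega
    · obtain ⟨a, -, haN, hlt, haD⟩ := key m hne
      rcases lt_or_ge (a + t 1) m with h | h
      · exact (hD m).antisymm (haD ▸ hmono' h)
      · have h1 : m * t 1 ≤ (a + t 1) * t 1 := Nat.mul_le_mul_right _ h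
        have h2 : D ≤ t a := by nlinarith
        have h3 : t 1 ^ 2 ≤ (m - a) * t 1 := by
          rcases le_total m a with h4 | h4
          · have : m * t 1 ≤ a * t 1 := Nat.mul_le_mul_right _ h4
            have := hD a
            rw [Nat.sub_eq_zero_of_le h4]
            nlinarith
          · have := hD a
            rw [Nat.sub_mul]
            omega
        have h4 : a ≤ m := by
          by_contra h4
          rw [Nat.sub_eq_zero_of_le (by omega), zero_mul] at h3
          have := hmono a
          have : t 1 ≠ 0 := by omega
          have : 0 < t 1 ^ 2 := by positivity
          omega
        exact (hD m).antisymm (h2.trans (hmono' h4))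

end Numerics

section Independence

open Module Topology

variable {ι ν κ E : Type*} [Fintype ι] [Fintype ν] [Fintype κ] [AddCommGroup E]
  [Module ℂ E] (F : MultilinearMap ℂ (fun _ : κ => ν → ℂ) E)

theorem MultilinearMap.continuous_of_pi {r : ℕ}
    (H : MultilinearMap ℂ (fun _ : κ => ν → ℂ) (Fin r → ℂ)) : Continuous H := by
  refine continuous_pi fun k => ?_
  exact (continuousSubalgebra (α := κ → ν → ℂ) (R := ℂ) (A := ℂ)).multilinear_apply_mem
    ((LinearMap.proj k).compMultilinearMap H) id
    fun i j => (continuous_apply_apply i j : Continuous fun p : κ → ν → ℂ => p i j)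

theorem eq_zero_of_vanishing_on_sums [DecidableEq κ] {r : ℕ} (f : E →ₗ[ℂ] (Fin r → ℂ))
    (p : ι → κ → ν → ℂ)
    (hf : (joinTangent F Finset.univ p).map f = ⊤) {Q : MvPolynomial (Fin r) ℂ}
    (hQ : ∀ p' : ι → κ → ν → ℂ, eval (f (∑ i, F (p' i))) Q = 0) : Q = 0 := by
  let H : ContinuousMultilinearMap ℂ (fun _ : κ => ν → ℂ) (Fin r → ℂ) :=
    ⟨f.compMultilinearMap F, MultilinearMap.continuous_of_pi _⟩
  have hH : ∀ q, H q = f (F q) := fun _ => rfl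
  let D : (ι → κ → ν → ℂ) →L[ℂ] (Fin r → ℂ) :=
    ∑ i, (H.linearDeriv (p i)).comp (ContinuousLinearMap.proj i)
  have hD : HasStrictFDerivAt (fun p' : ι → κ → ν → ℂ => ∑ i, H (p' i)) D p :=
    HasStrictFDerivAt.fun_sum fun i _ =>
      (H.hasStrictFDerivAt (p i)).comp p (hasStrictFDerivAt_apply i p)
  have hsurj : D.range = ⊤ := by
    refine LinearMap.range_eq_top.2 fun y => ?_
    obtain ⟨x, hx, rfl⟩ := (hf ▸ Submodule.mem_top : y ∈ (joinTangent F Finset.univ p).map f)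
    obtain ⟨q, rfl⟩ := (mem_joinTangent F).1 hx
    exact ⟨q, by simp [D, hH]⟩
  have hnhds := hD.map_nhds_eq_of_surj hsurj
  have hev : ∀ᶠ y in 𝓝 (∑ i, H (p i)), eval y Q = 0 := by
    rw [← hnhds, Filter.eventually_map]
    exact Filter.Eventually.of_forall fun p' => by simpa [hH] using hQ p'
  obtain ⟨ε, hε, hball⟩ := Metric.eventually_nhds_iff_ball.1 hev
  refine MvPolynomial.funext_set (fun k => Metric.ball ((∑ i, H (p i)) k) ε)
    (fun k => infinite_of_mem_nhds _ (Metric.ball_mem_nhds _ hε)) fun y hy => ?_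
  rw [hball y (by rwa [← ball_pi _ hε] at hy), map_zero]

/-- The algebra of polynomial functions on a coordinate space. -/
def mvPolyFun (τ : Type*) : Subalgebra ℂ ((τ → ℂ) → ℂ) :=
  (aeval (R := ℂ) (fun (t : τ) (a : τ → ℂ) => a t)).range

theorem mem_mvPolyFun {τ : Type*} {f : (τ → ℂ) → ℂ} :
    f ∈ mvPolyFun τ ↔ ∃ P : MvPolynomial τ ℂ, ∀ a, f a = eval a P := by
  have : ∀ (P : MvPolynomial τ ℂ) (a : τ → ℂ),
      aeval (R := ℂ) (fun (t : τ) (a : τ → ℂ) => a t) P a = eval a P := by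
    intro P a
    rw [← aeval_eq_eval]
    exact MvPolynomial.comp_aeval_apply _ (Pi.evalAlgHom ℂ (fun _ : τ → ℂ => ℂ) a) P
  simp only [mvPolyFun, AlgHom.mem_range, funext_iff, this, eq_comm]

theorem apply_mem_mvPolyFun {τ : Type*} (t : τ) : (fun a : τ → ℂ => a t) ∈ mvPolyFun τ :=
  mem_mvPolyFun.2 ⟨X t, fun _ => (eval_X t).symm⟩

theorem tangentRank_le_zDimV {ν κ : Type} [Fintype ν] [Fintype κ] [DecidableEq κ]
    [FiniteDimensional ℂ E] (F : MultilinearMap ℂ (fun _ : κ => ν → ℂ) E) (m : ℕ) :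
    (tangentRank F m : WithBot ℕ∞) ≤
      zDimV (zClosureV (Set.range fun p : Fin m → κ → ν → ℂ => ∑ i, F (p i))) := by
  let ψ : (Fin m × κ × ν → ℂ) → E := fun a => ∑ i, F fun j k => a (i, j, k)
  have hrange : (Set.range fun p : Fin m → κ → ν → ℂ => ∑ i, F (p i)) = Set.range ψ := by
    refine Set.Subset.antisymm ?_ ?_
    · rintro _ ⟨p, rfl⟩
      exact ⟨fun t => p t.1 t.2.1 t.2.2, rfl⟩
    · rintro _ ⟨a, rfl⟩
      exact ⟨fun i j k => a (i, j, k), rfl⟩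
  obtain ⟨p, hp⟩ := exists_finrank_joinTangent_eq F (Finset.univ : Finset (Fin m))
  rw [Finset.card_fin] at hp
  let w := finBasisOfFinrankEq ℂ (joinTangent F Finset.univ p) hp
  have hw : LinearIndependent ℂ fun k => (w k : E) :=
    w.linearIndependent.map' (joinTangent F Finset.univ p).subtype (Submodule.ker_subtype _)
  obtain ⟨f, hf⟩ := exists_linearMap_eq_single hw
  rw [hrange]
  refine (zDimV_bounds (finBasis ℂ E) ψ fun i => mem_mvPolyFun.1 ?_).2 _ f fun Q hQ =>
    eq_zero_of_vanishing_on_sums F f p ?_ fun p' => hQ _ (hrange ▸ ⟨p', rfl⟩)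
  · have : (fun a => (finBasis ℂ E).repr (ψ a) i) = ∑ l, fun a : Fin m × κ × ν → ℂ =>
        ((finBasis ℂ E).coord i).compMultilinearMap F fun j k => a (l, j, k) := by
      funext a
      simp [ψ]
    rw [this]
    exact sum_mem fun l _ => Subalgebra.multilinear_apply_mem _ _ _ fun j k =>
      apply_mem_mvPolyFun (l, j, k)
  · rw [eq_top_iff, ← (Pi.basisFun ℂ (Fin (tangentRank F m))).span_eq, Submodule.span_le]
    rintro _ ⟨k, rfl⟩
    exact ⟨w k, (w k).2, by rw [hf, Pi.basisFun_apply]⟩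

theorem zClosureV_sums_eq_univ {ν κ : Type*} [Fintype ν] [Fintype κ] [DecidableEq κ]
    [FiniteDimensional ℂ E] (F : MultilinearMap ℂ (fun _ : κ => ν → ℂ) E) {m : ℕ}
    (hm : tangentRank F m = finrank ℂ E) :
    zClosureV (Set.range fun p : Fin m → κ → ν → ℂ => ∑ i, F (p i)) = Set.univ := by
  obtain ⟨p, hp⟩ := exists_finrank_joinTangent_eq F (Finset.univ : Finset (Fin m))
  rw [Finset.card_fin, hm] at hp
  refine Set.eq_univ_of_forall fun x => (mem_zClosureV (finBasis ℂ E)).2 fun Q hQ => ?_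
  rw [eq_zero_of_vanishing_on_sums F (finBasis ℂ E).equivFun.toLinearMap p
    (by rw [Submodule.eq_top_of_finrank_eq hp, Submodule.map_top]; simp) fun p' => hQ _ ⟨p', rfl⟩,
    map_zero]

end Independence

section ClosureOfSums

open Module

variable {E : Type*} [AddCommGroup E] [Module ℂ E] [FiniteDimensional ℂ E]

theorem add_mem_zClosureV {S T : Set E} {c x : E} (h : ∀ y ∈ S, y + c ∈ zClosureV T)
    (hx : x ∈ zClosureV S) : x + c ∈ zClosureV T := by
  let b := finBasis ℂ E
  rw [mem_zClosureV b] at hx ⊢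
  intro P hP
  have hshift : ∀ y, eval (fun i => b.repr (y + c) i) P =
      eval (fun i => b.repr y i) (aeval (fun i => X i + C (b.repr c i)) P) := by
    intro y
    rw [← aeval_eq_eval (fun i => b.repr y i), MvPolynomial.comp_aeval_apply, aeval_eq_eval]
    simp [aeval_eq_eval]
  rw [hshift]
  exact hx _ fun y hy => by
    rw [← hshift]
    exact (mem_zClosureV b).1 (h y hy) P hP

theorem secantV_zClosureV (m : ℕ) (S : Set E) : secantV m (zClosureV S) =
    zClosureV {p | ∃ x : Fin m → E, (∀ i, x i ∈ S) ∧ p = ∑ i, x i} := by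
  refine Set.Subset.antisymm (zClosureV_minimal ?_) (zClosureV_minimal ?_)
  · rintro _ ⟨x, hx, rfl⟩
    suffices H : ∀ (s : Finset (Fin m)) (x : Fin m → E), (∀ i ∈ s, x i ∈ zClosureV S) →
        (∀ i ∉ s, x i ∈ S) →
          ∑ i, x i ∈ zClosureV {p | ∃ x : Fin m → E, (∀ i, x i ∈ S) ∧ p = ∑ i, x i} from
      H Finset.univ x (fun i _ => hx i) (by simp)
    intro s
    induction s using Finset.induction_on with
    | empty => exact fun x _ hx => subset_zClosureV _ ⟨x, fun i => hx i (by simp), rfl⟩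
    | insert a s ha ih =>
      intro x hxs hx
      rw [← Finset.add_sum_erase _ _ (Finset.mem_univ a)]
      refine add_mem_zClosureV (fun y hy => ?_) (hxs a (by simp))
      have hsum : y + ∑ i ∈ Finset.univ.erase a, x i = ∑ i, Function.update x a y i := by
        rw [← Finset.add_sum_erase _ _ (Finset.mem_univ a), Function.update_self]
        congr 1
        exact Finset.sum_congr rfl fun i hi =>
          (Function.update_of_ne (Finset.ne_of_mem_erase hi) _ _).symm
      rw [hsum]
      refine ih _ (fun i hi => ?_) fun i hi => ?_
      · rw [Function.update_of_ne (fun h : i = a => ha (h ▸ hi))]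
        exact hxs i (by simp [hi])
      · by_cases hia : i = a
        · subst hia
          simpa using hy
        · rw [Function.update_of_ne hia]
          exact hx i (by simp [hia, hi])
  · rintro _ ⟨x, hx, rfl⟩
    exact subset_zClosureV _ ⟨x, fun i => subset_zClosureV S (hx i), rfl⟩

theorem secantV_one_zClosureV (S : Set E) : secantV 1 (zClosureV S) = zClosureV S := by
  rw [secantV_zClosureV]
  congr 1
  ext y
  constructor
  · rintro ⟨x, hx, rfl⟩
    simpa using hx 0
  · exact fun hy => ⟨fun _ => y, fun _ => hy, by simp⟩

end ClosureOfSums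

section ChowMap

open Module

/-- The linear form with given coefficients. -/
def linForm (n : ℕ) : (Fin n → ℂ) →ₗ[ℂ] MvPolynomial (Fin n) ℂ :=
  Fintype.linearCombination ℂ X

theorem linForm_apply {n : ℕ} (v : Fin n → ℂ) : linForm n v = ∑ i, v i • X i :=
  Fintype.linearCombination_apply ℂ X v

theorem eval_linForm {n : ℕ} (v z : Fin n → ℂ) : eval z (linForm n v) = ∑ i, v i * z i := by
  simp [linForm_apply, smul_eval]

theorem range_linForm (n : ℕ) : LinearMap.range (linForm n) = homogeneousSubmodule (Fin n) ℂ 1 := by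
  rw [homogeneousSubmodule_one_eq_span_X, linForm, Fintype.range_linearCombination]

theorem isHomogeneous_linForm {n : ℕ} (v : Fin n → ℂ) : (linForm n v).IsHomogeneous 1 := by
  rw [← mem_homogeneousSubmodule, ← range_linForm]
  exact LinearMap.mem_range_self _ v

/-- The product of linear forms as a multilinear map. -/
def chowMap (n d : ℕ) :
    MultilinearMap ℂ (fun _ : Fin d => Fin n → ℂ) (homogeneousSubmodule (Fin n) ℂ d) :=
  ((MultilinearMap.mkPiAlgebra ℂ (Fin d) (MvPolynomial (Fin n) ℂ)).compLinearMap
    fun _ => linForm n).codRestrict _ fun v => by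
      rw [mem_homogeneousSubmodule]
      simpa using! IsHomogeneous.prod Finset.univ (fun i => linForm n (v i)) (fun _ => 1)
        fun i _ => isHomogeneous_linForm (v i)

theorem coe_chowMap {n d : ℕ} (v : Fin d → Fin n → ℂ) :
    (chowMap n d v : MvPolynomial (Fin n) ℂ) = ∏ i, linForm n (v i) := rfl

theorem chowVariety_eq (n d : ℕ) : ChowVariety n d = zClosureV (Set.range (chowMap n d)) := by
  rw [ChowVariety]
  congr 1
  ext f
  constructor
  · rintro ⟨ℓ, hℓ, hf⟩
    simp only [← range_linForm] at hℓ
    choose v hv using hℓ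
    exact ⟨v, Subtype.ext (by rw [hf, coe_chowMap]; simp only [hv])⟩
  · rintro ⟨v, rfl⟩
    exact ⟨fun i => linForm n (v i), fun i => isHomogeneous_linForm (v i), rfl⟩

instance finite_homogeneousSubmodule (n d : ℕ) :
    FiniteDimensional ℂ (homogeneousSubmodule (Fin n) ℂ d) :=
  Module.Finite.iff_fg.2 (homogeneousSubmodule_fg (Fin n) ℂ d)

theorem finrank_homogeneousSubmodule (n d : ℕ) :
    finrank ℂ (homogeneousSubmodule (Fin n) ℂ d) = Nat.choose (n + d - 1) d := by
  rw [homogeneousSubmodule_eq_finsupp_supported]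
  refine (finrank_eq_nat_card_basis (basisRestrictSupport ℂ {s : Fin n →₀ ℕ | s.degree = d})).trans
    ?_
  have : {s : Fin n →₀ ℕ | s.degree = d} =
      ↑(Finset.univ.finsuppAntidiag d : Finset (Fin n →₀ ℕ)) := by
    ext s
    simp [Finsupp.degree_eq_sum]
  rw [this, Nat.card_coe_set_eq, Set.ncard_coe_finset, Finset.card_finsuppAntidiag_nat_eq_choose,
    Finset.card_fin]

/-- Linear substitution of variables in forms. -/
def substForm (n d : ℕ) (g : (Fin n → ℂ) →ₗ[ℂ] (Fin n → ℂ)) :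
    homogeneousSubmodule (Fin n) ℂ d →ₗ[ℂ] homogeneousSubmodule (Fin n) ℂ d :=
  (aeval fun i => linForm n (g (Pi.single i 1))).toLinearMap.restrict fun f hf => by
    simpa using! IsHomogeneous.aeval hf _ fun i => isHomogeneous_linForm (g (Pi.single i 1))

theorem coe_substForm {n d : ℕ} (g : (Fin n → ℂ) →ₗ[ℂ] (Fin n → ℂ))
    (f : homogeneousSubmodule (Fin n) ℂ d) : (substForm n d g f : MvPolynomial (Fin n) ℂ) =
      aeval (fun i => linForm n (g (Pi.single i 1))) (f : MvPolynomial (Fin n) ℂ) := rfl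

theorem substForm_chowMap {n d : ℕ} (g : (Fin n → ℂ) →ₗ[ℂ] (Fin n → ℂ))
    (p : Fin d → Fin n → ℂ) : substForm n d g (chowMap n d p) = chowMap n d fun i => g (p i) := by
  apply Subtype.ext
  rw [coe_substForm, coe_chowMap, coe_chowMap, map_prod]
  refine Finset.prod_congr rfl fun i _ => ?_
  conv_rhs => rw [pi_eq_sum_univ' (p i)]
  simp [linForm_apply (p i), map_sum]

theorem linearMap_eq_zero_of_powers {n d : ℕ} (φ : homogeneousSubmodule (Fin n) ℂ d →ₗ[ℂ] ℂ)
    (hφ : ∀ w, φ (chowMap n d fun _ => w) = 0) : φ = 0 := by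
  obtain ⟨Φ, rfl⟩ := LinearMap.exists_extend φ
  let S : Finset (Fin n →₀ ℕ) := Finset.univ.finsuppAntidiag d
  have hS : ∀ s, s ∈ S ↔ (s.sum fun _ k => k) = d := fun s => by
    simp [S, Finsupp.sum_fintype]
  have hexp : ∀ f ∈ homogeneousSubmodule (Fin n) ℂ d,
      Φ f = ∑ s ∈ S, coeff s f * Φ (monomial s 1) := by
    intro f hf
    conv_lhs => rw [f.as_sum]
    rw [map_sum]
    have hmon : ∀ s, Φ (monomial s (coeff s f)) = coeff s f * Φ (monomial s 1) := fun s => by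
      rw [← smul_eq_mul, ← map_smul, smul_monomial, smul_eq_mul, mul_one]
    simp only [hmon]
    refine Finset.sum_subset (fun s hs => ?_) fun s _ hs => ?_
    · rw [hS]
      have := hf (mem_support_iff.1 hs)
      simpa [Finsupp.weight_apply] using this
    · rw [notMem_support_iff.1 hs, zero_mul]
  have hzero : ∑ s ∈ S, monomial s ((s.multinomial : ℂ) * Φ (monomial s 1)) = 0 := by
    refine MvPolynomial.funext fun w => ?_
    have h1 := hφ w
    rw [LinearMap.comp_apply, Submodule.subtype_apply, hexp _ (Subtype.mem _), coe_chowMap,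
      Finset.prod_const, Finset.card_fin, linForm_apply] at h1
    rw [map_sum, map_zero, ← h1]
    refine Finset.sum_congr rfl fun s hs => ?_
    rw [coeff_linearCombination_X_pow_of_fintype, if_pos ((hS s).1 hs), eval_monomial]
    ring
  have hcoeff : ∀ s ∈ S, Φ (monomial s 1) = 0 := by
    intro s hs
    have h1 := congrArg (coeff s) hzero
    simp only [coeff_sum, coeff_monomial, Finset.sum_ite_eq', hs, if_true, coeff_zero] at h1
    exact (mul_eq_zero.1 h1).resolve_left (Nat.cast_ne_zero.2 (Nat.multinomial_pos _ _).ne')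
  ext f
  rw [LinearMap.comp_apply, Submodule.subtype_apply, hexp _ f.2, LinearMap.zero_apply]
  exact Finset.sum_eq_zero fun s hs => by rw [hcoeff s hs, mul_zero]

theorem linearMap_eq_zero_of_substForm {n d : ℕ} (v : homogeneousSubmodule (Fin n) ℂ d)
    (hv : v ≠ 0) (φ : homogeneousSubmodule (Fin n) ℂ d →ₗ[ℂ] ℂ)
    (hφ : ∀ g, φ (substForm n d g v) = 0) : φ = 0 := by
  obtain ⟨z, hz⟩ : ∃ z, eval z (v : MvPolynomial (Fin n) ℂ) ≠ 0 := by
    by_contra! h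
    exact hv (Subtype.ext (MvPolynomial.funext fun z => by simpa using h z))
  refine linearMap_eq_zero_of_powers φ fun w => ?_
  have key : substForm n d ((Fintype.linearCombination ℂ z).smulRight w) v =
      eval z (v : MvPolynomial (Fin n) ℂ) • chowMap n d fun _ => w := by
    apply Subtype.ext
    rw [coe_substForm, Submodule.coe_smul, coe_chowMap, Finset.prod_const, Finset.card_fin]
    have hg : ∀ i, linForm n ((Fintype.linearCombination ℂ z).smulRight w (Pi.single i 1)) =
        C (z i) * linForm n w := fun i => by
      simp [Fintype.linearCombination_apply_single, smul_eq_C_mul]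
    simp only [hg]
    conv_lhs => rw [(v : MvPolynomial (Fin n) ℂ).as_sum]
    rw [map_sum, eval_eq', Finset.sum_smul]
    refine Finset.sum_congr rfl fun s hs => ?_
    have hdeg : ∑ i, s i = d := by
      have := v.2 (mem_support_iff.1 hs)
      simpa [Finsupp.weight_apply, Finsupp.sum_fintype] using this
    rw [aeval_monomial, Finsupp.prod_fintype _ _ (by simp)]
    simp only [mul_pow, Finset.prod_mul_distrib, Finset.prod_pow_eq_pow_sum, hdeg]
    rw [smul_eq_C_mul, map_mul, map_prod, ← mul_assoc]
    simp [algebraMap_eq]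
  have h1 := hφ ((Fintype.linearCombination ℂ z).smulRight w)
  rw [key, map_smul, smul_eq_mul] at h1
  exact (mul_eq_zero.1 h1).resolve_left hz

end ChowMap

section ChowDimension

open Module

theorem eval_linearDeriv_chowMap {n d : ℕ} (p q : Fin d → Fin n → ℂ) (z : Fin n → ℂ) :
    eval z ((chowMap n d).linearDeriv p q : MvPolynomial (Fin n) ℂ) =
      ∑ i, (∑ k, q i k * z k) * ∏ j ∈ Finset.univ.erase i, ∑ k, p j k * z k := by
  rw [MultilinearMap.linearDeriv_apply, Submodule.coe_sum, map_sum]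
  refine Finset.sum_congr rfl fun i _ => ?_
  rw [coe_chowMap, map_prod, ← Finset.mul_prod_erase _ _ (Finset.mem_univ i), eval_linForm,
    Function.update_self]
  congr 1
  refine Finset.prod_congr rfl fun j hj => ?_
  rw [Function.update_of_ne (Finset.ne_of_mem_erase hj), eval_linForm]

/-- Tangent directions whose leading coefficients vanish except in the first factor. -/
def chowDirection (n d : ℕ) :
    ((Fin (d + 1) → Fin n → ℂ) × ℂ) →ₗ[ℂ] (Fin (d + 1) → Fin (n + 1) → ℂ) where
  toFun x i := Fin.cons (if i = 0 then x.2 else 0) (x.1 i)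
  map_add' x y := by
    ext i k
    refine Fin.cases ?_ (fun k => ?_) k
    · by_cases hi : i = 0 <;> simp [hi]
    · simp
  map_smul' c x := by
    ext i k
    refine Fin.cases ?_ (fun k => ?_) k
    · by_cases hi : i = 0 <;> simp [hi]
    · simp

theorem chowDirection_apply {n d : ℕ} (x : (Fin (d + 1) → Fin n → ℂ) × ℂ) (i : Fin (d + 1)) :
    chowDirection n d x i = Fin.cons (if i = 0 then x.2 else 0) (x.1 i) := rfl

theorem injective_linearDeriv_comp_chowDirection (n d : ℕ) :
    Function.Injective ((chowMap (n + 1) (d + 1)).linearDeriv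
      (fun j => Fin.cons 1 fun _ => ((j : ℕ) : ℂ)) ∘ₗ chowDirection n d) := by
  rw [← LinearMap.ker_eq_bot, LinearMap.ker_eq_bot']
  rintro ⟨q, c⟩ h
  have hz : ∀ z, _ = _ := fun z =>
    (eval_linearDeriv_chowMap _ (chowDirection n d (q, c)) z).symm.trans
    (congrArg (fun f : homogeneousSubmodule (Fin (n + 1)) ℂ (d + 1) =>
      eval z (f : MvPolynomial (Fin (n + 1)) ℂ)) h)
  simp only [chowDirection_apply, Fin.sum_univ_succ (n := n), Fin.cons_zero, Fin.cons_succ,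
    ZeroMemClass.coe_zero, map_zero] at hz
  refine Prod.ext (funext₂ fun i k => ?_) ?_
  · have hi := hz (Fin.cons (-((i : ℕ) : ℂ)) (Pi.single k 1))
    simp only [Fin.cons_zero, Fin.cons_succ, Pi.single_apply, mul_ite, mul_one, mul_zero,
      Finset.sum_ite_eq', Finset.mem_univ, if_true] at hi
    rw [Finset.sum_eq_single_of_mem i (Finset.mem_univ i)] at hi
    · have hprod : ∏ j ∈ Finset.univ.erase i, (1 * -((i : ℕ) : ℂ) + ((j : ℕ) : ℂ)) ≠ 0 := by
        refine Finset.prod_ne_zero_iff.2 fun j hj hij => Finset.ne_of_mem_erase hj (Fin.ext ?_)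
        have hij' : ((i : ℕ) : ℂ) = ((j : ℕ) : ℂ) := neg_add_eq_zero.1 (by simpa using hij)
        exact_mod_cast hij'.symm
      have := (mul_eq_zero.1 hi).resolve_right hprod
      by_cases hi0 : i = 0
      · subst hi0
        simpa using this
      · simpa [hi0] using this
    · intro j _ hj
      rw [Finset.prod_eq_zero (Finset.mem_erase.2 ⟨hj.symm, Finset.mem_univ i⟩) (by ring), mul_zero]
  · simpa using hz (Pi.single 0 1)

theorem le_tangentRank_chowMap (n d : ℕ) :
    (d + 1) * n + 1 ≤ tangentRank (chowMap (n + 1) (d + 1)) 1 := by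
  let p : Fin (d + 1) → Fin (n + 1) → ℂ := fun j => Fin.cons 1 fun _ => ((j : ℕ) : ℂ)
  have h1 := LinearMap.finrank_range_of_inj (injective_linearDeriv_comp_chowDirection n d)
  have h2 := Submodule.finrank_mono (LinearMap.range_comp_le_range (chowDirection n d)
    ((chowMap (n + 1) (d + 1)).linearDeriv p))
  have h3 := finrank_joinTangent_le (chowMap (n + 1) (d + 1)) {()} fun _ => p
  rw [joinTangent_singleton, Finset.card_singleton] at h3
  refine le_trans (le_of_eq ?_) (h1.symm.le.trans (h2.trans h3))
  simp [Module.finrank_pi_fintype]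

/-- Multiples of products of linear forms whose leading coefficients are one. -/
def chowChart (n d : ℕ) (a : Option (Fin d × Fin n) → ℂ) :
    homogeneousSubmodule (Fin (n + 1)) ℂ d :=
  a none • chowMap (n + 1) d fun i => Fin.cons 1 fun k => a (some (i, k))

theorem chowMap_mem_range_chowChart {n d : ℕ} {p : Fin d → Fin (n + 1) → ℂ}
    (hp : ∀ i, p i 0 ≠ 0) : chowMap (n + 1) d p ∈ Set.range (chowChart n d) := by
  refine ⟨fun o => o.elim (∏ i, p i 0) fun x => (p x.1 0)⁻¹ * p x.1 x.2.succ, ?_⟩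
  simp only [chowChart, Option.elim_none, Option.elim_some]
  rw [← MultilinearMap.map_smul_univ]
  congr 1
  ext i k
  refine Fin.cases ?_ (fun k => ?_) k
  · simp
  · simp [hp i]

theorem chowMap_mem_zClosureV_range_chowChart {n d : ℕ} (p : Fin d → Fin (n + 1) → ℂ) :
    chowMap (n + 1) d p ∈ zClosureV (Set.range (chowChart n d)) := by
  let b := finBasis ℂ (homogeneousSubmodule (Fin (n + 1)) ℂ d)
  refine (mem_zClosureV b).2 fun h hh => ?_
  let γ : ℂ → Fin d → Fin (n + 1) → ℂ := fun s i k =>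
    p i k + s * (Pi.single 0 1 : Fin (n + 1) → ℂ) k
  have hγ : (fun s => eval (fun j => b.repr (chowMap (n + 1) d (γ s)) j) h) ∈ polyFun :=
    polyFun.eval_mem _ (fun j => polyFun.multilinear_apply_mem
      ((b.coord j).compMultilinearMap (chowMap (n + 1) d)) γ
        fun i k => affine_mem_polyFun (p i k) _) h
  have hγ0 : γ 0 = p := by
    ext i k
    simp [γ]
  by_contra hne
  rw [← hγ0] at hne
  refine Set.infinite_univ ((finite_zeros_of_mem_polyFun hγ hne).union
    (Set.finite_range fun i => -p i 0) |>.subset fun s _ => ?_)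
  by_contra hs
  rw [Set.mem_union, not_or] at hs
  refine hs.1 (hh _ (chowMap_mem_range_chowChart fun i hi => hs.2 ⟨i, ?_⟩))
  simp only [γ, Pi.single_eq_same, mul_one] at hi
  linear_combination -hi

theorem chowVariety_eq_zClosureV_range_chowChart (n d : ℕ) :
    ChowVariety (n + 1) (d + 1) = zClosureV (Set.range (chowChart n (d + 1))) := by
  rw [chowVariety_eq]
  refine Set.Subset.antisymm (zClosureV_minimal ?_) (zClosureV_minimal ?_)
  · rintro _ ⟨p, rfl⟩
    exact chowMap_mem_zClosureV_range_chowChart p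
  · rintro _ ⟨a, rfl⟩
    let q : Fin (d + 1) → Fin (n + 1) → ℂ := fun i => Fin.cons 1 fun k => a (some (i, k))
    refine subset_zClosureV _ ⟨Function.update q 0 (a none • q 0), ?_⟩
    rw [MultilinearMap.map_update_smul, Function.update_eq_self, chowChart]

theorem secantV_zClosureV_range {E α : Type*} [AddCommGroup E] [Module ℂ E]
    [FiniteDimensional ℂ E] (m : ℕ) (f : α → E) : secantV m (zClosureV (Set.range f)) =
      zClosureV (Set.range fun p : Fin m → α => ∑ i, f (p i)) := by
  rw [secantV_zClosureV]
  congr 1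
  ext y
  constructor
  · rintro ⟨x, hx, rfl⟩
    choose p hp using hx
    exact ⟨p, by simp only [hp]⟩
  · rintro ⟨p, rfl⟩
    exact ⟨fun i => f (p i), fun i => ⟨p i, rfl⟩, rfl⟩

theorem zDimV_secantV_chowVariety_le (n d m : ℕ) :
    zDimV (secantV m (ChowVariety (n + 1) (d + 1))) ≤
      ((m * ((d + 1) * n + 1) : ℕ) : WithBot ℕ∞) := by
  let ψ : (Fin m × Option (Fin (d + 1) × Fin n) → ℂ) →
      homogeneousSubmodule (Fin (n + 1)) ℂ (d + 1) := fun a =>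
    ∑ l, chowChart n (d + 1) fun o => a (l, o)
  have hψ : (Set.range fun p : Fin m → Option (Fin (d + 1) × Fin n) → ℂ =>
      ∑ l, chowChart n (d + 1) (p l)) = Set.range ψ := by
    refine Set.Subset.antisymm ?_ ?_
    · rintro _ ⟨p, rfl⟩
      exact ⟨fun x => p x.1 x.2, rfl⟩
    · rintro _ ⟨a, rfl⟩
      exact ⟨fun l o => a (l, o), rfl⟩
  rw [chowVariety_eq_zClosureV_range_chowChart, secantV_zClosureV_range, hψ]
  let b := finBasis ℂ (homogeneousSubmodule (Fin (n + 1)) ℂ (d + 1))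
  refine (zDimV_bounds b ψ fun j => mem_mvPolyFun.1 ?_).1.trans (le_of_eq ?_)
  · have : (fun a => b.repr (ψ a) j) = ∑ l, (fun a => a (l, none)) *
        fun a => (b.coord j).compMultilinearMap (chowMap (n + 1) (d + 1))
          fun i => Fin.cons 1 fun k => a (l, some (i, k)) := by
      funext a
      simp [ψ, chowChart]
    rw [this]
    refine sum_mem fun l _ => mul_mem (apply_mem_mvPolyFun _)
      (Subalgebra.multilinear_apply_mem _ _ _ fun i k => ?_)
    refine Fin.cases ?_ (fun k => ?_) k
    · exact (mvPolyFun _).one_mem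
    · simpa using apply_mem_mvPolyFun (l, some (i, k))
  · simp

theorem tangentRank_chowMap_one (n d : ℕ) :
    tangentRank (chowMap (n + 1) (d + 1)) 1 = (d + 1) * n + 1 := by
  refine le_antisymm ?_ (le_tangentRank_chowMap n d)
  have h := tangentRank_le_zDimV (chowMap (n + 1) (d + 1)) 1
  rw [← secantV_zClosureV_range, ← chowVariety_eq] at h
  have := h.trans (zDimV_secantV_chowVariety_le n d 1)
  rw [one_mul] at this
  exact_mod_cast this

theorem zDimV_secantV_chowVariety_of_tangentRank {n d m : ℕ}
    (h : tangentRank (chowMap (n + 1) (d + 1)) m = m * ((d + 1) * n + 1)) :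
    zDimV (secantV m (ChowVariety (n + 1) (d + 1))) =
      ((m * ((d + 1) * n + 1) : ℕ) : WithBot ℕ∞) := by
  refine le_antisymm (zDimV_secantV_chowVariety_le n d m) ?_
  rw [← h, chowVariety_eq, secantV_zClosureV_range]
  exact_mod_cast tangentRank_le_zDimV (chowMap (n + 1) (d + 1)) m

end ChowDimension

theorem stmt_11 (n d : ℕ) (hn : 1 ≤ n) (hd : 1 ≤ d) (N : ℕ) (hN : N = d * (n - 1) + 1) :
    zDimV (ChowVariety n d) = (N : WithBot ℕ∞) ∧
    (∀ m : ℕ, 1 ≤ m → N * (m + N) ≤ Nat.choose (n + d - 1) d →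
      zDimV (secantV m (ChowVariety n d)) = ((m * N : ℕ) : WithBot ℕ∞)) ∧
    (∀ m : ℕ, 1 ≤ m → Nat.choose (n + d - 1) d + N ^ 2 ≤ m * N →
      secantV m (ChowVariety n d) = Set.univ) := by
  obtain ⟨n, rfl⟩ := Nat.exists_eq_add_of_le' hn
  obtain ⟨d, rfl⟩ := Nat.exists_eq_add_of_le' hd
  rw [Nat.add_sub_cancel] at hN
  have hone : tangentRank (chowMap (n + 1) (d + 1)) 1 = N :=
    (tangentRank_chowMap_one n d).trans hN.symm
  obtain ⟨hlow, hhigh⟩ := slope_sequence (tangentRank_zero (chowMap (n + 1) (d + 1)))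
    (tangentRank_le_succ _) (tangentRank_succ_le _) (tangentRank_le_finrank _)
    fun k => tangentRank_step _ (substForm (n + 1) (d + 1)) substForm_chowMap
      linearMap_eq_zero_of_substForm
  rw [hone, finrank_homogeneousSubmodule] at hlow hhigh
  subst hN
  refine ⟨?_, fun m _ hm => zDimV_secantV_chowVariety_of_tangentRank (hlow m hm), fun m _ hm => ?_⟩
  · have := zDimV_secantV_chowVariety_of_tangentRank (hone.trans (one_mul _).symm)
    rwa [one_mul, chowVariety_eq, secantV_one_zClosureV, ← chowVariety_eq] at this
  · rw [chowVariety_eq, secantV_zClosureV_range]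
    exact zClosureV_sums_eq_univ _ ((hhigh m hm).trans (finrank_homogeneousSubmodule _ _).symm)
end
end
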